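/- arXiv:1601.02173 — 4 statements merged into one kernel-verified Lean document; each statement's English description precedes it below -/
import Mathlib

section
/- Let n, m ≥ 1, let ω : (0,∞) → [0,∞) be non-decreasing and satisfy the log-Dini(1) condition, let K be an m-linear Calderón–Zygmund kernel of ω type with constant C₀ > 0 on ℝⁿ, and let T be an m-linear operator on m-tuples of integrable functions with the kernel representation: for all compactly supported f₁,…,f_m ∈ L¹(ℝⁿ) and a.e. x ∉ ⋂_j supp f_j, T(f⃗)(x) = ∫_{(ℝⁿ)^m} K(x,y₁,…,y_m)∏_j f_j(y_j) dy⃗. Let b₁,…,b_m be locally integrable with finite BMO seminorms and define T_{b⃗}(f⃗) = ∑_{j=1}^m [b_j·T(f₁,…,f_m) − T(f₁,…,b_jf_j,…,f_m)]. Assume C₁, C₂ > 0 satisfy: |{x : |T_{b⃗}(f⃗)(x)| > λ}| ≤ (C₁∏_j‖f_j‖_{L²}/λ)^{2/m} for all bounded compactly supported f_j and λ > 0, and |{x : |T(f⃗)(x)| > λ}| ≤ (C₂∏_j‖f_j‖_{L¹}/λ)^{1/m} for all f_j ∈ L¹(ℝⁿ) and λ > 0. Then there is C, depending only on n, m, ω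 and ‖b₁‖_*,…,‖b_m‖_*, such that for every λ > 0 and all f₁,…,f_m that are finite sums of (1,∞,0)-atoms supported on dyadic cubes with coefficient ℓ¹-sums at most 1, |{x ∈ ℝⁿ : |T_{b⃗}(f⃗)(x)| > λ}| ≤ C·(C₀+C₁+C₂)^{1/m}·λ^{−1/m}. -/
open MeasureTheory Set
open scoped ENNReal

noncomputable section

/-- Euclidean space `ℝⁿ`. -/
abbrev Rn (n : ℕ) : Type := EuclideanSpace ℝ (Fin n)

/-- A dyadic cube `∏ [2^k mᵢ, 2^k (mᵢ+1))` in `ℝⁿ`. -/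
def IsDyadicCube {n : ℕ} (Q : Set (Rn n)) : Prop :=
  ∃ (k : ℤ) (m : Fin n → ℤ),
    Q = {x : Rn n | ∀ i, (2:ℝ) ^ k * (m i : ℝ) ≤ x i ∧ x i < (2:ℝ) ^ k * ((m i : ℝ) + 1)}

/-- The (closed) axis-parallel cube with center `c` and side length `l`. -/
def cube {n : ℕ} (c : Rn n) (l : ℝ) : Set (Rn n) :=
  {x : Rn n | ∀ i, |x i - c i| ≤ l / 2}

/-- The average `b_Q = |Q|⁻¹ ∫_Q b`. -/
def avgOn {n : ℕ} (b : Rn n → ℝ) (Q : Set (Rn n)) : ℝ := ⨍ x in Q, b x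

/-- `b` has mean oscillation at most `M` on every cube; i.e. `‖b‖_* ≤ M`. -/
def OscBound {n : ℕ} (b : Rn n → ℝ) (M : ℝ) : Prop :=
  ∀ (c : Rn n) (l : ℝ), 0 < l →
    ⨍ x in cube c l, |b x - avgOn b (cube c l)| ≤ M

/-- A `(1,∞,0)`-atom supported on the set `Q`. -/
def IsH1Atom {n : ℕ} (Q : Set (Rn n)) (a : Rn n → ℝ) : Prop :=
  Measurable a ∧ (∀ x, x ∉ Q → a x = 0) ∧
    (∀ᵐ x ∂volume, |a x| ≤ ((volume Q).toReal)⁻¹) ∧ (∫ x, a x) = 0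

/-- The `L¹` norm. -/
def l1norm {n : ℕ} (f : Rn n → ℝ) : ℝ := ∫ x, |f x|

/-- The `L²` norm. -/
def l2norm {n : ℕ} (f : Rn n → ℝ) : ℝ := (∫ x, (f x) ^ 2) ^ ((1:ℝ)/2)

/-- A finite sum `∑ λ_k a_k` of `(1,∞,0)`-atoms on dyadic cubes with `∑ |λ_k| ≤ 1`. -/
def FiniteAtomicSum {n : ℕ} (f : Rn n → ℝ) : Prop :=
  ∃ (N : ℕ) (Q : Fin N → Set (Rn n)) (a : Fin N → Rn n → ℝ) (lam : Fin N → ℝ),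
    (∀ k, IsDyadicCube (Q k)) ∧ (∀ k, IsH1Atom (Q k) (a k)) ∧
    (∑ k, |lam k|) ≤ 1 ∧ ∀ x, f x = ∑ k, lam k * a k x

/-- An `m`-linear Calderón–Zygmund kernel of `ω` type with constant `C₀` on `ℝⁿ`.
The condition `|u| ≤ (1/2)·max_j |x - y_j|` is phrased as `∃ j, |u| ≤ (1/2)·|x - y_j|`. -/
def IsCZKernelM {n m : ℕ} (C₀ : ℝ) (ω : ℝ → ℝ)
    (K : Rn n → (Fin m → Rn n) → ℝ) : Prop :=
  (∀ (x : Rn n) (y : Fin m → Rn n), (¬ ∀ j, y j = x) →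
      |K x y| ≤ C₀ / (∑ j, ‖x - y j‖) ^ (m * n)) ∧
  (∀ (x x' : Rn n) (y : Fin m → Rn n), (¬ ∀ j, y j = x) →
      (∃ j, ‖x - x'‖ ≤ (1/2) * ‖x - y j‖) →
      |K x y - K x' y| ≤
        C₀ / (∑ j, ‖x - y j‖) ^ (m * n) * ω (‖x - x'‖ / ∑ j, ‖x - y j‖)) ∧
  (∀ (x : Rn n) (y : Fin m → Rn n) (i : Fin m) (y' : Rn n), (¬ ∀ j, y j = x) →
      (∃ j, ‖y i - y'‖ ≤ (1/2) * ‖x - y j‖) →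
      |K x y - K x (Function.update y i y')| ≤
        C₀ / (∑ j, ‖x - y j‖) ^ (m * n) * ω (‖y i - y'‖ / ∑ j, ‖x - y j‖))

/-- `T` is additive and homogeneous in each of its `m` entries (on integrable functions). -/
def MultilinM {n m : ℕ} (T : (Fin m → Rn n → ℝ) → Rn n → ℝ) : Prop :=
  (∀ (f : Fin m → Rn n → ℝ) (j : Fin m) (g g' : Rn n → ℝ),
      (∀ k, Integrable (f k)) → Integrable g → Integrable g' → ∀ x,
      T (Function.update f j (fun y => g y + g' y)) x =
        T (Function.update f j g) x + T (Function.update f j g') x) ∧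
  (∀ (f : Fin m → Rn n → ℝ) (j : Fin m) (r : ℝ) (g : Rn n → ℝ),
      (∀ k, Integrable (f k)) → Integrable g → ∀ x,
      T (Function.update f j (fun y => r * g y)) x = r * T (Function.update f j g) x)

/-- `T` is represented by the kernel `K` off the supports of the arguments. -/
def KernelRepM {n m : ℕ} (K : Rn n → (Fin m → Rn n) → ℝ)
    (T : (Fin m → Rn n → ℝ) → Rn n → ℝ) : Prop :=
  ∀ f : Fin m → Rn n → ℝ, (∀ j, Integrable (f j)) → (∀ j, HasCompactSupport (f j)) →
    ∀ᵐ x ∂volume, x ∉ ⋂ j, tsupport (f j) →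
      T f x = ∫ y : Fin m → Rn n, K x y * ∏ j, f j (y j)

section Geometry

variable {n : ℕ}

lemma measurableSet_cube (c : Rn n) (l : ℝ) : MeasurableSet (cube c l) := by
  have : cube c l = ⋂ i, {x : Rn n | |x i - c i| ≤ l / 2} := by ext x; simp [cube]
  rw [this]
  exact MeasurableSet.iInter fun i => measurableSet_le (by fun_prop) (by fun_prop)

lemma isClosed_cube (c : Rn n) (l : ℝ) : IsClosed (cube c l) := by
  have : cube c l = ⋂ i, {x : Rn n | |x i - c i| ≤ l / 2} := by ext x; simp [cube]
  rw [this]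
  exact isClosed_iInter fun i => isClosed_le (by fun_prop) (by fun_prop)

lemma volume_setOf_forall_mem (s : Fin n → Set ℝ) :
    volume {x : Rn n | ∀ i, x i ∈ s i} = ∏ i, volume (s i) := by
  have h : {x : Rn n | ∀ i, x i ∈ s i}
      = (MeasurableEquiv.toLp 2 (Fin n → ℝ)).symm ⁻¹' (Set.univ.pi s) := by
    ext x; simp
  rw [h, (EuclideanSpace.volume_preserving_symm_measurableEquiv_toLp (Fin n)).measure_preimage_equiv,
    volume_pi_pi]

lemma volume_cube (c : Rn n) {l : ℝ} (hl : 0 ≤ l) :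
    volume (cube c l) = ENNReal.ofReal (l ^ n) := by
  have : cube c l = {x : Rn n | ∀ i, x i ∈ Icc (c i - l / 2) (c i + l / 2)} := by
    ext x
    simp only [cube, mem_ofPred_eq, mem_Icc, abs_le]
    refine forall_congr' fun i => ⟨fun h => ⟨?_, ?_⟩, fun h => ⟨?_, ?_⟩⟩ <;> linarith [h.1, h.2]
  rw [this, volume_setOf_forall_mem]
  simp only [Real.volume_Icc, add_sub_sub_cancel, add_halves, Finset.prod_const, Finset.card_univ,
    Fintype.card_fin]
  rw [ENNReal.ofReal_pow hl]

lemma abs_apply_sub_le (x c : Rn n) (i : Fin n) : |x i - c i| ≤ ‖x - c‖ := by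
  have := PiLp.norm_apply_le (x - c) i
  simpa using this

lemma closedBall_subset_cube (c : Rn n) (r : ℝ) : Metric.closedBall c r ⊆ cube c (2 * r) := by
  intro x hx i
  rw [Metric.mem_closedBall, dist_eq_norm] at hx
  have := abs_apply_sub_le x c i
  linarith

lemma ball_subset_cube (c : Rn n) (r : ℝ) : Metric.ball c r ⊆ cube c (2 * r) :=
  Metric.ball_subset_closedBall.trans (closedBall_subset_cube c r)

lemma cube_subset_cube (c : Rn n) {l l' : ℝ} (h : l ≤ l') : cube c l ⊆ cube c l' :=
  fun x hx i => (hx i).trans (by linarith)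

lemma norm_sub_le_of_mem_cube {c x : Rn n} {l : ℝ} (hl : 0 ≤ l) (hx : x ∈ cube c l) :
    ‖x - c‖ ≤ 2 ^ n * l / 2 := by
  rw [EuclideanSpace.norm_eq]
  refine Real.sqrt_le_iff.mpr ⟨by positivity, ?_⟩
  have h1 : ∀ i, ‖(x - c) i‖ ^ 2 ≤ (l / 2) ^ 2 := by
    intro i
    have := hx i
    simp only [PiLp.sub_apply, Real.norm_eq_abs]
    gcongr
  calc ∑ i, ‖(x - c) i‖ ^ 2 ≤ ∑ _i : Fin n, (l / 2) ^ 2 := Finset.sum_le_sum fun i _ => h1 i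
    _ = n * (l / 2) ^ 2 := by simp
    _ ≤ (2 ^ n) ^ 2 * (l / 2) ^ 2 := by
        gcongr
        have h2 : (n : ℝ) ≤ 2 ^ n := by exact_mod_cast (Nat.lt_two_pow_self (n := n)).le
        have h3 : (1 : ℝ) ≤ 2 ^ n := one_le_pow₀ (by norm_num)
        nlinarith
    _ = (2 ^ n * l / 2) ^ 2 := by ring

lemma isCompact_cube (c : Rn n) {l : ℝ} (hl : 0 ≤ l) : IsCompact (cube c l) := by
  refine Metric.isCompact_of_isClosed_isBounded (isClosed_cube c l) ?_
  refine (Metric.isBounded_closedBall (x := c) (r := 2 ^ n * l / 2)).subset fun x hx => ?_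
  rw [Metric.mem_closedBall, dist_eq_norm]
  exact norm_sub_le_of_mem_cube hl hx

lemma volume_ball_le (c : Rn n) {r : ℝ} (hr : 0 ≤ r) :
    volume (Metric.ball c r) ≤ ENNReal.ofReal ((2 * r) ^ n) :=
  (measure_mono (ball_subset_cube c r)).trans (volume_cube c (by positivity)).le

/-- If `x` is at distance less than `2 ^ (n + 1) * l` from the center of a cube of side `l`,
then the cube lies in the ball of radius `2 ^ (n + 2) * l` about `x`. -/
lemma cube_subset_ball {c x : Rn n} {l : ℝ} (hl : 0 < l) (hx : ‖x - c‖ < 2 ^ (n + 1) * l) :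
    cube c l ⊆ Metric.ball x (2 ^ (n + 2) * l) := by
  intro y hy
  have h1 := norm_sub_le_of_mem_cube hl.le hy
  rw [Metric.mem_ball, dist_eq_norm]
  have h2 : ‖y - x‖ ≤ ‖y - c‖ + ‖x - c‖ := by
    rw [← norm_neg (x - c)]
    refine (norm_add_le _ _).trans_eq' ?_
    congr 1; abel
  have h3 : (0 : ℝ) < 2 ^ n * l := by positivity
  rw [pow_succ] at hx
  rw [pow_add]
  nlinarith

end Geometry

section Oscillation

variable {n : ℕ}

lemma integrableOn_cube {b : Rn n → ℝ} (hb : LocallyIntegrable b volume) (c : Rn n) {l : ℝ}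
    (hl : 0 ≤ l) : IntegrableOn b (cube c l) :=
  hb.integrableOn_isCompact (isCompact_cube c hl)

lemma lintegral_cube_sub_avgOn_le {b : Rn n → ℝ} {M : ℝ} (hb : LocallyIntegrable b volume)
    (hM : OscBound b M) (c : Rn n) {l : ℝ} (hl : 0 < l) :
    ∫⁻ x in cube c l, ‖b x - avgOn b (cube c l)‖ₑ ≤ ENNReal.ofReal (l ^ n * M) := by
  have hvol := volume_cube c hl.le
  have hfin : volume (cube c l) ≠ ⊤ := by rw [hvol]; exact ENNReal.ofReal_ne_top
  have hi : IntegrableOn (fun x => b x - avgOn b (cube c l)) (cube c l) :=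
    (integrableOn_cube hb c hl.le).sub (integrableOn_const hfin)
  have h := hM c l hl
  rw [setAverage_eq, smul_eq_mul, measureReal_def, hvol, ENNReal.toReal_ofReal (by positivity),
    inv_mul_le_iff₀ (by positivity)] at h
  have h2 := ofReal_integral_norm_eq_lintegral_enorm hi
  rw [← h2]
  exact ENNReal.ofReal_le_ofReal (by simpa using h)

lemma abs_avgOn_double_sub_le {b : Rn n → ℝ} {M : ℝ} (hb : LocallyIntegrable b volume)
    (hM : OscBound b M) (c : Rn n) {l : ℝ} (hl : 0 < l) :
    |avgOn b (cube c (2 * l)) - avgOn b (cube c l)| ≤ 2 ^ n * M := by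
  set β := avgOn b (cube c (2 * l)) with hβ
  have hvol := volume_cube c hl.le
  have hfin : volume (cube c l) ≠ ⊤ := by rw [hvol]; exact ENNReal.ofReal_ne_top
  have hi := integrableOn_cube hb c hl.le
  have hi2 := integrableOn_cube hb c (l := 2 * l) (by positivity)
  have hfin2 : volume (cube c (2 * l)) ≠ ⊤ := (isCompact_cube c (by positivity)).measure_ne_top
  have h := hM c (2 * l) (by positivity)
  rw [← hβ, setAverage_eq, smul_eq_mul, measureReal_def, volume_cube c (by positivity),
    ENNReal.toReal_ofReal (by positivity), inv_mul_le_iff₀ (by positivity)] at h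
  have hsub : ∫ x in cube c l, |b x - β| ≤ ∫ x in cube c (2 * l), |b x - β| :=
    setIntegral_mono_set (hi2.sub (integrableOn_const hfin2)).norm
      (ae_of_all _ fun x => abs_nonneg _)
      (cube_subset_cube c (by linarith)).eventuallyLE
  have hv : volume.real (cube c l) = l ^ n := by
    rw [measureReal_def, hvol, ENNReal.toReal_ofReal (by positivity)]
  have h3 : (l ^ n) * (avgOn b (cube c l) - β) = ∫ x in cube c l, (b x - β) := by
    rw [integral_sub hi (integrableOn_const hfin)]
    rw [setIntegral_const, hv, avgOn, setAverage_eq, hv, smul_eq_mul, smul_eq_mul]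
    field_simp
  have h4 : l ^ n * |avgOn b (cube c l) - β| ≤ (2 * l) ^ n * M := by
    rw [← abs_of_pos (show (0:ℝ) < l ^ n by positivity), ← abs_mul, h3]
    exact (abs_integral_le_integral_abs).trans (hsub.trans h)
  rw [abs_sub_comm]
  rw [mul_pow, mul_right_comm, mul_comm] at h4
  exact le_of_mul_le_mul_right h4 (by positivity)

lemma abs_avgOn_dilate_sub_le {b : Rn n → ℝ} {M : ℝ} (hb : LocallyIntegrable b volume)
    (hM : OscBound b M) (c : Rn n) {l : ℝ} (hl : 0 < l) (s : ℕ) :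
    |avgOn b (cube c (2 ^ s * l)) - avgOn b (cube c l)| ≤ s * (2 ^ n * M) := by
  induction s with
  | zero => simp
  | succ s ih =>
    have h := abs_avgOn_double_sub_le hb hM c (l := 2 ^ s * l) (by positivity)
    rw [← mul_assoc, ← pow_succ'] at h
    have h2 := abs_sub_le (avgOn b (cube c (2 ^ (s + 1) * l))) (avgOn b (cube c (2 ^ s * l)))
      (avgOn b (cube c l))
    push_cast
    linarith

lemma lintegral_cube_dilate_sub_avgOn_le {b : Rn n → ℝ} {M : ℝ}
    (hb : LocallyIntegrable b volume) (hM : OscBound b M) (hM0 : 0 ≤ M) (c : Rn n) {l : ℝ}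
    (hl : 0 < l) (s : ℕ) :
    ∫⁻ x in cube c (2 ^ s * l), ‖b x - avgOn b (cube c l)‖ₑ ≤
      ENNReal.ofReal ((2 ^ s * l) ^ n * (M * (1 + s * 2 ^ n))) := by
  set β := avgOn b (cube c (2 ^ s * l))
  set β' := avgOn b (cube c l)
  calc ∫⁻ x in cube c (2 ^ s * l), ‖b x - β'‖ₑ
      ≤ ∫⁻ x in cube c (2 ^ s * l), (‖b x - β‖ₑ + ‖β - β'‖ₑ) := by
        refine lintegral_mono fun x => ?_
        rw [← sub_add_sub_cancel (b x) β β']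
        exact enorm_add_le _ _
    _ = (∫⁻ x in cube c (2 ^ s * l), ‖b x - β‖ₑ) + ‖β - β'‖ₑ * volume (cube c (2 ^ s * l)) := by
        rw [lintegral_add_right _ measurable_const, lintegral_const, Measure.restrict_apply_univ]
    _ ≤ ENNReal.ofReal ((2 ^ s * l) ^ n * M)
        + ENNReal.ofReal (s * (2 ^ n * M)) * ENNReal.ofReal ((2 ^ s * l) ^ n) := by
        gcongr
        · exact lintegral_cube_sub_avgOn_le hb hM c (by positivity)
        · rw [Real.enorm_eq_ofReal_abs]
          exact ENNReal.ofReal_le_ofReal (abs_avgOn_dilate_sub_le hb hM c hl s)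
        · rw [volume_cube c (by positivity)]
    _ = _ := by
        rw [← ENNReal.ofReal_mul (by positivity), ← ENNReal.ofReal_add (by positivity)
          (by positivity)]
        congr 1; ring

end Oscillation

section Dini

/-- The dyadic sum `∑ᵢ (i + 1) ω(2^{-i-1})` attached to the log-Dini condition. -/
def dyadicDiniSum (ω : ℝ → ℝ) : ℝ≥0∞ :=
  ∑' i : ℕ, ENNReal.ofReal (ω ((1 / 2) ^ (i + 1)) * (i + 1))

lemma dyadicDiniSum_ne_top {ω : ℝ → ℝ} (hω0 : ∀ t, 0 < t → 0 ≤ ω t)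
    (hωmono : ∀ s t : ℝ, 0 < s → s ≤ t → ω s ≤ ω t)
    (hω : IntegrableOn (fun t => ω t * (1 + Real.log (1 / t)) / t) (Ioo (0 : ℝ) 1)) :
    dyadicDiniSum ω ≠ ⊤ := by
  set F : ℝ → ℝ := fun t => ω t * (1 + Real.log (1 / t)) / t with hF
  set I : ℕ → Set ℝ := fun i => Ioo ((1 / 2) ^ (i + 1)) ((1 / 2) ^ i) with hI
  have hanti : Antitone fun i : ℕ => ((1 : ℝ) / 2) ^ i :=
    pow_right_anti₀ (by norm_num) (by norm_num)
  have hdisj : Pairwise (Function.onFun Disjoint I) := by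
    have := hanti.pairwise_disjoint_on_Ioo_succ
    simpa [hI, Function.onFun] using this
  have hterm : ∀ i : ℕ, ENNReal.ofReal (ω ((1 / 2) ^ (i + 1)) * (i + 1)) ≤
      4 * ∫⁻ t in I i, ENNReal.ofReal (F t) := by
    intro i
    have hp : (0 : ℝ) < (1 / 2) ^ (i + 1) := by positivity
    have hw := hω0 _ hp
    have hle : ∀ t ∈ I i, ω ((1 / 2) ^ (i + 1)) * (i + 1) / 2 * 2 ^ i ≤ F t := by
      intro t ht
      have ht0 : 0 < t := hp.trans ht.1
      have h1 : ω ((1 / 2) ^ (i + 1)) ≤ ω t := hωmono _ _ hp ht.1.le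
      have h2 : (2 : ℝ) ^ i ≤ 1 / t := by
        rw [le_div_iff₀ ht0]
        have := ht.2.le
        calc (2 : ℝ) ^ i * t ≤ 2 ^ i * (1 / 2) ^ i := by gcongr
          _ = 1 := by rw [← mul_pow]; norm_num
      have h3 : (i : ℝ) / 2 ≤ Real.log (1 / t) := by
        calc (i : ℝ) / 2 ≤ i * Real.log 2 := by
              have := Real.log_two_gt_d9
              have hi : (0 : ℝ) ≤ i := Nat.cast_nonneg i
              nlinarith
          _ = Real.log (2 ^ i) := by rw [Real.log_pow]
          _ ≤ _ := Real.log_le_log (by positivity) h2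
      have h4 : ((i : ℝ) + 1) / 2 ≤ 1 + Real.log (1 / t) := by linarith
      have h5 : 0 ≤ ω t := hw.trans h1
      have h6 : 0 ≤ 1 + Real.log (1 / t) := le_trans (by positivity) h4
      have h7 : 0 ≤ ω t * (1 + Real.log (1 / t)) := mul_nonneg h5 h6
      calc ω ((1 / 2) ^ (i + 1)) * (i + 1) / 2 * 2 ^ i
          = ω ((1 / 2) ^ (i + 1)) * (((i : ℝ) + 1) / 2) * 2 ^ i := by ring
        _ ≤ ω t * (1 + Real.log (1 / t)) * (1 / t) := by gcongr
        _ = F t := by simp only [hF]; ring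
    calc ENNReal.ofReal (ω ((1 / 2) ^ (i + 1)) * (i + 1))
        = 4 * (ENNReal.ofReal (ω ((1 / 2) ^ (i + 1)) * (i + 1) / 2 * 2 ^ i) * volume (I i)) := by
          rw [hI, Real.volume_Ioo, ← ENNReal.ofReal_mul (by positivity),
            show (4 : ℝ≥0∞) = ENNReal.ofReal 4 by simp, ← ENNReal.ofReal_mul (by norm_num)]
          congr 1
          have : (2 : ℝ) ^ i * (1 / 2) ^ i = 1 := by rw [← mul_pow]; norm_num
          rw [pow_succ (1 / 2 : ℝ)]
          linear_combination (-(ω ((1 / 2) ^ i * (1 / 2)) * (i + 1))) * this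
      _ = 4 * ∫⁻ _ in I i, ENNReal.ofReal (ω ((1 / 2) ^ (i + 1)) * (i + 1) / 2 * 2 ^ i) := by
          rw [setLIntegral_const]
      _ ≤ _ := by
          gcongr 4 * ?_
          refine setLIntegral_mono' measurableSet_Ioo fun t ht => ?_
          exact ENNReal.ofReal_le_ofReal (hle t ht)
  have hfin : ∫⁻ t in Ioo (0 : ℝ) 1, ENNReal.ofReal (F t) < ⊤ := hω.lintegral_lt_top
  refine ne_top_of_le_ne_top (ENNReal.mul_ne_top (by norm_num : (4 : ℝ≥0∞) ≠ ⊤) hfin.ne) ?_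
  calc dyadicDiniSum ω ≤ ∑' i, 4 * ∫⁻ t in I i, ENNReal.ofReal (F t) :=
        ENNReal.tsum_le_tsum hterm
    _ = 4 * ∫⁻ t in ⋃ i, I i, ENNReal.ofReal (F t) := by
        rw [ENNReal.tsum_mul_left, lintegral_iUnion (fun i => measurableSet_Ioo) hdisj]
    _ ≤ _ := by
        gcongr 4 * ?_
        refine lintegral_mono_set (iUnion_subset fun i t ht => ⟨lt_trans (by positivity) ht.1, ?_⟩)
        exact ht.2.trans_le (pow_le_one₀ (by norm_num) (by norm_num))

end Dini

section Majorant

variable {n : ℕ}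

/-- A measurable majorant, outside a neighbourhood of the cube of center `c` and side `l`, of
`ω (2 ^ n * l / ‖x - c‖) / ‖x - c‖ ^ n`. -/
def annularMajorant (ω : ℝ → ℝ) (c : Rn n) (l : ℝ) (x : Rn n) : ℝ≥0∞ :=
  ∑' i : ℕ, (Metric.ball c (2 ^ (i + 1) * (2 ^ (n + 1) * l))).indicator
    (fun _ => ENNReal.ofReal (ω ((1 / 2) ^ (i + 1)) / (2 ^ i * (2 ^ (n + 1) * l)) ^ n)) x

lemma measurable_annularMajorant (ω : ℝ → ℝ) (c : Rn n) (l : ℝ) :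
    Measurable (annularMajorant ω c l) :=
  Measurable.tsum fun _ => measurable_const.indicator Metric.isOpen_ball.measurableSet

lemma exists_two_pow_mul_le_lt {ρ D : ℝ} (hρ : 0 < ρ) (h : ρ ≤ D) :
    ∃ i : ℕ, 2 ^ i * ρ ≤ D ∧ D < 2 ^ (i + 1) * ρ := by
  obtain ⟨i, h1, h2⟩ := exists_nat_pow_near (x := D / ρ) (y := (2 : ℝ))
    ((one_le_div hρ).2 h) (by norm_num)
  exact ⟨i, (le_div_iff₀ hρ).1 h1, (div_lt_iff₀ hρ).1 h2⟩

lemma le_annularMajorant {ω : ℝ → ℝ} (hω0 : ∀ t, 0 < t → 0 ≤ ω t)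
    (hωmono : ∀ s t : ℝ, 0 < s → s ≤ t → ω s ≤ ω t) {c x : Rn n} {l : ℝ} (hl : 0 < l)
    (hx : 2 ^ (n + 1) * l ≤ ‖x - c‖) :
    ENNReal.ofReal (ω (2 ^ n * l / ‖x - c‖) / ‖x - c‖ ^ n) ≤ annularMajorant ω c l x := by
  have hρ : (0 : ℝ) < 2 ^ (n + 1) * l := by positivity
  obtain ⟨i, h1, h2⟩ := exists_two_pow_mul_le_lt hρ hx
  have hD : 0 < ‖x - c‖ := hρ.trans_le hx
  have hmem : x ∈ Metric.ball c (2 ^ (i + 1) * (2 ^ (n + 1) * l)) := by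
    rwa [Metric.mem_ball, dist_eq_norm]
  refine le_trans ?_ (ENNReal.le_tsum i)
  rw [indicator_of_mem hmem]
  refine ENNReal.ofReal_le_ofReal ?_
  have h3 : 2 ^ n * l / ‖x - c‖ ≤ (1 / 2) ^ (i + 1) := by
    rw [div_le_iff₀ hD]
    calc 2 ^ n * l = (1 / 2) ^ (i + 1) * (2 ^ i * (2 ^ (n + 1) * l)) := by
          have : (2 : ℝ) ^ i * (1 / 2) ^ i = 1 := by rw [← mul_pow]; norm_num
          rw [pow_succ (1 / 2 : ℝ), pow_succ (2 : ℝ) n]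
          linear_combination (-(2 ^ n * l)) * this
      _ ≤ _ := by gcongr
  have := hω0 ((1 / 2) ^ (i + 1)) (by positivity)
  have := hωmono _ _ (by positivity) h3
  gcongr

lemma lintegral_mul_annularMajorant {ω : ℝ → ℝ} (c : Rn n) {l : ℝ} {g : Rn n → ℝ≥0∞}
    (hg : AEMeasurable g) :
    ∫⁻ x, g x * annularMajorant ω c l x = ∑' i : ℕ,
      ENNReal.ofReal (ω ((1 / 2) ^ (i + 1)) / (2 ^ i * (2 ^ (n + 1) * l)) ^ n) *
        ∫⁻ x in Metric.ball c (2 ^ (i + 1) * (2 ^ (n + 1) * l)), g x := by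
  simp only [annularMajorant, ← ENNReal.tsum_mul_left]
  have hm : ∀ i : ℕ, AEMeasurable fun x => g x *
      (Metric.ball c (2 ^ (i + 1) * (2 ^ (n + 1) * l))).indicator (fun _ => ENNReal.ofReal
        (ω ((1 / 2) ^ (i + 1)) / (2 ^ i * (2 ^ (n + 1) * l)) ^ n)) x := fun i => hg.mul
    (measurable_const.indicator Metric.isOpen_ball.measurableSet).aemeasurable
  rw [lintegral_tsum hm]
  congr 1; ext i
  rw [← lintegral_const_mul'' _ hg.restrict, ← lintegral_indicator Metric.isOpen_ball.measurableSet]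
  congr 1; ext x
  by_cases hx : x ∈ Metric.ball c (2 ^ (i + 1) * (2 ^ (n + 1) * l))
  · rw [indicator_of_mem hx, indicator_of_mem hx, mul_comm]
  · rw [indicator_of_notMem hx, indicator_of_notMem hx, mul_zero]

lemma lintegral_annularMajorant_le {ω : ℝ → ℝ} (hω0 : ∀ t, 0 < t → 0 ≤ ω t) (c : Rn n) {l : ℝ}
    (hl : 0 < l) :
    ∫⁻ x, annularMajorant ω c l x ≤ ENNReal.ofReal (4 ^ n) * dyadicDiniSum ω := by
  have := lintegral_mul_annularMajorant (ω := ω) c (l := l) (g := fun _ : Rn n => 1)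
    aemeasurable_const
  simp only [one_mul] at this
  rw [this, dyadicDiniSum, ← ENNReal.tsum_mul_left]
  refine ENNReal.tsum_le_tsum fun i => ?_
  have hw := hω0 ((1 / 2) ^ (i + 1)) (by positivity)
  rw [setLIntegral_one]
  calc _ ≤ ENNReal.ofReal (ω ((1 / 2) ^ (i + 1)) / (2 ^ i * (2 ^ (n + 1) * l)) ^ n) *
        ENNReal.ofReal ((2 * (2 ^ (i + 1) * (2 ^ (n + 1) * l))) ^ n) := by
        gcongr; exact volume_ball_le c (by positivity)
    _ = ENNReal.ofReal (4 ^ n * (ω ((1 / 2) ^ (i + 1)))) := by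
        rw [← ENNReal.ofReal_mul (by positivity)]
        congr 1
        have : 2 * (2 ^ (i + 1) * (2 ^ (n + 1) * l)) = 4 * (2 ^ i * (2 ^ (n + 1) * l)) := by ring
        rw [this, mul_pow 4]
        field_simp
    _ ≤ _ := by
        rw [← ENNReal.ofReal_mul (by positivity)]
        refine ENNReal.ofReal_le_ofReal ?_
        have : (0 : ℝ) ≤ i := Nat.cast_nonneg i
        gcongr
        nlinarith

lemma lintegral_sub_avgOn_mul_annularMajorant_le {ω : ℝ → ℝ} (hω0 : ∀ t, 0 < t → 0 ≤ ω t)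
    {b : Rn n → ℝ} {M : ℝ} (hb : LocallyIntegrable b volume) (hM : OscBound b M) (hM0 : 0 ≤ M)
    (c : Rn n) {l : ℝ} (hl : 0 < l) :
    ∫⁻ x, ‖b x - avgOn b (cube c l)‖ₑ * annularMajorant ω c l x ≤
      ENNReal.ofReal (8 ^ n * (n + 4) * M) * dyadicDiniSum ω := by
  have hbm : AEMeasurable fun x => ‖b x - avgOn b (cube c l)‖ₑ :=
    (hb.aestronglyMeasurable.sub aestronglyMeasurable_const).enorm
  rw [lintegral_mul_annularMajorant c hbm, dyadicDiniSum, ← ENNReal.tsum_mul_left]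
  refine ENNReal.tsum_le_tsum fun i => ?_
  have hw := hω0 ((1 / 2) ^ (i + 1)) (by positivity)
  have hsub : Metric.ball c (2 ^ (i + 1) * (2 ^ (n + 1) * l)) ⊆ cube c (2 ^ (i + n + 3) * l) := by
    refine (ball_subset_cube _ _).trans (cube_subset_cube _ (le_of_eq ?_))
    ring
  calc _ ≤ ENNReal.ofReal (ω ((1 / 2) ^ (i + 1)) / (2 ^ i * (2 ^ (n + 1) * l)) ^ n) *
        ENNReal.ofReal ((2 ^ (i + n + 3) * l) ^ n * (M * (1 + (i + n + 3 : ℕ) * 2 ^ n))) := by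
        gcongr
        exact (lintegral_mono_set hsub).trans
          (lintegral_cube_dilate_sub_avgOn_le hb hM hM0 c hl _)
    _ = ENNReal.ofReal (ω ((1 / 2) ^ (i + 1)) * (4 ^ n * (M * (1 + (i + n + 3 : ℕ) * 2 ^ n)))) := by
        rw [← ENNReal.ofReal_mul (by positivity)]
        congr 1
        have : 2 ^ (i + n + 3) * l = 4 * (2 ^ i * (2 ^ (n + 1) * l)) := by ring
        rw [this, mul_pow 4]
        field_simp
    _ ≤ _ := by
        rw [← ENNReal.ofReal_mul (by positivity)]
        refine ENNReal.ofReal_le_ofReal ?_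
        have hi : (0 : ℝ) ≤ i := Nat.cast_nonneg i
        have hn : (0 : ℝ) ≤ n := Nat.cast_nonneg n
        have h1 : (1 : ℝ) ≤ 2 ^ n := one_le_pow₀ (by norm_num)
        have h2 : 1 + ((i + n + 3 : ℕ) : ℝ) * 2 ^ n ≤ 2 ^ n * ((n + 4) * (i + 1)) := by
          push_cast
          have : (i : ℝ) + n + 4 ≤ (n + 4) * (i + 1) := by nlinarith
          nlinarith
        calc ω ((1 / 2) ^ (i + 1)) * (4 ^ n * (M * (1 + (i + n + 3 : ℕ) * 2 ^ n)))
            ≤ ω ((1 / 2) ^ (i + 1)) * (4 ^ n * (M * (2 ^ n * ((n + 4) * (i + 1))))) := by gcongr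
          _ = 8 ^ n * (n + 4) * M * (ω ((1 / 2) ^ (i + 1)) * (i + 1)) := by
              rw [show (8 : ℝ) = 4 * 2 by norm_num, mul_pow]; ring

/-- The function `l ^ {-n}` on the neighbourhood of a cube not covered by `annularMajorant`. -/
def localMajorant (c : Rn n) (l : ℝ) (x : Rn n) : ℝ≥0∞ :=
  (Metric.ball c (2 ^ (n + 1) * l)).indicator (fun _ => ENNReal.ofReal ((l ^ n)⁻¹)) x

lemma measurable_localMajorant (c : Rn n) (l : ℝ) : Measurable (localMajorant c l) :=
  measurable_const.indicator Metric.isOpen_ball.measurableSet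

lemma lintegral_sub_avgOn_mul_localMajorant_le
    {b : Rn n → ℝ} {M : ℝ} (hb : LocallyIntegrable b volume) (hM : OscBound b M) (hM0 : 0 ≤ M)
    (c : Rn n) {l : ℝ} (hl : 0 < l) :
    ∫⁻ x, ‖b x - avgOn b (cube c l)‖ₑ * localMajorant c l x ≤
      ENNReal.ofReal ((2 ^ (n + 2)) ^ n * (M * (1 + (n + 2 : ℕ) * 2 ^ n))) := by
  have hbm : AEMeasurable fun x => ‖b x - avgOn b (cube c l)‖ₑ :=
    (hb.aestronglyMeasurable.sub aestronglyMeasurable_const).enorm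
  have h : ∀ x, ‖b x - avgOn b (cube c l)‖ₑ * localMajorant c l x =
      (Metric.ball c (2 ^ (n + 1) * l)).indicator
        (fun x => ENNReal.ofReal ((l ^ n)⁻¹) * ‖b x - avgOn b (cube c l)‖ₑ) x := by
    intro x
    by_cases hx : x ∈ Metric.ball c (2 ^ (n + 1) * l)
    · rw [localMajorant, indicator_of_mem hx, indicator_of_mem hx, mul_comm]
    · rw [localMajorant, indicator_of_notMem hx, indicator_of_notMem hx, mul_zero]
  simp_rw [h]
  rw [lintegral_indicator Metric.isOpen_ball.measurableSet, lintegral_const_mul'' _ hbm.restrict]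
  have hsub : Metric.ball c (2 ^ (n + 1) * l) ⊆ cube c (2 ^ (n + 2) * l) := by
    refine (ball_subset_cube _ _).trans (cube_subset_cube _ (le_of_eq ?_))
    ring
  calc _ ≤ ENNReal.ofReal ((l ^ n)⁻¹) *
        ENNReal.ofReal ((2 ^ (n + 2) * l) ^ n * (M * (1 + (n + 2 : ℕ) * 2 ^ n))) := by
        gcongr
        exact (lintegral_mono_set hsub).trans
          (lintegral_cube_dilate_sub_avgOn_le hb hM hM0 c hl _)
    _ = _ := by
        rw [← ENNReal.ofReal_mul (by positivity)]
        congr 1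
        rw [mul_pow _ l]
        field_simp

end Majorant

section Kernel

variable {n : ℕ}

/-- A bounded mean-zero function adapted to the cube of center `c` and side `l`. -/
structure IsCubeAtom (c : Rn n) (l : ℝ) (a : Rn n → ℝ) : Prop where
  side_pos : 0 < l
  measurable : Measurable a
  eq_zero : ∀ x, x ∉ cube c l → a x = 0
  abs_le : ∀ x, |a x| ≤ (l ^ n)⁻¹
  integral_eq_zero : ∫ x, a x = 0

namespace IsCubeAtom

variable {c : Rn n} {l : ℝ} {a : Rn n → ℝ}

lemma enorm_le (h : IsCubeAtom c l a) (x : Rn n) :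
    ‖a x‖ₑ ≤ (cube c l).indicator (fun _ => ENNReal.ofReal ((l ^ n)⁻¹)) x := by
  by_cases hx : x ∈ cube c l
  · rw [indicator_of_mem hx, Real.enorm_eq_ofReal_abs]
    exact ENNReal.ofReal_le_ofReal (h.abs_le x)
  · simp [h.eq_zero x hx]

lemma lintegral_le_one (h : IsCubeAtom c l a) : ∫⁻ x, ‖a x‖ₑ ≤ 1 := by
  refine (lintegral_mono h.enorm_le).trans ?_
  have := h.side_pos
  rw [lintegral_indicator (measurableSet_cube c l), setLIntegral_const,
    volume_cube c this.le, ← ENNReal.ofReal_mul (by positivity),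
    inv_mul_cancel₀ (by positivity), ENNReal.ofReal_one]

lemma integrable (h : IsCubeAtom c l a) : Integrable a :=
  ⟨h.measurable.aestronglyMeasurable, h.lintegral_le_one.trans_lt (by simp)⟩

lemma tsupport_subset (h : IsCubeAtom c l a) : tsupport a ⊆ cube c l :=
  closure_minimal (fun x hx => by by_contra hx'; exact hx (h.eq_zero x hx')) (isClosed_cube c l)

lemma hasCompactSupport (h : IsCubeAtom c l a) : HasCompactSupport a :=
  (isCompact_cube c h.side_pos.le).of_isClosed_subset (isClosed_tsupport a) h.tsupport_subset

lemma lintegral_ball_le (h : IsCubeAtom c l a) (x : Rn n) {r : ℝ} (hr : 0 ≤ r) :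
    ∫⁻ y in Metric.ball x r, ‖a y‖ₑ ≤ ENNReal.ofReal (2 ^ n * (l ^ n)⁻¹) * ENNReal.ofReal (r ^ n) := by
  have := h.side_pos
  calc ∫⁻ y in Metric.ball x r, ‖a y‖ₑ
      ≤ ∫⁻ _ in Metric.ball x r, ENNReal.ofReal ((l ^ n)⁻¹) := by
        refine lintegral_mono fun y => ?_
        rw [Real.enorm_eq_ofReal_abs]
        exact ENNReal.ofReal_le_ofReal (h.abs_le y)
    _ ≤ ENNReal.ofReal ((l ^ n)⁻¹) * ENNReal.ofReal ((2 * r) ^ n) := by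
        rw [setLIntegral_const]
        gcongr
        exact volume_ball_le x hr
    _ = _ := by
        rw [← ENNReal.ofReal_mul (by positivity), ← ENNReal.ofReal_mul (by positivity), mul_pow]
        congr 1; ring

end IsCubeAtom

lemma lintegral_fin_prod {k : ℕ} (f : Fin k → Rn n → ℝ≥0∞) (hf : ∀ i, Measurable (f i)) :
    ∫⁻ y : Fin k → Rn n, ∏ i, f i (y i) = ∏ i, ∫⁻ x, f i x := by
  induction k with
  | zero =>
    rw [volume_pi, Measure.pi_of_empty, lintegral_dirac]
    simp
  | succ k ih =>
    have hmp := (volume_preserving_piFinSuccAbove (fun _ : Fin (k + 1) => Rn n) 0).symm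
    rw [← hmp.lintegral_comp_emb (MeasurableEquiv.measurableEmbedding _)]
    have : ∀ p : Rn n × (Fin k → Rn n),
        ∏ i, f i ((MeasurableEquiv.piFinSuccAbove (fun _ : Fin (k + 1) => Rn n) 0).symm p i) =
          f 0 p.1 * ∏ i : Fin k, f i.succ (p.2 i) := by
      intro p
      rw [Fin.prod_univ_succ]
      simp [MeasurableEquiv.piFinSuccAbove_symm_apply, Fin.insertNthEquiv]
    simp_rw [this]
    have hm : Measurable fun y : Fin k → Rn n => ∏ i : Fin k, f i.succ (y i) :=
      Finset.measurable_fun_prod _ fun i _ => (hf i.succ).comp (measurable_pi_apply i)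
    have hprod : ∫⁻ p : Rn n × (Fin k → Rn n), f 0 p.1 * ∏ i : Fin k, f i.succ (p.2 i) =
        (∫⁻ x, f 0 x) * ∫⁻ y : Fin k → Rn n, ∏ i : Fin k, f i.succ (y i) := by
      rw [Measure.volume_eq_prod]
      exact lintegral_prod_mul (hf 0).aemeasurable hm.aemeasurable
    rw [hprod, ih (fun i => f i.succ) (fun i => hf _), Fin.prod_univ_succ]

lemma lintegral_inv_pow_mul_prod_le (hn : 1 ≤ n) {k : ℕ} (x : Rn n) {ρ : ℝ} (hρ : 0 < ρ)
    (w : Fin k → Rn n → ℝ) (hw : ∀ i, Measurable (w i)) (A : Fin k → ℝ≥0∞)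
    (hA : ∀ i, ∀ r : ℝ, 0 < r →
      ∫⁻ y in Metric.ball x r, ‖w i y‖ₑ ≤ A i * ENNReal.ofReal (r ^ n)) :
    ∫⁻ y : Fin k → Rn n, ENNReal.ofReal (1 / (ρ + ∑ i, ‖x - y i‖) ^ ((k + 1) * n)) *
        ∏ i, ‖w i (y i)‖ₑ ≤
      ENNReal.ofReal (2 ^ (k * n + 1) / ρ ^ n) * ∏ i, A i := by
  have hpt : ∀ y : Fin k → Rn n, ENNReal.ofReal (1 / (ρ + ∑ i, ‖x - y i‖) ^ ((k + 1) * n)) *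
        ∏ i, ‖w i (y i)‖ₑ ≤ ∑' s : ℕ, ENNReal.ofReal (1 / (2 ^ s * ρ) ^ ((k + 1) * n)) *
          ∏ i, (Metric.ball x (2 ^ (s + 1) * ρ)).indicator (fun z => ‖w i z‖ₑ) (y i) := by
    intro y
    have hs : 0 ≤ ∑ i, ‖x - y i‖ := by positivity
    obtain ⟨s, h1, h2⟩ := exists_two_pow_mul_le_lt hρ
      (show ρ ≤ ρ + ∑ i, ‖x - y i‖ by linarith)
    refine le_trans ?_ (ENNReal.le_tsum s)
    gcongr with i
    rw [indicator_of_mem]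
    rw [Metric.mem_ball, dist_comm, dist_eq_norm]
    have := Finset.single_le_sum (f := fun i => ‖x - y i‖) (fun i _ => norm_nonneg _)
      (Finset.mem_univ i)
    linarith
  refine (lintegral_mono hpt).trans ?_
  have hmeas : ∀ s : ℕ, Measurable fun y : Fin k → Rn n =>
      ∏ i, (Metric.ball x (2 ^ (s + 1) * ρ)).indicator (fun z => ‖w i z‖ₑ) (y i) := fun s =>
    Finset.measurable_fun_prod _ fun i _ =>
      ((hw i).enorm.indicator Metric.isOpen_ball.measurableSet).comp (measurable_pi_apply i)
  rw [lintegral_tsum fun s => ((hmeas s).const_mul _).aemeasurable]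
  have hterm : ∀ s : ℕ, ∫⁻ y : Fin k → Rn n, ENNReal.ofReal (1 / (2 ^ s * ρ) ^ ((k + 1) * n)) *
          ∏ i, (Metric.ball x (2 ^ (s + 1) * ρ)).indicator (fun z => ‖w i z‖ₑ) (y i) ≤
      ENNReal.ofReal (2 ^ (k * n) / ρ ^ n * (1 / 2) ^ s) * ∏ i, A i := by
    intro s
    rw [lintegral_const_mul _ (hmeas s), lintegral_fin_prod _
      fun i => (hw i).enorm.indicator Metric.isOpen_ball.measurableSet]
    calc _ ≤ ENNReal.ofReal (1 / (2 ^ s * ρ) ^ ((k + 1) * n)) *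
          ∏ i, (A i * ENNReal.ofReal ((2 ^ (s + 1) * ρ) ^ n)) := by
          gcongr with i
          rw [lintegral_indicator Metric.isOpen_ball.measurableSet]
          exact hA i _ (by positivity)
      _ = ENNReal.ofReal (1 / (2 ^ s * ρ) ^ ((k + 1) * n) * ((2 ^ (s + 1) * ρ) ^ n) ^ k) *
          ∏ i, A i := by
          rw [Finset.prod_mul_distrib, Finset.prod_const, Finset.card_univ, Fintype.card_fin,
            ← ENNReal.ofReal_pow (by positivity), ENNReal.ofReal_mul (by positivity)]
          ring
      _ ≤ _ := by
          gcongr ?_ * _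
          refine ENNReal.ofReal_le_ofReal ?_
          have h1 : (2 : ℝ) ^ (s + 1) * ρ = 2 * (2 ^ s * ρ) := by ring
          have h2 : (1 : ℝ) / (2 ^ s * ρ) ^ ((k + 1) * n) * ((2 ^ (s + 1) * ρ) ^ n) ^ k =
              2 ^ (k * n) / ρ ^ n * (1 / 2) ^ (s * n) := by
            rw [h1, mul_pow 2, mul_pow (2 ^ n), ← pow_mul, ← pow_mul, add_mul, one_mul, pow_add,
              mul_comm n k, mul_pow (2 ^ s) ρ n, one_div_pow, ← pow_mul]
            field_simp
          rw [h2]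
          gcongr 2 ^ (k * n) / ρ ^ n * ?_
          exact pow_le_pow_of_le_one (by norm_num) (by norm_num) (Nat.le_mul_of_pos_right s hn)
  refine (ENNReal.tsum_le_tsum hterm).trans ?_
  rw [ENNReal.tsum_mul_right]
  gcongr
  rw [← ENNReal.ofReal_tsum_of_nonneg (fun s => by positivity)
    ((summable_geometric_two).mul_left _), tsum_mul_left, tsum_geometric_two]
  rw [pow_succ]
  refine ENNReal.ofReal_le_ofReal (le_of_eq ?_)
  ring

lemma div_pow_mul_le {C p S w w' : ℝ} (hC : 0 ≤ C) (hp : 0 < p) (hpS : p ≤ S) (hw : 0 ≤ w)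
    (hw' : w ≤ w') (N : ℕ) : C / S ^ N * w ≤ C * w' * (1 / p ^ N) := by
  calc C / S ^ N * w ≤ C / p ^ N * w' := by gcongr
    _ = _ := by ring

lemma abs_kernel_insertNth_sub_le {C₀ : ℝ} {ω : ℝ → ℝ} (hC₀ : 0 < C₀)
    (hω0 : ∀ t, 0 < t → 0 ≤ ω t) (hωmono : ∀ s t : ℝ, 0 < s → s ≤ t → ω s ≤ ω t)
    {k : ℕ} {K : Rn n → (Fin (k + 1) → Rn n) → ℝ} (hK : IsCZKernelM C₀ ω K)
    (j : Fin (k + 1)) {c x z : Rn n} {l : ℝ} (hl : 0 < l)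
    (hx : 2 ^ (n + 1) * l ≤ ‖x - c‖) (hz : z ∈ cube c l) (y' : Fin k → Rn n) :
    |K x (j.insertNth z y') - K x (j.insertNth c y')| ≤
      C₀ * ω (2 ^ n * l / ‖x - c‖) *
        (1 / (‖x - c‖ / 2 + ∑ i, ‖x - y' i‖) ^ ((k + 1) * n)) := by
  set D := ‖x - c‖ with hD
  have hp : (0 : ℝ) < 2 ^ n * l := by positivity
  have hxD : 2 * (2 ^ n * l) ≤ D := by rw [pow_succ] at hx; linarith
  have hD0 : 0 < D := by linarith
  have hwD : 0 ≤ ω (2 ^ n * l / D) := hω0 _ (by positivity)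
  have hs : 0 ≤ ∑ i, ‖x - y' i‖ := Finset.sum_nonneg fun i _ => norm_nonneg _
  rcases eq_or_ne z c with hzc | hzc
  · rw [hzc, sub_self, abs_zero]
    exact mul_nonneg (mul_nonneg hC₀.le hwD)
      (one_div_nonneg.2 (pow_nonneg (add_nonneg (half_pos hD0).le hs) _))
  have hzc' : ‖z - c‖ ≤ 2 ^ n * l / 2 := norm_sub_le_of_mem_cube hl.le hz
  have hzc0 : 0 < ‖z - c‖ := norm_pos_iff.2 (sub_ne_zero.2 hzc)
  have hxz : D ≤ ‖x - z‖ + ‖z - c‖ := by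
    rw [hD, ← sub_add_sub_cancel x z c]; exact norm_add_le _ _
  set Y : Fin (k + 1) → Rn n := Fin.insertNth (α := fun _ => Rn n) j z y' with hY
  have hYj : Y j = z := by rw [hY, Fin.insertNth_apply_same]
  have hsum : ∑ i, ‖x - Y i‖ = ‖x - z‖ + ∑ i, ‖x - y' i‖ := by
    rw [Fin.sum_univ_succAbove _ j, hYj]
    congr 2; ext i
    rw [hY, Fin.insertNth_apply_succAbove]
  have hle : D / 2 + ∑ i, ‖x - y' i‖ ≤ ∑ i, ‖x - Y i‖ := by rw [hsum]; linarith
  have h := hK.2.2 x Y j c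
    (fun h => by
      have h2 := h j
      rw [hYj] at h2
      rw [h2, sub_self, norm_zero] at hxz
      rw [h2] at hzc'
      linarith)
    ⟨j, by rw [hYj]; linarith⟩
  rw [hYj, hY, Fin.update_insertNth, ← hY] at h
  refine h.trans ?_
  clear hsum h
  generalize ∑ i, ‖x - Y i‖ = S at hle ⊢
  generalize ∑ i, ‖x - y' i‖ = S' at hle hs ⊢
  have hS : 0 < S := by linarith
  have hωle : ω (‖z - c‖ / S) ≤ ω (2 ^ n * l / D) := by
    refine hωmono _ _ (by positivity) ?_
    rw [div_le_div_iff₀ hS hD0]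
    nlinarith
  have hω0' := hω0 (‖z - c‖ / S) (by positivity)
  exact div_pow_mul_le hC₀.le (add_pos_of_pos_of_nonneg (half_pos hD0) hs) hle hω0' hωle _

lemma enorm_integral_kernel_le {C₀ : ℝ} {ω : ℝ → ℝ} (hC₀ : 0 < C₀)
    (hω0 : ∀ t, 0 < t → 0 ≤ ω t) (hωmono : ∀ s t : ℝ, 0 < s → s ≤ t → ω s ≤ ω t) (hn : 1 ≤ n)
    {k : ℕ} {K : Rn n → (Fin (k + 1) → Rn n) → ℝ} (hK : IsCZKernelM C₀ ω K)
    (u : Fin (k + 1) → Rn n → ℝ) (hu : ∀ i, Measurable (u i)) (j : Fin (k + 1))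
    {c : Rn n} {l : ℝ} (ha : IsCubeAtom c l (u j)) {x : Rn n}
    (hx : 2 ^ (n + 1) * l ≤ ‖x - c‖) (A : Fin (k + 1) → ℝ≥0∞)
    (hA : ∀ i, i ≠ j → ∀ r : ℝ, 0 < r →
      ∫⁻ y in Metric.ball x r, ‖u i y‖ₑ ≤ A i * ENNReal.ofReal (r ^ n)) :
    ‖∫ y : Fin (k + 1) → Rn n, K x y * ∏ i, u i (y i)‖ₑ ≤
      ENNReal.ofReal (2 ^ ((k + 1) * n + 1) * C₀) * (∏ i ∈ Finset.univ.erase j, A i) *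
        annularMajorant ω c l x := by
  set F : (Fin (k + 1) → Rn n) → ℝ := fun y => K x y * ∏ i, u i (y i) with hF
  by_cases hInt : Integrable F
  swap
  · rw [integral_undef hInt]; simp
  have hl := ha.side_pos
  set D := ‖x - c‖ with hD
  have hp : (0 : ℝ) < 2 ^ n * l := by positivity
  have hxD : 2 * (2 ^ n * l) ≤ D := by rw [pow_succ] at hx; linarith
  have hD0 : 0 < D := by linarith
  have hρ : 0 < D / 2 := by positivity
  have hwD : 0 ≤ ω (2 ^ n * l / D) := hω0 _ (by positivity)
  set H : (Fin k → Rn n) → ℝ := fun y' =>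
    C₀ * ω (2 ^ n * l / D) * (1 / (D / 2 + ∑ i, ‖x - y' i‖) ^ ((k + 1) * n)) with hH
  have hker : ∀ (z : Rn n) (y' : Fin k → Rn n), z ∈ cube c l →
      |K x (j.insertNth z y') - K x (j.insertNth c y')| ≤ H y' :=
    fun z y' hz => abs_kernel_insertNth_sub_le hC₀ hω0 hωmono hK j hl hx hz y'
  have hmp := (volume_preserving_piFinSuccAbove (fun _ : Fin (k + 1) => Rn n) j).symm
  have hFe : ∀ p : Rn n × (Fin k → Rn n),
      F ((MeasurableEquiv.piFinSuccAbove (fun _ : Fin (k + 1) => Rn n) j).symm p) =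
        K x (j.insertNth p.1 p.2) * (u j p.1 * ∏ i, u (j.succAbove i) (p.2 i)) := by
    intro p
    simp only [hF, MeasurableEquiv.piFinSuccAbove_symm_apply, Fin.insertNthEquiv]
    rw [Fin.prod_univ_succAbove _ j]
    simp
  have hint2 : Integrable (fun p : Rn n × (Fin k → Rn n) =>
      K x (j.insertNth p.1 p.2) * (u j p.1 * ∏ i, u (j.succAbove i) (p.2 i)))
      (volume.prod volume) := by
    have := (hmp.integrable_comp_emb (MeasurableEquiv.measurableEmbedding _)).2 hInt
    refine this.congr (ae_of_all _ fun p => ?_)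
    exact hFe p
  have hFub : ∫ y, F y = ∫ y' : Fin k → Rn n, ∫ z : Rn n,
      K x (j.insertNth z y') * (u j z * ∏ i, u (j.succAbove i) (y' i)) := by
    rw [← hmp.integral_comp']
    simp_rw [hFe]
    rw [Measure.volume_eq_prod, integral_prod_symm _ hint2]
  have hinner : ∀ᵐ y' : Fin k → Rn n, ‖∫ z : Rn n,
      K x (j.insertNth z y') * (u j z * ∏ i, u (j.succAbove i) (y' i))‖ₑ ≤
      ENNReal.ofReal (H y') * ∏ i, ‖u (j.succAbove i) (y' i)‖ₑ := by
    filter_upwards [hint2.prod_left_ae] with y' hy'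
    set W := ∏ i, u (j.succAbove i) (y' i) with hW
    have hWe : ∏ i, ‖u (j.succAbove i) (y' i)‖ₑ = ‖W‖ₑ := by
      simp only [hW, Real.enorm_eq_ofReal_abs, Finset.abs_prod]
      rw [ENNReal.ofReal_prod_of_nonneg fun _ _ => abs_nonneg _]
    have hci : Integrable fun z => K x (j.insertNth c y') * (u j z * W) :=
      (ha.integrable.mul_const W).const_mul _
    have hz : ∫ z, K x (j.insertNth c y') * (u j z * W) = 0 := by
      rw [integral_const_mul, integral_mul_const, ha.integral_eq_zero]; simp
    have heq : ∫ z : Rn n, K x (j.insertNth z y') * (u j z * W) =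
        ∫ z, (K x (j.insertNth z y') - K x (j.insertNth c y')) * (u j z * W) := by
      simp_rw [sub_mul]
      rw [integral_sub hy' hci, hz, sub_zero]
    rw [heq, hWe]
    refine (enorm_integral_le_lintegral_enorm _).trans ?_
    calc _ ≤ ∫⁻ z, (ENNReal.ofReal (H y') * ‖W‖ₑ) * ‖u j z‖ₑ := by
          refine lintegral_mono fun z => ?_
          by_cases hzc : z ∈ cube c l
          · rw [enorm_mul, enorm_mul, mul_assoc, mul_comm ‖W‖ₑ, Real.enorm_eq_ofReal_abs]
            gcongr
            exact hker z y' hzc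
          · simp [ha.eq_zero z hzc]
      _ ≤ ENNReal.ofReal (H y') * ‖W‖ₑ * 1 := by
          rw [lintegral_const_mul _ (hu j).enorm]
          gcongr
          exact ha.lintegral_le_one
      _ = _ := mul_one _
  rw [hFub]
  refine (enorm_integral_le_lintegral_enorm _).trans ((lintegral_mono_ae hinner).trans ?_)
  have hHe : ∀ y', ENNReal.ofReal (H y') = ENNReal.ofReal (C₀ * ω (2 ^ n * l / D)) *
      ENNReal.ofReal (1 / (D / 2 + ∑ i, ‖x - y' i‖) ^ ((k + 1) * n)) := by
    intro y'
    rw [← ENNReal.ofReal_mul (by positivity)]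
  simp_rw [hHe, mul_assoc]
  rw [lintegral_const_mul' _ _ ENNReal.ofReal_ne_top]
  have hmain := lintegral_inv_pow_mul_prod_le hn x hρ (fun i => u (j.succAbove i))
    (fun i => hu _) (fun i => A (j.succAbove i)) (fun i => hA _ (Fin.succAbove_ne j i))
  have hprod : ∏ i, A (j.succAbove i) = ∏ i ∈ Finset.univ.erase j, A i := by
    rw [← Finset.compl_singleton, ← Fin.image_succAbove_univ,
      Finset.prod_image fun a _ b _ h => Fin.succAbove_right_injective h]
  rw [hprod] at hmain
  have hΨ := le_annularMajorant hω0 hωmono hl hx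
  calc _ ≤ ENNReal.ofReal (C₀ * ω (2 ^ n * l / D)) *
        (ENNReal.ofReal (2 ^ (k * n + 1) / (D / 2) ^ n) * ∏ i ∈ Finset.univ.erase j, A i) := by
        gcongr
    _ = ENNReal.ofReal (2 ^ ((k + 1) * n + 1) * C₀) * ((∏ i ∈ Finset.univ.erase j, A i) *
        ENNReal.ofReal (ω (2 ^ n * l / D) / D ^ n)) := by
        rw [← mul_assoc, ← ENNReal.ofReal_mul (by positivity), mul_comm (∏ i ∈ _, A i), ← mul_assoc,
          ← ENNReal.ofReal_mul (by positivity)]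
        congr 2
        rw [add_mul, one_mul, pow_succ, pow_succ, pow_add, div_pow]
        field_simp
    _ ≤ _ := by gcongr

end Kernel

section Selection

variable {n : ℕ}

lemma volume_setOf_lt_lintegral_ball_le (hn : 1 ≤ n) {v : Rn n → ℝ≥0∞} (hv : ∫⁻ x, v x ≤ 1)
    {α : ℝ} (hα : 0 < α) :
    volume {x : Rn n | ∃ r : ℝ, 0 < r ∧
      ENNReal.ofReal (α * r ^ n) < ∫⁻ y in Metric.ball x r, v y} ≤
      ENNReal.ofReal (10 ^ n / α) := by
  set t : Set (Rn n) := {x | ∃ r : ℝ, 0 < r ∧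
      ENNReal.ofReal (α * r ^ n) < ∫⁻ y in Metric.ball x r, v y} with ht
  have ht' : ∀ x ∈ t, ∃ r : ℝ, 0 < r ∧
      ENNReal.ofReal (α * r ^ n) < ∫⁻ y in Metric.ball x r, v y := fun x hx => hx
  choose! r hr0 hr using ht'
  have hbound : ∀ x ∈ t, r x ≤ max 1 (1 / α) := by
    intro x hx
    by_contra! h
    have h1 := hr x hx
    have h2 : ∫⁻ y in Metric.ball x (r x), v y ≤ 1 := (setLIntegral_le_lintegral _ _).trans hv
    have h3 : ENNReal.ofReal (α * r x ^ n) < 1 := h1.trans_le h2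
    rw [ENNReal.ofReal_lt_one] at h3
    have h4 : 1 < r x := (le_max_left _ _).trans_lt h
    have h5 : 1 / α < r x := (le_max_right _ _).trans_lt h
    have h6 : r x ≤ r x ^ n := le_self_pow₀ h4.le (by omega)
    rw [div_lt_iff₀ hα] at h5
    nlinarith
  obtain ⟨u, hut, hdisj, hcov⟩ := Vitali.exists_disjoint_subfamily_covering_enlargement_closedBall
    t (fun x => x) r _ hbound 5 (by norm_num)
  have hcount : u.Countable := hdisj.countable_of_nonempty_interior fun x hx =>
    ⟨x, by rw [mem_interior_iff_mem_nhds]; exact Metric.closedBall_mem_nhds x (hr0 x (hut hx))⟩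
  have hsub : t ⊆ ⋃ x ∈ u, cube x (2 * (5 * r x)) := by
    intro x hx
    obtain ⟨y, hy, hxy⟩ := hcov x hx
    refine mem_iUnion₂.2 ⟨y, hy, closedBall_subset_cube _ _ (hxy ?_)⟩
    exact Metric.mem_closedBall_self (hr0 x hx).le
  calc volume t ≤ volume (⋃ x ∈ u, cube x (2 * (5 * r x))) := measure_mono hsub
    _ ≤ ∑' x : u, volume (cube (x : Rn n) (2 * (5 * r x))) := measure_biUnion_le _ hcount _
    _ ≤ ∑' x : u, ENNReal.ofReal (10 ^ n / α) * ∫⁻ y in Metric.closedBall (x : Rn n) (r x), v y := by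
        refine ENNReal.tsum_le_tsum fun x => ?_
        have hx0 := hr0 x (hut x.2)
        rw [volume_cube _ (by positivity)]
        calc ENNReal.ofReal ((2 * (5 * r x)) ^ n)
            = ENNReal.ofReal (10 ^ n / α) * ENNReal.ofReal (α * r x ^ n) := by
              rw [← ENNReal.ofReal_mul (by positivity)]
              congr 1
              rw [← mul_assoc, mul_pow]
              field_simp
              norm_num
          _ ≤ _ := by
              gcongr
              exact (hr x (hut x.2)).le.trans (lintegral_mono_set Metric.ball_subset_closedBall)
    _ = ENNReal.ofReal (10 ^ n / α) * ∫⁻ y in ⋃ x ∈ u, Metric.closedBall x (r x), v y := by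
        rw [ENNReal.tsum_mul_left, lintegral_biUnion hcount
          (fun x _ => Metric.isClosed_closedBall.measurableSet) hdisj]
    _ ≤ ENNReal.ofReal (10 ^ n / α) * 1 := by
        gcongr
        exact (setLIntegral_le_lintegral _ _).trans hv
    _ = _ := mul_one _

lemma IsDyadicCube.exists_side {Q : Set (Rn n)} (hQ : IsDyadicCube Q) :
    ∃ (c : Rn n) (l : ℝ), 0 < l ∧ Q ⊆ cube c l ∧ MeasurableSet Q ∧
      volume Q = ENNReal.ofReal (l ^ n) ∧ (∃ k : ℤ, l = 2 ^ k) ∧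
      ∃ m : Fin n → ℤ, Q = {x : Rn n | ∀ i, l * (m i : ℝ) ≤ x i ∧ x i < l * ((m i : ℝ) + 1)} := by
  obtain ⟨k, m, rfl⟩ := hQ
  have hl : (0 : ℝ) < 2 ^ k := by positivity
  refine ⟨WithLp.toLp 2 fun i => 2 ^ k * ((m i : ℝ) + 1 / 2), 2 ^ k, hl, ?_, ?_, ?_, ⟨k, rfl⟩,
    m, rfl⟩
  · intro x hx i
    obtain ⟨h1, h2⟩ := hx i
    simp only
    rw [abs_le]
    constructor <;> linarith
  · have : {x : Rn n | ∀ i, (2 : ℝ) ^ k * (m i : ℝ) ≤ x i ∧ x i < 2 ^ k * ((m i : ℝ) + 1)} =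
        ⋂ i, ({x : Rn n | (2 : ℝ) ^ k * (m i : ℝ) ≤ x i} ∩
          {x : Rn n | x i < 2 ^ k * ((m i : ℝ) + 1)}) := by ext x; simp
    rw [this]
    exact MeasurableSet.iInter fun i => (measurableSet_le (by fun_prop) (by fun_prop)).inter
      (measurableSet_lt (by fun_prop) (by fun_prop))
  · rw [show {x : Rn n | ∀ i, (2 : ℝ) ^ k * (m i : ℝ) ≤ x i ∧ x i < 2 ^ k * ((m i : ℝ) + 1)} =
      {x : Rn n | ∀ i, x i ∈ Ico ((2 : ℝ) ^ k * (m i : ℝ)) (2 ^ k * ((m i : ℝ) + 1))} from rfl,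
      volume_setOf_forall_mem]
    have hd : ∀ i, (2 : ℝ) ^ k * ((m i : ℝ) + 1) - 2 ^ k * (m i : ℝ) = 2 ^ k := fun i => by ring
    simp only [Real.volume_Ico, hd, Finset.prod_const, Finset.card_univ, Fintype.card_fin]
    rw [ENNReal.ofReal_pow hl.le]

lemma dyadic_interval_nested {k k' m m' : ℤ} (hk : k ≤ k') {t : ℝ}
    (h1 : (2 : ℝ) ^ k * m ≤ t) (h2 : t < 2 ^ k * (m + 1))
    (h1' : (2 : ℝ) ^ k' * m' ≤ t) (h2' : t < 2 ^ k' * (m' + 1)) :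
    (2 : ℝ) ^ k' * m' ≤ 2 ^ k * m ∧ (2 : ℝ) ^ k * (m + 1) ≤ 2 ^ k' * (m' + 1) := by
  obtain ⟨d, rfl⟩ := Int.le.dest hk
  have hp : (0 : ℝ) < 2 ^ k := by positivity
  have he : (2 : ℝ) ^ (k + (d : ℤ)) = 2 ^ k * ((2 ^ d : ℤ) : ℝ) := by
    rw [zpow_add₀ (by norm_num), zpow_natCast]; push_cast; rfl
  rw [he, mul_assoc] at h1' h2'
  rw [he, mul_assoc, mul_assoc]
  have e1 : ((2 ^ d : ℤ) : ℝ) * m' < m + 1 := lt_of_mul_lt_mul_left (h1'.trans_lt h2) hp.le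
  have e2 : (m : ℝ) < ((2 ^ d : ℤ) : ℝ) * (m' + 1) := lt_of_mul_lt_mul_left (h1.trans_lt h2') hp.le
  have e3 : (2 ^ d : ℤ) * m' < m + 1 := by exact_mod_cast e1
  have e4 : m < (2 ^ d : ℤ) * (m' + 1) := by exact_mod_cast e2
  have e5 : ((2 ^ d : ℤ) : ℝ) * m' ≤ m := by exact_mod_cast Int.lt_add_one_iff.1 e3
  have e6 : (m : ℝ) + 1 ≤ ((2 ^ d : ℤ) : ℝ) * (m' + 1) := by exact_mod_cast Int.add_one_le_iff.2 e4
  exact ⟨mul_le_mul_of_nonneg_left e5 hp.le, mul_le_mul_of_nonneg_left e6 hp.le⟩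

/-- Two dyadic cubes with a common point are nested. -/
lemma IsDyadicCube.subset_of_volume_le (hn : 1 ≤ n) {Q Q' : Set (Rn n)} (hQ : IsDyadicCube Q)
    (hQ' : IsDyadicCube Q') (h : volume Q ≤ volume Q') {x : Rn n} (hx : x ∈ Q) (hx' : x ∈ Q') :
    Q ⊆ Q' := by
  obtain ⟨-, l, hl, -, -, hv, ⟨k, rfl⟩, m, rfl⟩ := hQ.exists_side
  obtain ⟨-, l', hl', -, -, hv', ⟨k', rfl⟩, m', rfl⟩ := hQ'.exists_side
  rw [hv, hv', ENNReal.ofReal_le_ofReal_iff (by positivity)] at h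
  have hk : k ≤ k' := by
    have := (pow_le_pow_iff_left₀ hl.le hl'.le (by omega)).1 h
    exact (zpow_le_zpow_iff_right₀ (by norm_num)).1 this
  intro y hy i
  obtain ⟨h1, h2⟩ := dyadic_interval_nested hk (hx i).1 (hx i).2 (hx' i).1 (hx' i).2
  exact ⟨h1.trans (hy i).1, (hy i).2.trans_le h2⟩

/-- The data of a finite sum of everywhere bounded atoms. -/
structure AtomicData (n : ℕ) where
  size : ℕ
  coeff : Fin size → ℝ
  atom : Fin size → Rn n → ℝ
  center : Fin size → Rn n
  side : Fin size → ℝ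
  sum_le : ∑ q, |coeff q| ≤ 1
  isAtom : ∀ q, IsCubeAtom (center q) (side q) (atom q)

/-- The partial atomic sum over the index set `s`. -/
def AtomicData.sum (d : AtomicData n) (s : Finset (Fin d.size)) (x : Rn n) : ℝ :=
  ∑ q ∈ s, d.coeff q * d.atom q x

/-- Sum of the absolute values of the terms of an atomic sum. -/
def AtomicData.absSum (d : AtomicData n) (s : Finset (Fin d.size)) (x : Rn n) : ℝ≥0∞ :=
  ∑ q ∈ s, ‖d.coeff q‖ₑ * ‖d.atom q x‖ₑ

lemma sum_enorm_le_one {N : ℕ} {c : Fin N → ℝ} (h : ∑ q, |c q| ≤ 1) (s : Finset (Fin N)) :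
    ∑ q ∈ s, ‖c q‖ₑ ≤ 1 := by
  refine (Finset.sum_le_univ_sum_of_nonneg fun _ => zero_le).trans ?_
  simp only [Real.enorm_eq_ofReal_abs]
  rw [← ENNReal.ofReal_sum_of_nonneg fun _ _ => abs_nonneg _]
  exact ENNReal.ofReal_le_one.2 h

/-- Splitting of a finite atomic sum at height `α`. -/
lemma exists_good_atoms (hn : 1 ≤ n) {N : ℕ} {Q : Fin N → Set (Rn n)} {a : Fin N → Rn n → ℝ}
    {coeff : Fin N → ℝ} (hQ : ∀ k, IsDyadicCube (Q k)) (ha : ∀ k, IsH1Atom (Q k) (a k))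
    (hc : ∑ k, |coeff k| ≤ 1) {α : ℝ} (hα : 0 < α) :
    ∃ (d : AtomicData n) (s : Finset (Fin d.size)) (Ω : Set (Rn n)),
      (fun x => ∑ k, coeff k * a k x) =ᵐ[volume] d.sum Finset.univ ∧
      volume Ω ≤ ENNReal.ofReal (10 ^ n / α) ∧
      (∀ x, x ∉ Ω → ∀ r : ℝ, 0 < r →
        ∫⁻ y in Metric.ball x r, d.absSum Finset.univ y ≤ ENNReal.ofReal (α * r ^ n)) ∧
      (∀ q, q ∉ s → ∀ x, x ∉ Ω → 2 ^ (n + 1) * d.side q ≤ ‖x - d.center q‖) ∧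
      (∀ x, d.absSum s x ≤ ENNReal.ofReal ((2 ^ (n + 2)) ^ n * α)) := by
  classical
  choose c l hl hQc hQm hQv _ _ using fun k => (hQ k).exists_side
  set a' : Fin N → Rn n → ℝ := fun k => {x | |a k x| ≤ ((l k) ^ n)⁻¹}.indicator (a k) with ha'
  have hvol : ∀ k, (volume (Q k)).toReal = l k ^ n := fun k => by
    have := hl k
    rw [hQv, ENNReal.toReal_ofReal (by positivity)]
  have hae : ∀ k, a' k =ᵐ[volume] a k := by
    intro k
    filter_upwards [(ha k).2.2.1] with x hx
    rw [hvol] at hx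
    exact indicator_of_mem (s := {x | |a k x| ≤ ((l k) ^ n)⁻¹}) hx _
  have hzero : ∀ k x, x ∉ Q k → a' k x = 0 := fun k x hx => by
    simp [ha', indicator_apply, (ha k).2.1 x hx]
  have hle : ∀ k x, |a' k x| ≤ ((l k) ^ n)⁻¹ := by
    intro k x
    have := hl k
    by_cases hx : |a k x| ≤ ((l k) ^ n)⁻¹
    · simp [ha', hx]
    · simp only [ha', indicator_apply, mem_ofPred_eq, hx, if_false, abs_zero]; positivity
  have hatom : ∀ k, IsCubeAtom (c k) (l k) (a' k) := fun k =>
    { side_pos := hl k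
      measurable := (ha k).1.indicator (measurableSet_le (ha k).1.abs measurable_const)
      eq_zero := fun x hx => hzero k x fun h => hx (hQc k h)
      abs_le := hle k
      integral_eq_zero := by rw [integral_congr_ae (hae k)]; exact (ha k).2.2.2 }
  set d : AtomicData n := ⟨N, coeff, a', c, l, hc, hatom⟩ with hd
  set w : Fin N → Rn n → ℝ≥0∞ := fun k => (Q k).indicator fun _ => ENNReal.ofReal ((l k ^ n)⁻¹)
    with hw
  set v : Rn n → ℝ≥0∞ := fun x => ∑ k, ‖coeff k‖ₑ * w k x with hv
  have hwm : ∀ k, Measurable (w k) := fun k => measurable_const.indicator (hQm k)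
  have hw1 : ∀ k, ∫⁻ x, w k x ≤ 1 := by
    intro k
    have := hl k
    rw [hw, lintegral_indicator (hQm k), setLIntegral_const, hQv,
      ← ENNReal.ofReal_mul (by positivity), inv_mul_cancel₀ (by positivity), ENNReal.ofReal_one]
  have haw : ∀ k x, ‖a' k x‖ₑ ≤ w k x := by
    intro k x
    by_cases hx : x ∈ Q k
    · rw [hw]; simp only; rw [indicator_of_mem hx, Real.enorm_eq_ofReal_abs]
      exact ENNReal.ofReal_le_ofReal (hle k x)
    · simp [hzero k x hx]
  have hv1 : ∫⁻ x, v x ≤ 1 := by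
    rw [hv, lintegral_finsetSum _ fun k _ => (hwm k).const_mul _]
    calc _ ≤ ∑ k, ‖coeff k‖ₑ := by
          refine Finset.sum_le_sum fun k _ => ?_
          rw [lintegral_const_mul _ (hwm k)]
          exact mul_le_of_le_one_right' (hw1 k)
      _ ≤ 1 := sum_enorm_le_one hc _
  set Λ : ℝ := (2 ^ (n + 2)) ^ n with hΛ
  set good : Finset (Fin N) := Finset.univ.filter fun k =>
    ∫⁻ y in Q k, v y ≤ ENNReal.ofReal (Λ * α * l k ^ n) with hgood
  set Ω : Set (Rn n) := {x | ∃ r : ℝ, 0 < r ∧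
      ENNReal.ofReal (α * r ^ n) < ∫⁻ y in Metric.ball x r, v y} with hΩ
  refine ⟨d, good, Ω, ?_, volume_setOf_lt_lintegral_ball_le hn hv1 hα, ?_, ?_, ?_⟩
  · filter_upwards [eventually_countable_forall.2 hae] with x hx
    exact Finset.sum_congr rfl fun k _ => by rw [← hx k]
  · intro x hx r hr
    have h1 : ∫⁻ y in Metric.ball x r, v y ≤ ENNReal.ofReal (α * r ^ n) := by
      by_contra! h; exact hx ⟨r, hr, h⟩
    refine le_trans (lintegral_mono fun y => ?_) h1
    exact Finset.sum_le_sum fun k _ => mul_le_mul_right (haw k y) _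
  · intro q hq x hx
    by_contra! h
    refine hx ⟨2 ^ (n + 2) * l q, mul_pos (by positivity) (hl q), ?_⟩
    have h1 : ENNReal.ofReal (Λ * α * l q ^ n) < ∫⁻ y in Q q, v y := by
      by_contra! h'
      exact hq (Finset.mem_filter.2 ⟨Finset.mem_univ _, h'⟩)
    calc ENNReal.ofReal (α * (2 ^ (n + 2) * l q) ^ n)
        = ENNReal.ofReal (Λ * α * l q ^ n) := by rw [mul_pow _ (l q), hΛ]; congr 1; ring
      _ < _ := h1
      _ ≤ _ := lintegral_mono_set ((hQc q).trans (cube_subset_ball (hl q) h))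
  · intro x
    set t := good.filter fun k => x ∈ Q k with ht
    have hred : d.absSum good x ≤ ∑ k ∈ t, ‖coeff k‖ₑ * ENNReal.ofReal ((l k ^ n)⁻¹) := by
      rw [ht, Finset.sum_filter]
      refine Finset.sum_le_sum fun k _ => ?_
      split_ifs with hx
      · refine mul_le_mul_right ((haw k x).trans ?_) _
        rw [hw]; simp only; rw [indicator_of_mem hx]
      · have : d.atom k x = 0 := hzero k x hx
        simp [this]
    refine hred.trans ?_
    rcases t.eq_empty_or_nonempty with he | hne
    · simp [he]
    obtain ⟨k₀, hk₀, hmin⟩ := t.exists_min_image (fun k => volume (Q k)) hne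
    obtain ⟨hk₀g, hxk₀⟩ := Finset.mem_filter.1 hk₀
    have hk₀' := (Finset.mem_filter.1 hk₀g).2
    have hl0 := hl k₀
    have hsub : ∀ k ∈ t, Q k₀ ⊆ Q k := fun k hk =>
      (hQ k₀).subset_of_volume_le hn (hQ k) (hmin k hk) hxk₀ (Finset.mem_filter.1 hk).2
    have h1 : (∑ k ∈ t, ‖coeff k‖ₑ * ENNReal.ofReal ((l k ^ n)⁻¹)) * volume (Q k₀) ≤
        ENNReal.ofReal (Λ * α * l k₀ ^ n) := by
      refine le_trans ?_ hk₀'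
      rw [← setLIntegral_const]
      refine setLIntegral_mono' (hQm k₀) fun y hy => ?_
      calc _ ≤ ∑ k ∈ t, ‖coeff k‖ₑ * w k y := by
            refine Finset.sum_le_sum fun k hk => ?_
            rw [hw]; simp only; rw [indicator_of_mem (hsub k hk hy)]
        _ ≤ v y := Finset.sum_le_univ_sum_of_nonneg fun _ => zero_le
    rw [hQv, ENNReal.ofReal_mul (q := l k₀ ^ n) (by positivity)] at h1
    refine (ENNReal.mul_le_mul_iff_left ?_ ENNReal.ofReal_ne_top).1 h1
    simpa using pow_pos hl0 n

end Selection

section Operator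

variable {n m : ℕ}

/-- The weak type `L¹ × ⋯ × L¹ → L^{1/m,∞}` bound with constant `C₂`. -/
def WeakTypeOne (T : (Fin m → Rn n → ℝ) → Rn n → ℝ) (C₂ : ℝ) : Prop :=
  ∀ f : Fin m → Rn n → ℝ, (∀ j, Integrable (f j)) → ∀ lam : ℝ, 0 < lam →
    volume {x | lam < |T f x|} ≤
      ENNReal.ofReal ((C₂ * (∏ j, l1norm (f j)) / lam) ^ ((1 : ℝ) / (m : ℝ)))

lemma forall_update (P : (Rn n → ℝ) → Prop) {f : Fin m → Rn n → ℝ} (hf : ∀ k, P (f k))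
    {g : Rn n → ℝ} (hg : P g) (j k : Fin m) : P (Function.update f j g k) := by
  rcases eq_or_ne k j with rfl | h
  · rwa [Function.update_self]
  · rw [Function.update_of_ne h]; exact hf k

lemma MultilinM.map_finset_sum {T : (Fin m → Rn n → ℝ) → Rn n → ℝ} (hT : MultilinM T)
    {f : Fin m → Rn n → ℝ} (hf : ∀ k, Integrable (f k)) (j : Fin m) {ι : Type*} (s : Finset ι)
    (coeff : ι → ℝ) (g : ι → Rn n → ℝ) (hg : ∀ q, Integrable (g q)) (x : Rn n) :
    T (Function.update f j (fun y => ∑ q ∈ s, coeff q * g q y)) x =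
      ∑ q ∈ s, coeff q * T (Function.update f j (g q)) x := by
  classical
  induction s using Finset.induction_on with
  | empty =>
    have := hT.2 f j 0 (fun _ => 0) hf (integrable_zero _ _ _) x
    simpa using this
  | insert q s hq ih =>
    simp only [Finset.sum_insert hq]
    rw [hT.1 f j (fun y => coeff q * g q y) (fun y => ∑ q ∈ s, coeff q * g q y) hf
      ((hg q).const_mul _) (integrable_finsetSum _ fun q _ => (hg q).const_mul _), ih,
      hT.2 f j _ _ hf (hg q)]

lemma ae_eq_zero_of_l1norm_eq_zero (hm : 1 ≤ m) {T : (Fin m → Rn n → ℝ) → Rn n → ℝ} {C₂ : ℝ}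
    (hW : WeakTypeOne T C₂) {f : Fin m → Rn n → ℝ} (hf : ∀ k, Integrable (f k)) {j : Fin m}
    (hj : l1norm (f j) = 0) : T f =ᵐ[volume] 0 := by
  have h : ∀ i : ℕ, volume {x | (1 : ℝ) / (i + 1) < |T f x|} = 0 := by
    intro i
    have := hW f hf (1 / (i + 1)) (by positivity)
    rw [Finset.prod_eq_zero (Finset.mem_univ j) hj, mul_zero, zero_div,
      Real.zero_rpow (by positivity), ENNReal.ofReal_zero] at this
    exact nonpos_iff_eq_zero.1 this
  have h' : ∀ i : ℕ, ∀ᵐ x ∂(volume : Measure (Rn n)), |T f x| ≤ 1 / (i + 1) := by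
    intro i
    rw [ae_iff]
    simpa only [not_le] using h i
  filter_upwards [ae_all_iff.2 h'] with x hx
  have : |T f x| ≤ 0 := by
    by_contra! hlt
    obtain ⟨i, hi⟩ := exists_nat_one_div_lt hlt
    exact absurd (hx i) (not_le.2 hi)
  exact abs_nonpos_iff.1 this

lemma MultilinM.update_congr_ae (hm : 1 ≤ m) {T : (Fin m → Rn n → ℝ) → Rn n → ℝ} {C₂ : ℝ}
    (hT : MultilinM T) (hW : WeakTypeOne T C₂) {f : Fin m → Rn n → ℝ}
    (hf : ∀ k, Integrable (f k)) (j : Fin m) {g g' : Rn n → ℝ} (hg : Integrable g)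
    (hgg' : g =ᵐ[volume] g') :
    T (Function.update f j g) =ᵐ[volume] T (Function.update f j g') := by
  have hg' : Integrable g' := hg.congr hgg'
  have h0 : l1norm (fun y => g y - g' y) = 0 := by
    rw [l1norm, integral_eq_zero_of_ae]
    filter_upwards [hgg'] with x hx
    simp [hx]
  have hsub : Integrable fun y => g y - g' y := hg.sub hg'
  have hz := ae_eq_zero_of_l1norm_eq_zero hm hW
    (f := Function.update f j fun y => g y - g' y) (j := j)
    (forall_update (Integrable ·) hf hsub j) (by rw [Function.update_self]; exact h0)
  filter_upwards [hz] with x hx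
  have := hT.1 f j g' (fun y => g y - g' y) hf hg' hsub x
  rw [hx] at this
  simpa using this

lemma MultilinM.congr_ae (hm : 1 ≤ m) {T : (Fin m → Rn n → ℝ) → Rn n → ℝ} {C₂ : ℝ}
    (hT : MultilinM T) (hW : WeakTypeOne T C₂) {f g : Fin m → Rn n → ℝ}
    (hf : ∀ k, Integrable (f k)) (hfg : ∀ k, f k =ᵐ[volume] g k) : T f =ᵐ[volume] T g := by
  have hg : ∀ k, Integrable (g k) := fun k => (hf k).congr (hfg k)
  have key : ∀ S : Finset (Fin m), T (S.piecewise g f) =ᵐ[volume] T f := by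
    intro S
    induction S using Finset.induction_on with
    | empty => simp
    | insert j S hj ih =>
      refine Filter.EventuallyEq.trans ?_ ih
      have hInt : ∀ k, Integrable (S.piecewise g f k) := fun k => by
        by_cases hk : k ∈ S
        · rw [Finset.piecewise_eq_of_mem _ _ _ hk]; exact hg k
        · rw [Finset.piecewise_eq_of_notMem _ _ _ hk]; exact hf k
      have := hT.update_congr_ae hm hW hInt j (hg j) (hfg j).symm
      rw [Finset.piecewise_insert]
      refine this.trans ?_
      rw [Function.update_eq_self_iff.2 (Finset.piecewise_eq_of_notMem _ _ _ hj).symm]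
  have := key Finset.univ
  rw [Finset.piecewise_univ] at this
  exact this.symm

lemma integrable_mul_of_bounded {b f : Rn n → ℝ} (hb : LocallyIntegrable b volume)
    (hf : Measurable f) {A : ℝ} (hA : ∀ x, |f x| ≤ A) (hs : HasCompactSupport f) :
    Integrable fun y => b y * f y := by
  have h : (fun y => b y * f y) = fun y => f y * (tsupport f).indicator b y := by
    ext y
    by_cases hy : y ∈ tsupport f
    · rw [indicator_of_mem hy, mul_comm]
    · rw [image_eq_zero_of_notMem_tsupport hy]; simp
  rw [h]
  refine Integrable.bdd_mul (c := A) ?_ hf.aestronglyMeasurable (.of_forall hA)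
  rw [integrable_indicator_iff hs.isClosed.measurableSet]
  exact hb.integrableOn_isCompact hs

/-- The `j`-th commutator term `b·T(f⃗) − T(f₁,…,b f_j,…,f_m)`. -/
def commTerm (T : (Fin m → Rn n → ℝ) → Rn n → ℝ) (b : Rn n → ℝ) (f : Fin m → Rn n → ℝ)
    (j : Fin m) (x : Rn n) : ℝ :=
  b x * T f x - T (Function.update f j (fun y => b y * f j y)) x

lemma commTerm_congr_ae (hm : 1 ≤ m) {T : (Fin m → Rn n → ℝ) → Rn n → ℝ} {C₂ : ℝ}
    (hT : MultilinM T) (hW : WeakTypeOne T C₂) {b : Rn n → ℝ} {f g : Fin m → Rn n → ℝ}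
    (hf : ∀ k, Integrable (f k)) (j : Fin m) (hbf : Integrable fun y => b y * f j y)
    (hfg : ∀ k, f k =ᵐ[volume] g k) : commTerm T b f j =ᵐ[volume] commTerm T b g j := by
  have h1 := hT.congr_ae hm hW hf hfg
  have h2 := hT.congr_ae hm hW (f := Function.update f j fun y => b y * f j y)
    (g := Function.update g j fun y => b y * g j y) (forall_update (Integrable ·) hf hbf j) (by
      intro k
      rcases eq_or_ne k j with rfl | h
      · rw [Function.update_self, Function.update_self]
        filter_upwards [hfg k] with x hx
        rw [hx]
      · rw [Function.update_of_ne h, Function.update_of_ne h]; exact hfg k)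
  filter_upwards [h1, h2] with x hx1 hx2
  rw [commTerm, commTerm, hx1, hx2]

lemma commTerm_update_add {T : (Fin m → Rn n → ℝ) → Rn n → ℝ} (hT : MultilinM T) {b : Rn n → ℝ}
    {f : Fin m → Rn n → ℝ} (hf : ∀ k, Integrable (f k))
    (hbf : ∀ k, Integrable fun y => b y * f k y) (i j : Fin m) {g h : Rn n → ℝ}
    (hg : Integrable g) (hh : Integrable h) (hbg : Integrable fun y => b y * g y)
    (hbh : Integrable fun y => b y * h y) (x : Rn n) :
    commTerm T b (Function.update f i fun y => g y + h y) j x =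
      commTerm T b (Function.update f i g) j x + commTerm T b (Function.update f i h) j x := by
  simp only [commTerm]
  rw [hT.1 f i g h hf hg hh]
  rcases eq_or_ne j i with rfl | hij
  · simp only [Function.update_self, Function.update_idem, mul_add]
    rw [hT.1 f j _ _ hf hbg hbh]
    ring
  · simp only [Function.update_of_ne hij]
    rw [Function.update_comm hij.symm, Function.update_comm hij.symm,
      Function.update_comm hij.symm, hT.1 _ i g h (forall_update (Integrable ·) hf (hbf j) j) hg hh]
    ring

lemma ae_enorm_le_annularMajorant {C₀ : ℝ} {ω : ℝ → ℝ} (hC₀ : 0 < C₀)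
    (hω0 : ∀ t, 0 < t → 0 ≤ ω t) (hωmono : ∀ s t : ℝ, 0 < s → s ≤ t → ω s ≤ ω t) (hn : 1 ≤ n)
    {K : Rn n → (Fin m → Rn n) → ℝ} (hK : IsCZKernelM C₀ ω K)
    {T : (Fin m → Rn n → ℝ) → Rn n → ℝ} (hrep : KernelRepM K T)
    {u : Fin m → Rn n → ℝ} (hu : ∀ i, Measurable (u i)) (hInt : ∀ i, Integrable (u i))
    (hsupp : ∀ i, HasCompactSupport (u i)) (j : Fin m) {c : Rn n} {l : ℝ}
    (ha : IsCubeAtom c l (u j)) :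
    ∀ᵐ x ∂volume, 2 ^ (n + 1) * l ≤ ‖x - c‖ → ∀ A : Fin m → ℝ≥0∞,
      (∀ i, i ≠ j → ∀ r : ℝ, 0 < r →
        ∫⁻ y in Metric.ball x r, ‖u i y‖ₑ ≤ A i * ENNReal.ofReal (r ^ n)) →
      ‖T u x‖ₑ ≤ ENNReal.ofReal (2 ^ (m * n + 1) * C₀) * (∏ i ∈ Finset.univ.erase j, A i) *
        annularMajorant ω c l x := by
  obtain ⟨k, rfl⟩ : ∃ k, m = k + 1 := ⟨m - 1, by have := j.pos; omega⟩
  filter_upwards [hrep u hInt hsupp] with x hx hfar A hA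
  have hl := ha.side_pos
  have hmem : x ∉ ⋂ j, tsupport (u j) := by
    intro h
    have h1 := norm_sub_le_of_mem_cube hl.le (ha.tsupport_subset (mem_iInter.1 h j))
    have h2 : (0 : ℝ) < 2 ^ n * l := by positivity
    rw [pow_succ] at hfar
    linarith
  rw [hx hmem]
  exact enorm_integral_kernel_le hC₀ hω0 hωmono hn hK u hu j ha hfar A hA

end Operator

section AtomicSums

variable {n : ℕ}

lemma lintegral_sum_coeff_mul_le {N : ℕ} {c : Fin N → ℝ} (hc : ∑ q, |c q| ≤ 1)
    (s : Finset (Fin N)) {g : Fin N → Rn n → ℝ≥0∞} (hg : ∀ q, AEMeasurable (g q))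
    {κ : ℝ≥0∞} (hκ : ∀ q, ∫⁻ x, g q x ≤ κ) : ∫⁻ x, ∑ q ∈ s, ‖c q‖ₑ * g q x ≤ κ := by
  rw [lintegral_finsetSum' _ fun q _ => (hg q).const_mul _]
  calc ∑ q ∈ s, ∫⁻ x, ‖c q‖ₑ * g q x ≤ ∑ q ∈ s, ‖c q‖ₑ * κ := by
        refine Finset.sum_le_sum fun q _ => ?_
        rw [lintegral_const_mul'' _ (hg q)]
        exact mul_le_mul_right (hκ q) _
    _ = (∑ q ∈ s, ‖c q‖ₑ) * κ := by rw [Finset.sum_mul]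
    _ ≤ 1 * κ := by gcongr; exact sum_enorm_le_one hc s
    _ = κ := one_mul κ

lemma l1norm_le_of_lintegral_le {f : Rn n → ℝ} (hf : AEStronglyMeasurable f) {c : ℝ} (hc : 0 ≤ c)
    (h : ∫⁻ x, ‖f x‖ₑ ≤ ENNReal.ofReal c) : l1norm f ≤ c := by
  have : l1norm f = (∫⁻ x, ‖f x‖ₑ).toReal := integral_norm_eq_lintegral_enorm hf
  rw [this]
  exact ENNReal.toReal_le_of_le_ofReal hc h

lemma l1norm_nonneg (f : Rn n → ℝ) : 0 ≤ l1norm f := integral_nonneg fun _ => abs_nonneg _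

namespace AtomicData

variable (d : AtomicData n) (s : Finset (Fin d.size))

lemma measurable_sum : Measurable (d.sum s) :=
  Finset.measurable_sum _ fun q _ => ((d.isAtom q).measurable.const_mul _)

lemma enorm_sum_le (x : Rn n) : ‖d.sum s x‖ₑ ≤ d.absSum s x := by
  refine (_root_.enorm_sum_le _ _).trans (Finset.sum_le_sum fun q _ => ?_)
  rw [enorm_mul]

lemma absSum_le_univ (x : Rn n) : d.absSum s x ≤ d.absSum Finset.univ x :=
  Finset.sum_le_univ_sum_of_nonneg fun _ => zero_le

lemma lintegral_enorm_sum_le : ∫⁻ x, ‖d.sum s x‖ₑ ≤ 1 :=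
  (lintegral_mono (d.enorm_sum_le s)).trans <| lintegral_sum_coeff_mul_le d.sum_le s
    (fun q => (d.isAtom q).measurable.enorm.aemeasurable) fun q => (d.isAtom q).lintegral_le_one

lemma integrable_sum : Integrable (d.sum s) :=
  integrable_finsetSum _ fun q _ => (d.isAtom q).integrable.const_mul _

lemma l1norm_sum_le : l1norm (d.sum s) ≤ 1 :=
  l1norm_le_of_lintegral_le (d.measurable_sum s).aestronglyMeasurable zero_le_one
    (by rw [ENNReal.ofReal_one]; exact d.lintegral_enorm_sum_le s)

lemma hasCompactSupport_sum : HasCompactSupport (d.sum s) := by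
  refine HasCompactSupport.intro (K := ⋃ q, cube (d.center q) (d.side q))
    (isCompact_iUnion fun q => isCompact_cube _ (d.isAtom q).side_pos.le) fun x hx => ?_
  refine Finset.sum_eq_zero fun q _ => ?_
  rw [(d.isAtom q).eq_zero x fun h => hx (mem_iUnion.2 ⟨q, h⟩), mul_zero]

lemma abs_sum_le (x : Rn n) :
    |d.sum s x| ≤ ∑ q ∈ s, |d.coeff q| * ((d.side q) ^ n)⁻¹ := by
  refine (Finset.abs_sum_le_sum_abs _ _).trans (Finset.sum_le_sum fun q _ => ?_)
  rw [abs_mul]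
  exact mul_le_mul_of_nonneg_left ((d.isAtom q).abs_le x) (abs_nonneg _)

lemma integrable_mul_sum {b : Rn n → ℝ} (hb : LocallyIntegrable b volume) :
    Integrable fun y => b y * d.sum s y :=
  integrable_mul_of_bounded hb (d.measurable_sum s) (d.abs_sum_le s) (d.hasCompactSupport_sum s)

lemma sum_add_sum_sdiff (x : Rn n) :
    d.sum s x + d.sum (Finset.univ \ s) x = d.sum Finset.univ x := by
  rw [add_comm]
  exact Finset.sum_sdiff (Finset.subset_univ s)

/-- The mean of `b` over the cube of the `q`-th atom. -/
def mean (b : Rn n → ℝ) (q : Fin d.size) : ℝ := avgOn b (cube (d.center q) (d.side q))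

/-- The sum of the annular majorants of the atoms. -/
def annularSum (ω : ℝ → ℝ) (x : Rn n) : ℝ≥0∞ :=
  ∑ q ∈ s, ‖d.coeff q‖ₑ * annularMajorant ω (d.center q) (d.side q) x

/-- The sum of the annular majorants of the atoms weighted by the oscillation of `b`. -/
def oscAnnularSum (ω : ℝ → ℝ) (b : Rn n → ℝ) (x : Rn n) : ℝ≥0∞ :=
  ∑ q ∈ s, ‖d.coeff q‖ₑ *
    (‖b x - d.mean b q‖ₑ * annularMajorant ω (d.center q) (d.side q) x)

/-- The sum of the local majorants of the atoms weighted by the oscillation of `b`. -/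
def oscLocalSum (b : Rn n → ℝ) (x : Rn n) : ℝ≥0∞ :=
  ∑ q ∈ s, ‖d.coeff q‖ₑ * (‖b x - d.mean b q‖ₑ * localMajorant (d.center q) (d.side q) x)

lemma lintegral_annularSum_le {ω : ℝ → ℝ} (hω0 : ∀ t, 0 < t → 0 ≤ ω t) :
    ∫⁻ x, d.annularSum s ω x ≤ ENNReal.ofReal (4 ^ n) * dyadicDiniSum ω :=
  lintegral_sum_coeff_mul_le d.sum_le s (fun _ => (measurable_annularMajorant _ _ _).aemeasurable)
    fun q => lintegral_annularMajorant_le hω0 _ (d.isAtom q).side_pos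

lemma aemeasurable_enorm_sub_mean {b : Rn n → ℝ} (hb : LocallyIntegrable b volume)
    (q : Fin d.size) : AEMeasurable fun x => ‖b x - d.mean b q‖ₑ :=
  (hb.aestronglyMeasurable.sub aestronglyMeasurable_const).enorm

lemma lintegral_oscAnnularSum_le {b : Rn n → ℝ} (hb : LocallyIntegrable b volume) {M : ℝ}
    (hM : OscBound b M) (hM0 : 0 ≤ M)
    {ω : ℝ → ℝ} (hω0 : ∀ t, 0 < t → 0 ≤ ω t) :
    ∫⁻ x, d.oscAnnularSum s ω b x ≤
      ENNReal.ofReal (8 ^ n * (n + 4) * M) * dyadicDiniSum ω :=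
  lintegral_sum_coeff_mul_le d.sum_le s (fun q => (d.aemeasurable_enorm_sub_mean hb q).mul
    (measurable_annularMajorant _ _ _).aemeasurable)
    fun q => lintegral_sub_avgOn_mul_annularMajorant_le hω0 hb hM hM0 _ (d.isAtom q).side_pos

lemma lintegral_oscLocalSum_le {b : Rn n → ℝ} (hb : LocallyIntegrable b volume) {M : ℝ}
    (hM : OscBound b M) (hM0 : 0 ≤ M) :
    ∫⁻ x, d.oscLocalSum s b x ≤
      ENNReal.ofReal ((2 ^ (n + 2)) ^ n * (M * (1 + (n + 2 : ℕ) * 2 ^ n))) :=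
  lintegral_sum_coeff_mul_le d.sum_le s (fun q => (d.aemeasurable_enorm_sub_mean hb q).mul
    (measurable_localMajorant _ _).aemeasurable)
    fun q => lintegral_sub_avgOn_mul_localMajorant_le hb hM hM0 _ (d.isAtom q).side_pos

lemma lintegral_sub_mean_mul_atom_le {b : Rn n → ℝ} (hb : LocallyIntegrable b volume) {M : ℝ}
    (hM : OscBound b M) (hM0 : 0 ≤ M) (q : Fin d.size) :
    ∫⁻ x, ‖(b x - d.mean b q) * d.atom q x‖ₑ ≤ ENNReal.ofReal M := by
  have hl := (d.isAtom q).side_pos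
  calc ∫⁻ x, ‖(b x - d.mean b q) * d.atom q x‖ₑ
      ≤ ∫⁻ x, (cube (d.center q) (d.side q)).indicator
          (fun x => ‖b x - d.mean b q‖ₑ * ENNReal.ofReal ((d.side q ^ n)⁻¹)) x := by
        refine lintegral_mono fun x => ?_
        rw [enorm_mul]
        by_cases hx : x ∈ cube (d.center q) (d.side q)
        · rw [indicator_of_mem hx]
          refine mul_le_mul_right (((d.isAtom q).enorm_le x).trans ?_) _
          rw [indicator_of_mem hx]
        · rw [(d.isAtom q).eq_zero x hx]; simp
    _ = (∫⁻ x in cube (d.center q) (d.side q), ‖b x - d.mean b q‖ₑ) *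
          ENNReal.ofReal ((d.side q ^ n)⁻¹) := by
        rw [lintegral_indicator (measurableSet_cube _ _),
          lintegral_mul_const'' _ (d.aemeasurable_enorm_sub_mean hb q).restrict]
    _ ≤ ENNReal.ofReal (d.side q ^ n * M) * ENNReal.ofReal ((d.side q ^ n)⁻¹) := by
        gcongr
        exact lintegral_cube_sub_avgOn_le hb hM _ hl
    _ = ENNReal.ofReal M := by
        rw [← ENNReal.ofReal_mul (by positivity)]
        congr 1
        field_simp

lemma l1norm_sum_sub_mean_le {b : Rn n → ℝ} (hb : LocallyIntegrable b volume) {M : ℝ}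
    (hM : OscBound b M) (hM0 : 0 ≤ M) :
    l1norm (fun x => ∑ q ∈ s, d.coeff q * ((b x - d.mean b q) * d.atom q x)) ≤ M := by
  have hm : ∀ q, AEStronglyMeasurable fun x => (b x - d.mean b q) * d.atom q x := fun q =>
    (hb.aestronglyMeasurable.sub aestronglyMeasurable_const).mul
      (d.isAtom q).measurable.aestronglyMeasurable
  refine l1norm_le_of_lintegral_le
    (Finset.aestronglyMeasurable_fun_sum _ fun q _ => (hm q).const_mul _) hM0 ?_
  refine le_trans (lintegral_mono fun x => ?_) <| lintegral_sum_coeff_mul_le d.sum_le s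
    (fun q => (hm q).enorm) fun q => d.lintegral_sub_mean_mul_atom_le hb hM hM0 q
  refine (_root_.enorm_sum_le _ _).trans (Finset.sum_le_sum fun q _ => ?_)
  rw [enorm_mul]

end AtomicData

end AtomicSums

section FarEstimate

variable {n m : ℕ}

lemma lintegral_ball_enorm_sum_le (d : AtomicData n) (s : Finset (Fin d.size)) {α : ℝ}
    (hα : 0 < α) {x : Rn n} {r : ℝ}
    (h : ∫⁻ y in Metric.ball x r, d.absSum Finset.univ y ≤ ENNReal.ofReal (α * r ^ n)) :
    ∫⁻ y in Metric.ball x r, ‖d.sum s y‖ₑ ≤ ENNReal.ofReal α * ENNReal.ofReal (r ^ n) := by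
  rw [← ENNReal.ofReal_mul hα.le]
  exact (lintegral_mono fun y => (d.enorm_sum_le s y).trans (d.absSum_le_univ s y)).trans h

/-- Pointwise bound for `T` when its `j`-th entry is a single atom. The cancellation of that atom
is used away from its cube, and the cancellation of the atoms in the `i`-th entry near it. -/
lemma ae_enorm_update_atom_le {C₀ : ℝ} {ω : ℝ → ℝ} (hC₀ : 0 < C₀)
    (hω0 : ∀ t, 0 < t → 0 ≤ ω t) (hωmono : ∀ s t : ℝ, 0 < s → s ≤ t → ω s ≤ ω t) (hn : 1 ≤ n)
    {K : Rn n → (Fin m → Rn n) → ℝ} (hK : IsCZKernelM C₀ ω K)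
    {T : (Fin m → Rn n → ℝ) → Rn n → ℝ} (hT : MultilinM T) (hrep : KernelRepM K T)
    (d : Fin m → AtomicData n) (s : ∀ k, Finset (Fin (d k).size)) {i : Fin m} {Ω : Set (Rn n)}
    {α : ℝ} (hα : 0 < α)
    (hgrowth : ∀ k, ∀ x, x ∉ Ω → ∀ r : ℝ, 0 < r →
      ∫⁻ y in Metric.ball x r, (d k).absSum Finset.univ y ≤ ENNReal.ofReal (α * r ^ n))
    (hfar : ∀ q, q ∈ s i → ∀ x, x ∉ Ω → 2 ^ (n + 1) * (d i).side q ≤ ‖x - (d i).center q‖)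
    (j : Fin m) (q : Fin (d j).size) (hq : q ∈ s j) :
    ∀ᵐ x ∂volume, x ∉ Ω →
      ‖T (Function.update (fun k => (d k).sum (s k)) j ((d j).atom q)) x‖ₑ ≤
        ENNReal.ofReal (2 ^ (m * n + 1) * C₀) * ENNReal.ofReal α ^ (m - 1) *
          (annularMajorant ω ((d j).center q) ((d j).side q) x +
            ENNReal.ofReal (2 ^ n / α) * localMajorant ((d j).center q) ((d j).side q) x *
              (d i).annularSum (s i) ω x) := by
  have hatom := (d j).isAtom q
  obtain ⟨u, hu⟩ : ∃ u : Fin m → Rn n → ℝ, u = fun k => (d k).sum (s k) := ⟨_, rfl⟩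
  obtain ⟨a, ha⟩ : ∃ a : Rn n → ℝ, a = (d j).atom q := ⟨_, rfl⟩
  rw [← hu, ← ha]
  rw [← ha] at hatom
  have hum : ∀ k, Measurable (u k) := fun k => by rw [hu]; exact (d k).measurable_sum (s k)
  have hui : ∀ k, Integrable (u k) := fun k => by rw [hu]; exact (d k).integrable_sum (s k)
  have hus : ∀ k, HasCompactSupport (u k) := fun k => by
    rw [hu]; exact (d k).hasCompactSupport_sum (s k)
  have hug : ∀ k, ∀ x, x ∉ Ω → ∀ r : ℝ, 0 < r →
      ∫⁻ y in Metric.ball x r, ‖u k y‖ₑ ≤ ENNReal.ofReal α * ENNReal.ofReal (r ^ n) := by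
    intro k x hx r hr
    rw [hu]
    exact lintegral_ball_enorm_sum_le (d k) (s k) hα (hgrowth k x hx r hr)
  have hvm := forall_update (Measurable ·) hum hatom.measurable j
  have hvi := forall_update (Integrable ·) hui hatom.integrable j
  have hvs := forall_update (HasCompactSupport ·) hus hatom.hasCompactSupport j
  have h1 := ae_enorm_le_annularMajorant hC₀ hω0 hωmono hn hK hrep hvm hvi hvs j
    (by rw [Function.update_self]; exact hatom)
  have h2 : ∀ P : Fin (d i).size, _ := fun P =>
    ae_enorm_le_annularMajorant hC₀ hω0 hωmono hn hK hrep
      (forall_update (Measurable ·) hvm ((d i).isAtom P).measurable i)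
      (forall_update (Integrable ·) hvi ((d i).isAtom P).integrable i)
      (forall_update (HasCompactSupport ·) hvs ((d i).isAtom P).hasCompactSupport i) i
      (by rw [Function.update_self]; exact (d i).isAtom P)
  filter_upwards [h1, ae_all_iff.2 h2] with x hx1 hx2 hx
  by_cases hxfar : 2 ^ (n + 1) * (d j).side q ≤ ‖x - (d j).center q‖
  · have h3 := hx1 hxfar (fun _ => ENNReal.ofReal α) (fun k hk r hr => by
      rw [Function.update_of_ne hk]; exact hug k x hx r hr)
    rw [Finset.prod_const, Finset.card_erase_of_mem (Finset.mem_univ j), Finset.card_univ,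
      Fintype.card_fin] at h3
    exact h3.trans (mul_le_mul_right le_self_add _)
  have hij : i ≠ j := by
    rintro rfl
    exact hxfar (hfar q hq x hx)
  have hl := hatom.side_pos
  have hloc : localMajorant ((d j).center q) ((d j).side q) x =
      ENNReal.ofReal (((d j).side q ^ n)⁻¹) := by
    refine indicator_of_mem ?_ _
    rw [Metric.mem_ball, dist_eq_norm]
    exact not_le.1 hxfar
  obtain ⟨B, hB⟩ : ∃ B : ℝ≥0∞, B = ENNReal.ofReal (2 ^ n / α) *
    localMajorant ((d j).center q) ((d j).side q) x := ⟨_, rfl⟩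
  have hαB : ENNReal.ofReal α * B = ENNReal.ofReal (2 ^ n * ((d j).side q ^ n)⁻¹) := by
    rw [hB, hloc, ← mul_assoc, ← ENNReal.ofReal_mul hα.le, ← ENNReal.ofReal_mul (by positivity)]
    congr 2
    field_simp
  have hP : ∀ P ∈ s i, ‖T (Function.update (Function.update u j a) i ((d i).atom P)) x‖ₑ ≤
      ENNReal.ofReal (2 ^ (m * n + 1) * C₀) * ENNReal.ofReal α ^ (m - 1) * B *
        annularMajorant ω ((d i).center P) ((d i).side P) x := by
    intro P hPs
    have h3 := hx2 P (hfar P hPs x hx)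
      (fun k => ENNReal.ofReal α * if k = j then B else 1) (fun k hk r hr => by
        rw [Function.update_of_ne hk]
        rcases eq_or_ne k j with rfl | hkj
        · rw [if_pos rfl, hαB, Function.update_self]
          exact hatom.lintegral_ball_le x hr.le
        · rw [if_neg hkj, mul_one, Function.update_of_ne hkj]
          exact hug k x hx r hr)
    rw [Finset.prod_mul_distrib, Finset.prod_const, Finset.card_erase_of_mem (Finset.mem_univ i),
      Finset.card_univ, Fintype.card_fin, Finset.prod_ite_eq',
      if_pos (Finset.mem_erase.2 ⟨hij.symm, Finset.mem_univ j⟩), ← mul_assoc] at h3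
    exact h3
  have hexp : T (Function.update u j a) x =
      ∑ P ∈ s i, (d i).coeff P *
        T (Function.update (Function.update u j a) i ((d i).atom P)) x := by
    rw [← hT.map_finset_sum hvi i (s i) (d i).coeff (d i).atom fun P => ((d i).isAtom P).integrable]
    congr 1
    refine (Function.update_eq_self_iff.2 ?_).symm
    rw [Function.update_of_ne hij, hu]
    rfl
  rw [hexp, ← hB]
  calc _ ≤ ∑ P ∈ s i, ‖(d i).coeff P‖ₑ *
        (ENNReal.ofReal (2 ^ (m * n + 1) * C₀) * ENNReal.ofReal α ^ (m - 1) * B *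
        annularMajorant ω ((d i).center P) ((d i).side P) x) := by
        refine (enorm_sum_le _ _).trans (Finset.sum_le_sum fun P hPs => ?_)
        rw [enorm_mul]
        exact mul_le_mul_right (hP P hPs) _
    _ = ENNReal.ofReal (2 ^ (m * n + 1) * C₀) * ENNReal.ofReal α ^ (m - 1) *
          (B * (d i).annularSum (s i) ω x) := by
        rw [AtomicData.annularSum, ← mul_assoc, Finset.mul_sum]
        exact Finset.sum_congr rfl fun P _ => mul_left_comm _ _ _
    _ ≤ _ := mul_le_mul_right le_add_self _

/-- Decomposition of a commutator term relative to the means of `b` over the cubes of the atoms. -/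
lemma commTerm_eq {T : (Fin m → Rn n → ℝ) → Rn n → ℝ} (hT : MultilinM T)
    (d : Fin m → AtomicData n) (s : ∀ k, Finset (Fin (d k).size)) {b : Rn n → ℝ}
    (hb : LocallyIntegrable b volume) (j : Fin m) (x : Rn n) :
    commTerm T b (fun k => (d k).sum (s k)) j x =
      ∑ q ∈ s j, (d j).coeff q * ((b x - (d j).mean b q) *
        T (Function.update (fun k => (d k).sum (s k)) j ((d j).atom q)) x) -
      T (Function.update (fun k => (d k).sum (s k)) j fun y =>
        ∑ q ∈ s j, (d j).coeff q * ((b y - (d j).mean b q) * (d j).atom q y)) x := by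
  obtain ⟨u, hu⟩ : ∃ u : Fin m → Rn n → ℝ, u = fun k => (d k).sum (s k) := ⟨_, rfl⟩
  have hui : ∀ k, Integrable (u k) := fun k => by rw [hu]; exact (d k).integrable_sum (s k)
  have huj : u j = fun y => ∑ q ∈ s j, (d j).coeff q * (d j).atom q y := by rw [hu]; rfl
  rw [← hu]
  have hai := fun q => ((d j).isAtom q).integrable
  have hbai : ∀ q, Integrable fun y => b y * (d j).atom q y := fun q =>
    integrable_mul_of_bounded hb ((d j).isAtom q).measurable ((d j).isAtom q).abs_le
      ((d j).isAtom q).hasCompactSupport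
  have hdi : ∀ q, Integrable fun y => (b y - (d j).mean b q) * (d j).atom q y := fun q => by
    simp only [sub_mul]
    exact (hbai q).sub ((hai q).const_mul _)
  have e1 : T u x = ∑ q ∈ s j, (d j).coeff q * T (Function.update u j ((d j).atom q)) x := by
    rw [← hT.map_finset_sum hui j (s j) (d j).coeff (d j).atom hai, ← huj,
      Function.update_eq_self]
  have e2 : T (Function.update u j fun y => b y * u j y) x =
      ∑ q ∈ s j, (d j).coeff q * T (Function.update u j fun y => b y * (d j).atom q y) x := by
    rw [← hT.map_finset_sum hui j (s j) (d j).coeff _ hbai, huj]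
    simp only [Finset.mul_sum, mul_left_comm]
  have e3 : ∀ q, T (Function.update u j fun y => (b y - (d j).mean b q) * (d j).atom q y) x =
      T (Function.update u j fun y => b y * (d j).atom q y) x -
        (d j).mean b q * T (Function.update u j ((d j).atom q)) x := by
    intro q
    rw [← hT.2 u j _ _ hui (hai q), eq_sub_iff_add_eq,
      ← hT.1 u j _ _ hui (hdi q) ((hai q).const_mul _)]
    congr 2
    ext y
    ring
  rw [commTerm, e1, e2, hT.map_finset_sum hui j (s j) (d j).coeff _ hdi, Finset.mul_sum,
    ← Finset.sum_sub_distrib, ← Finset.sum_sub_distrib]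
  refine Finset.sum_congr rfl fun q _ => ?_
  rw [e3]
  ring

lemma ae_enorm_sum_sub_mean_mul_le {C₀ : ℝ} {ω : ℝ → ℝ} (hC₀ : 0 < C₀)
    (hω0 : ∀ t, 0 < t → 0 ≤ ω t) (hωmono : ∀ s t : ℝ, 0 < s → s ≤ t → ω s ≤ ω t) (hn : 1 ≤ n)
    {K : Rn n → (Fin m → Rn n) → ℝ} (hK : IsCZKernelM C₀ ω K)
    {T : (Fin m → Rn n → ℝ) → Rn n → ℝ} (hT : MultilinM T) (hrep : KernelRepM K T)
    (d : Fin m → AtomicData n) (s : ∀ k, Finset (Fin (d k).size)) {i : Fin m} {Ω : Set (Rn n)}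
    {α : ℝ} (hα : 0 < α)
    (hgrowth : ∀ k, ∀ x, x ∉ Ω → ∀ r : ℝ, 0 < r →
      ∫⁻ y in Metric.ball x r, (d k).absSum Finset.univ y ≤ ENNReal.ofReal (α * r ^ n))
    (hfar : ∀ q, q ∈ s i → ∀ x, x ∉ Ω → 2 ^ (n + 1) * (d i).side q ≤ ‖x - (d i).center q‖)
    (b : Rn n → ℝ) (j : Fin m) :
    ∀ᵐ x ∂volume, x ∉ Ω →
      ‖∑ q ∈ s j, (d j).coeff q * ((b x - (d j).mean b q) *
        T (Function.update (fun k => (d k).sum (s k)) j ((d j).atom q)) x)‖ₑ ≤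
        ENNReal.ofReal (2 ^ (m * n + 1) * C₀) * ENNReal.ofReal α ^ (m - 1) *
          ((d j).oscAnnularSum (s j) ω b x + ENNReal.ofReal (2 ^ n / α) *
            ((d j).oscLocalSum (s j) b x * (d i).annularSum (s i) ω x)) := by
  have h := fun q : s j => ae_enorm_update_atom_le hC₀ hω0 hωmono hn hK hT hrep d s hα hgrowth hfar
    j q.1 q.2
  filter_upwards [ae_all_iff.2 h] with x hx hxΩ
  refine (enorm_sum_le _ _).trans ?_
  obtain ⟨κ, hκ⟩ : ∃ κ : ℝ≥0∞, κ =
    ENNReal.ofReal (2 ^ (m * n + 1) * C₀) * ENNReal.ofReal α ^ (m - 1) := ⟨_, rfl⟩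
  rw [← hκ] at hx ⊢
  calc _ ≤ ∑ q ∈ s j, ‖(d j).coeff q‖ₑ * (‖b x - (d j).mean b q‖ₑ *
        (κ * (annularMajorant ω ((d j).center q) ((d j).side q) x +
            ENNReal.ofReal (2 ^ n / α) * localMajorant ((d j).center q) ((d j).side q) x *
              (d i).annularSum (s i) ω x))) := by
        refine Finset.sum_le_sum fun q hq => ?_
        rw [enorm_mul, enorm_mul]
        exact mul_le_mul_right (mul_le_mul_right (hx ⟨q, hq⟩ hxΩ) _) _
    _ = _ := by
        rw [AtomicData.oscAnnularSum, AtomicData.oscLocalSum, Finset.sum_mul, Finset.mul_sum,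
          ← Finset.sum_add_distrib, Finset.mul_sum]
        refine Finset.sum_congr rfl fun q _ => ?_
        ring

end FarEstimate

section MeasureEstimates

variable {n m : ℕ}

lemma WeakTypeOne.volume_le (hm : 1 ≤ m) {T : (Fin m → Rn n → ℝ) → Rn n → ℝ} {C₂ : ℝ}
    (hC₂ : 0 < C₂) (hW : WeakTypeOne T C₂) {f : Fin m → Rn n → ℝ} (hf : ∀ j, Integrable (f j))
    {P : ℝ} (hP : ∏ j, l1norm (f j) ≤ P) {α lam D : ℝ} (hα : 0 < α) (hlam : 0 < lam) (hD : 0 < D)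
    (h : C₂ * α ^ m ≤ lam) :
    volume {x | lam / D < |T f x|} ≤
      ENNReal.ofReal ((P * D) ^ ((1 : ℝ) / (m : ℝ))) / ENNReal.ofReal α := by
  refine (hW f hf (lam / D) (by positivity)).trans ?_
  have hP0 : 0 ≤ ∏ j, l1norm (f j) := Finset.prod_nonneg fun j _ => l1norm_nonneg _
  have hP0' : 0 ≤ P := hP0.trans hP
  rw [← ENNReal.ofReal_div_of_pos hα]
  refine ENNReal.ofReal_le_ofReal ?_
  have h1 : C₂ * (∏ j, l1norm (f j)) / (lam / D) ≤ P * D / α ^ m := by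
    rw [div_div_eq_mul_div, div_le_div_iff₀ hlam (by positivity)]
    calc C₂ * (∏ j, l1norm (f j)) * D * α ^ m
        = (∏ j, l1norm (f j)) * D * (C₂ * α ^ m) := by ring
      _ ≤ P * D * lam := by gcongr
  have h0 : 0 ≤ C₂ * (∏ j, l1norm (f j)) / (lam / D) :=
    div_nonneg (mul_nonneg hC₂.le hP0) (by positivity)
  refine (Real.rpow_le_rpow h0 h1 (by positivity)).trans_eq ?_
  rw [Real.div_rpow (by positivity) (by positivity), one_div,
    Real.pow_rpow_inv_natCast hα.le (by omega)]

lemma prod_l1norm_update_le {f : Fin m → Rn n → ℝ} (hf : ∀ k, l1norm (f k) ≤ 1) (j : Fin m)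
    {g : Rn n → ℝ} {M : ℝ} (hg : l1norm g ≤ M) :
    ∏ k, l1norm (Function.update f j g k) ≤ M := by
  rw [← Finset.mul_prod_erase _ _ (Finset.mem_univ j), Function.update_self]
  refine (mul_le_of_le_one_right (l1norm_nonneg g) (Finset.prod_le_one
    (fun _ _ => l1norm_nonneg _) fun k hk => ?_)).trans hg
  rw [Function.update_of_ne (Finset.ne_of_mem_erase hk)]
  exact hf k

/-- The threshold factor in the estimate of one commutator term. -/
def thresholdFactor (n m : ℕ) (D : ℝ) : ℝ := 1 / (2 * D * 2 ^ (m * n + 1) * (1 + 2 ^ n))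

/-- The constant in the estimate of one commutator term. -/
def commConst (n m : ℕ) (ω : ℝ → ℝ) (M D : ℝ) : ℝ≥0∞ :=
  ENNReal.ofReal ((M * (2 * D)) ^ ((1 : ℝ) / (m : ℝ))) +
    (ENNReal.ofReal (8 ^ n * (n + 4) * M) * dyadicDiniSum ω +
      ENNReal.ofReal ((2 ^ (n + 2)) ^ n * (M * (1 + (n + 2 : ℕ) * 2 ^ n))) +
      ENNReal.ofReal (4 ^ n) * dyadicDiniSum ω) / ENNReal.ofReal (thresholdFactor n m D)

lemma thresholdFactor_pos {D : ℝ} (hD : 0 < D) : 0 < thresholdFactor n m D := by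
  unfold thresholdFactor; positivity

lemma thresholdFactor_le_one (n m : ℕ) {D : ℝ} (hD : 1 ≤ D) : thresholdFactor n m D ≤ 1 := by
  rw [thresholdFactor, div_le_one (by positivity)]
  have e1 : (1 : ℝ) ≤ 2 ^ (m * n + 1) := one_le_pow₀ (by norm_num)
  have e2 : (1 : ℝ) ≤ 1 + 2 ^ n := le_add_of_nonneg_right (by positivity)
  have e3 : (1 : ℝ) ≤ 2 * D := by linarith
  exact one_le_mul_of_one_le_of_one_le (one_le_mul_of_one_le_of_one_le e3 e1) e2

lemma mul_threshold_le (hm : 1 ≤ m) {C₀ α lam D : ℝ} (hC₀ : 0 < C₀) (hα : 0 < α) (hlam : 0 < lam)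
    (hD : 1 ≤ D) (h : C₀ * α ^ m ≤ lam) :
    2 ^ (m * n + 1) * C₀ * α ^ (m - 1) * (thresholdFactor n m D * α +
      2 ^ n / α * ((thresholdFactor n m D * α) * (thresholdFactor n m D * α))) ≤
      lam / (2 * D) := by
  have hD0 : 0 < D := one_pos.trans_le hD
  have hε0 := thresholdFactor_pos (n := n) (m := m) hD0
  have hε1 := thresholdFactor_le_one n m hD
  have heq : 2 ^ (m * n + 1) * lam * (thresholdFactor n m D * (1 + 2 ^ n * 1)) =
      lam / (2 * D) := by
    rw [thresholdFactor]
    have : (0 : ℝ) < 1 + 2 ^ n := by positivity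
    field_simp
  rw [← heq]
  generalize thresholdFactor n m D = ε at *
  obtain ⟨p, rfl⟩ : ∃ p, m = p + 1 := ⟨m - 1, by omega⟩
  rw [Nat.add_sub_cancel]
  calc 2 ^ ((p + 1) * n + 1) * C₀ * α ^ p * (ε * α + 2 ^ n / α * ((ε * α) * (ε * α)))
      = 2 ^ ((p + 1) * n + 1) * (C₀ * α ^ (p + 1)) * (ε * (1 + 2 ^ n * ε)) := by
        rw [pow_succ α]
        field_simp
    _ ≤ 2 ^ ((p + 1) * n + 1) * lam * (ε * (1 + 2 ^ n * 1)) := by gcongr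

lemma commConst_ne_top {ω : ℝ → ℝ} (hω : dyadicDiniSum ω ≠ ⊤) (M : ℝ) {D : ℝ} (hD : 0 < D) :
    commConst n m ω M D ≠ ⊤ := by
  unfold commConst
  refine ENNReal.add_ne_top.2 ⟨ENNReal.ofReal_ne_top, ENNReal.div_ne_top ?_ ?_⟩
  · exact ENNReal.add_ne_top.2 ⟨ENNReal.add_ne_top.2
      ⟨ENNReal.mul_ne_top ENNReal.ofReal_ne_top hω, ENNReal.ofReal_ne_top⟩,
      ENNReal.mul_ne_top ENNReal.ofReal_ne_top hω⟩
  · exact (ENNReal.ofReal_pos.2 (thresholdFactor_pos hD)).ne'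

lemma volume_le_lintegral_div {X : Rn n → ℝ≥0∞} (hX : AEMeasurable X) {κ : ℝ≥0∞}
    (hκ : ∫⁻ x, X x ≤ κ) {ε α : ℝ} (hε : 0 < ε) (hα : 0 < α) :
    volume {x | ENNReal.ofReal (ε * α) ≤ X x} ≤
      κ / ENNReal.ofReal ε / ENNReal.ofReal α := by
  have h0 : ENNReal.ofReal (ε * α) ≠ 0 := (ENNReal.ofReal_pos.2 (by positivity)).ne'
  refine (meas_ge_le_lintegral_div hX h0 ENNReal.ofReal_ne_top).trans ?_
  rw [ENNReal.ofReal_mul hε.le, div_eq_mul_inv, ENNReal.mul_inv (Or.inr ENNReal.ofReal_ne_top)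
    (Or.inl ENNReal.ofReal_ne_top), ← mul_assoc, ← div_eq_mul_inv, ← div_eq_mul_inv]
  gcongr

lemma volume_lt_abs_commTerm_le {C₀ C₂ : ℝ} {ω : ℝ → ℝ} (hC₀ : 0 < C₀) (hC₂ : 0 < C₂)
    (hω0 : ∀ t, 0 < t → 0 ≤ ω t) (hωmono : ∀ s t : ℝ, 0 < s → s ≤ t → ω s ≤ ω t) (hn : 1 ≤ n)
    (hm : 1 ≤ m) {K : Rn n → (Fin m → Rn n) → ℝ} (hK : IsCZKernelM C₀ ω K)
    {T : (Fin m → Rn n → ℝ) → Rn n → ℝ} (hT : MultilinM T) (hrep : KernelRepM K T)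
    (hW : WeakTypeOne T C₂) (d : Fin m → AtomicData n) (s : ∀ k, Finset (Fin (d k).size))
    {i : Fin m} {Ω : Set (Rn n)} {α : ℝ} (hα : 0 < α)
    (hgrowth : ∀ k, ∀ x, x ∉ Ω → ∀ r : ℝ, 0 < r →
      ∫⁻ y in Metric.ball x r, (d k).absSum Finset.univ y ≤ ENNReal.ofReal (α * r ^ n))
    (hfar : ∀ q, q ∈ s i → ∀ x, x ∉ Ω → 2 ^ (n + 1) * (d i).side q ≤ ‖x - (d i).center q‖)
    {b : Rn n → ℝ} (hb : LocallyIntegrable b volume) {M : ℝ} (hM : OscBound b M) (hM0 : 0 ≤ M)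
    {lam D : ℝ} (hlam : 0 < lam) (hD : 1 ≤ D) (h₀ : C₀ * α ^ m ≤ lam) (h₂ : C₂ * α ^ m ≤ lam)
    (j : Fin m) :
    volume {x | lam / D < |commTerm T b (fun k => (d k).sum (s k)) j x|} ≤
      volume Ω + commConst n m ω M D / ENNReal.ofReal α := by
  have hD0 : 0 < D := one_pos.trans_le hD
  obtain ⟨ε, hε⟩ : ∃ ε, ε = thresholdFactor n m D := ⟨_, rfl⟩
  have hε0 : 0 < ε := hε ▸ thresholdFactor_pos hD0
  have hae := ae_enorm_sum_sub_mean_mul_le hC₀ hω0 hωmono hn hK hT hrep d s hα hgrowth hfar b j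
  have heq := commTerm_eq hT d s hb j
  have hui : ∀ k, Integrable ((d k).sum (s k)) := fun k => (d k).integrable_sum (s k)
  have hu1 : ∀ k, l1norm ((d k).sum (s k)) ≤ 1 := fun k => (d k).l1norm_sum_le (s k)
  have hslot : Integrable fun y =>
      ∑ q ∈ s j, (d j).coeff q * ((b y - (d j).mean b q) * (d j).atom q y) := by
    refine integrable_finsetSum _ fun q _ => Integrable.const_mul ?_ _
    simp only [sub_mul]
    exact (integrable_mul_of_bounded hb ((d j).isAtom q).measurable ((d j).isAtom q).abs_le
      ((d j).isAtom q).hasCompactSupport).sub (((d j).isAtom q).integrable.const_mul _)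
  have hB := hW.volume_le hm hC₂ (f := Function.update (fun k => (d k).sum (s k)) j fun y =>
        ∑ q ∈ s j, (d j).coeff q * ((b y - (d j).mean b q) * (d j).atom q y))
    (forall_update (Integrable ·) hui hslot j)
    (prod_l1norm_update_le hu1 j ((d j).l1norm_sum_sub_mean_le (s j) hb hM hM0)) hα hlam
    (D := 2 * D) (by positivity) h₂
  have hX := volume_le_lintegral_div (X := (d j).oscAnnularSum (s j) ω b)
    (Finset.aemeasurable_fun_sum _ fun q _ => (((d j).aemeasurable_enorm_sub_mean hb q).mul
      (measurable_annularMajorant _ _ _).aemeasurable).const_mul _)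
    ((d j).lintegral_oscAnnularSum_le (s j) hb hM hM0 hω0) hε0 hα
  have hF := volume_le_lintegral_div (X := (d j).oscLocalSum (s j) b)
    (Finset.aemeasurable_fun_sum _ fun q _ => (((d j).aemeasurable_enorm_sub_mean hb q).mul
      (measurable_localMajorant _ _).aemeasurable).const_mul _)
    ((d j).lintegral_oscLocalSum_le (s j) hb hM hM0) hε0 hα
  have hG := volume_le_lintegral_div (X := (d i).annularSum (s i) ω)
    (Finset.aemeasurable_fun_sum _ fun q _ =>
      (measurable_annularMajorant _ _ _).aemeasurable.const_mul _)
    ((d i).lintegral_annularSum_le (s i) hω0) hε0 hα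
  rw [ae_iff] at hae
  obtain ⟨X, hXd⟩ : ∃ X, X = (d j).oscAnnularSum (s j) ω b := ⟨_, rfl⟩
  obtain ⟨F, hFd⟩ : ∃ F, F = (d j).oscLocalSum (s j) b := ⟨_, rfl⟩
  obtain ⟨G, hGd⟩ : ∃ G, G = (d i).annularSum (s i) ω := ⟨_, rfl⟩
  obtain ⟨A', hA'⟩ : ∃ A' : Rn n → ℝ, A' = fun x =>
      ∑ q ∈ s j, (d j).coeff q * ((b x - (d j).mean b q) *
        T (Function.update (fun k => (d k).sum (s k)) j ((d j).atom q)) x) := ⟨_, rfl⟩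
  obtain ⟨B', hB'⟩ : ∃ B' : Rn n → ℝ, B' =
      T (Function.update (fun k => (d k).sum (s k)) j fun y =>
        ∑ q ∈ s j, (d j).coeff q * ((b y - (d j).mean b q) * (d j).atom q y)) := ⟨_, rfl⟩
  have heq' : ∀ x, commTerm T b (fun k => (d k).sum (s k)) j x = A' x - B' x := fun x => by
    rw [heq, hA', hB']
  rw [← hXd] at hX
  rw [← hFd] at hF
  rw [← hGd] at hG
  rw [← hB'] at hB
  have hae' : volume {x | ¬(x ∉ Ω → ‖A' x‖ₑ ≤
      ENNReal.ofReal (2 ^ (m * n + 1) * C₀) * ENNReal.ofReal α ^ (m - 1) *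
          (X x + ENNReal.ofReal (2 ^ n / α) * (F x * G x)))} = 0 := by
    rw [hXd, hFd, hGd, hA']; exact hae
  have hsub : {x | lam / D < |commTerm T b (fun k => (d k).sum (s k)) j x|} ⊆
      Ω ∪ ({x | ¬(x ∉ Ω → ‖A' x‖ₑ ≤
        ENNReal.ofReal (2 ^ (m * n + 1) * C₀) * ENNReal.ofReal α ^ (m - 1) *
          (X x + ENNReal.ofReal (2 ^ n / α) * (F x * G x)))} ∪
      ({x | lam / (2 * D) < |B' x|} ∪ ({x | ENNReal.ofReal (ε * α) ≤ X x} ∪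
        {x | ENNReal.ofReal (ε * α) ≤ F x} ∪ {x | ENNReal.ofReal (ε * α) ≤ G x}))) := by
    intro x hx
    by_contra hcon
    simp only [mem_union, mem_ofPred_eq, not_or, not_not, not_le, not_lt] at hcon hx
    obtain ⟨hxΩ, hxA, hxB, ⟨hxX, hxF⟩, hxG⟩ := hcon
    have h1 := hxA hxΩ
    have h2 : ‖A' x‖ₑ ≤ ENNReal.ofReal (2 ^ (m * n + 1) * C₀ * α ^ (m - 1) *
        (ε * α + 2 ^ n / α * ((ε * α) * (ε * α)))) := by
      refine h1.trans ?_
      rw [ENNReal.ofReal_mul (p := 2 ^ (m * n + 1) * C₀ * α ^ (m - 1)) (by positivity),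
        ENNReal.ofReal_mul (p := 2 ^ (m * n + 1) * C₀) (by positivity),
        ENNReal.ofReal_add (by positivity) (by positivity), ENNReal.ofReal_pow hα.le,
        ENNReal.ofReal_mul (p := 2 ^ n / α) (by positivity),
        ENNReal.ofReal_mul (p := ε * α) (q := ε * α) (by positivity)]
      gcongr
    rw [Real.enorm_eq_ofReal_abs, ENNReal.ofReal_le_ofReal_iff (by positivity)] at h2
    have h3 := mul_threshold_le hm hC₀ hα hlam hD h₀ (n := n)
    rw [← hε] at h3
    have h4 : |A' x - B' x| ≤ |A' x| + |B' x| := abs_sub _ _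
    rw [heq'] at hx
    have h5 : lam / D = lam / (2 * D) + lam / (2 * D) := by field_simp; norm_num
    linarith
  calc _ ≤ volume Ω + (0 + (volume {x | lam / (2 * D) < |B' x|} +
      (volume {x | ENNReal.ofReal (ε * α) ≤ X x} +
        volume {x | ENNReal.ofReal (ε * α) ≤ F x} +
        volume {x | ENNReal.ofReal (ε * α) ≤ G x}))) := by
        refine (measure_mono hsub).trans ?_
        refine (measure_union_le _ _).trans (add_le_add_right ?_ _)
        refine (measure_union_le _ _).trans (add_le_add hae'.le ?_)
        refine (measure_union_le _ _).trans (add_le_add_right ?_ _)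
        refine (measure_union_le _ _).trans (add_le_add_left ?_ _)
        exact measure_union_le _ _
    _ ≤ _ := by
        rw [zero_add]
        refine add_le_add_right ((add_le_add hB (add_le_add (add_le_add hX hF) hG)).trans_eq ?_) _
        rw [commConst, ← hε]
        simp only [ENNReal.add_div]

end MeasureEstimates

section Assembly

variable {n m : ℕ}

/-- The sum of the commutator terms. -/
def commSum (T : (Fin m → Rn n → ℝ) → Rn n → ℝ) (b : Fin m → Rn n → ℝ) (f : Fin m → Rn n → ℝ)
    (x : Rn n) : ℝ :=
  ∑ j, commTerm T (b j) f j x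

/-- The weak type `L² × ⋯ × L² → L^{2/m,∞}` bound with constant `C₁` on bounded compactly
supported functions. -/
def WeakTypeTwo (S : (Fin m → Rn n → ℝ) → Rn n → ℝ) (C₁ : ℝ) : Prop :=
  ∀ f : Fin m → Rn n → ℝ, (∀ j, Measurable (f j)) → (∀ j, ∃ A : ℝ, ∀ x, |f j x| ≤ A) →
    (∀ j, HasCompactSupport (f j)) → ∀ lam : ℝ, 0 < lam →
      volume {x | lam < |S f x|} ≤
        ENNReal.ofReal ((C₁ * (∏ j, l2norm (f j)) / lam) ^ ((2 : ℝ) / (m : ℝ)))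

lemma l2norm_le_sqrt {f : Rn n → ℝ} (hf : Integrable f) {A : ℝ} (hA : ∀ x, |f x| ≤ A)
    (h1 : l1norm f ≤ 1) : l2norm f ≤ A ^ ((1 : ℝ) / 2) := by
  have hA0 : 0 ≤ A := (abs_nonneg _).trans (hA 0)
  refine Real.rpow_le_rpow (integral_nonneg fun x => sq_nonneg _) ?_ (by norm_num)
  calc ∫ x, (f x) ^ 2 ≤ ∫ x, A * |f x| := by
        refine integral_mono_of_nonneg (.of_forall fun x => sq_nonneg _)
          (hf.abs.const_mul A) (.of_forall fun x => ?_)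
        simp only
        rw [← sq_abs, sq]
        exact mul_le_mul_of_nonneg_right (hA x) (abs_nonneg _)
    _ = A * l1norm f := integral_const_mul _ _
    _ ≤ A := mul_le_of_le_one_right hA0 h1

lemma l2norm_nonneg (f : Rn n → ℝ) : 0 ≤ l2norm f :=
  Real.rpow_nonneg (integral_nonneg fun _ => sq_nonneg _) _

lemma WeakTypeTwo.volume_le (hm : 1 ≤ m) {S : (Fin m → Rn n → ℝ) → Rn n → ℝ} {C₁ : ℝ}
    (hC₁ : 0 < C₁) (hS : WeakTypeTwo S C₁) {d : Fin m → AtomicData n}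
    {s : ∀ k, Finset (Fin (d k).size)} {Λ α lam D : ℝ} (hΛ : 0 < Λ) (hα : 0 < α) (hlam : 0 < lam)
    (hD : 0 < D) (h : C₁ * α ^ m ≤ lam)
    (hs : ∀ k x, (d k).absSum (s k) x ≤ ENNReal.ofReal (Λ * α)) :
    volume {x | lam / D < |S (fun k => (d k).sum (s k)) x|} ≤
      ENNReal.ofReal (D ^ ((2 : ℝ) / (m : ℝ)) * Λ) / ENNReal.ofReal α := by
  have hA : ∀ k x, |(d k).sum (s k) x| ≤ Λ * α := by
    intro k x
    have := ((d k).enorm_sum_le (s k) x).trans (hs k x)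
    rwa [Real.enorm_eq_ofReal_abs, ENNReal.ofReal_le_ofReal_iff (by positivity)] at this
  refine (hS _ (fun k => (d k).measurable_sum (s k)) (fun k => ⟨_, hA k⟩)
    (fun k => (d k).hasCompactSupport_sum (s k)) (lam / D) (by positivity)).trans ?_
  rw [← ENNReal.ofReal_div_of_pos hα]
  refine ENNReal.ofReal_le_ofReal ?_
  obtain ⟨y, hy⟩ : ∃ y, y = (Λ * α) ^ ((1 : ℝ) / 2) := ⟨_, rfl⟩
  have hy0 : 0 < y := by rw [hy]; positivity
  have hy2 : y ^ 2 = Λ * α := by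
    rw [hy, ← Real.rpow_natCast, ← Real.rpow_mul (by positivity)]
    norm_num
  have hP0 : 0 ≤ ∏ k, l2norm ((d k).sum (s k)) := Finset.prod_nonneg fun k _ => l2norm_nonneg _
  have hP : ∏ k, l2norm ((d k).sum (s k)) ≤ y ^ m := by
    refine (Finset.prod_le_prod (fun k _ => l2norm_nonneg _) fun k _ =>
      (l2norm_le_sqrt ((d k).integrable_sum (s k)) (hA k) ((d k).l1norm_sum_le (s k))).trans_eq
        hy.symm).trans_eq ?_
    simp
  have h1 : C₁ * (∏ k, l2norm ((d k).sum (s k))) / (lam / D) ≤ D * (y / α) ^ m := by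
    rw [div_div_eq_mul_div, div_pow, mul_div_assoc', div_le_div_iff₀ hlam (by positivity)]
    calc C₁ * (∏ k, l2norm ((d k).sum (s k))) * D * α ^ m
        = D * (∏ k, l2norm ((d k).sum (s k))) * (C₁ * α ^ m) := by ring
      _ ≤ D * y ^ m * lam := by gcongr
  refine (Real.rpow_le_rpow (div_nonneg (mul_nonneg hC₁.le hP0) (by positivity)) h1
    (by positivity)).trans_eq ?_
  have hm0 : (m : ℝ) ≠ 0 := by positivity
  rw [Real.mul_rpow hD.le (by positivity), ← Real.rpow_natCast (y / α) m,
    ← Real.rpow_mul (by positivity), mul_div_cancel₀ _ hm0, Real.rpow_two, div_pow, hy2]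
  field_simp

lemma comm_congr_ae (hm : 1 ≤ m) {T : (Fin m → Rn n → ℝ) → Rn n → ℝ} {C₂ : ℝ}
    (hT : MultilinM T) (hW : WeakTypeOne T C₂) {b f g : Fin m → Rn n → ℝ}
    (hf : ∀ k, Integrable (f k)) (hbf : ∀ j, Integrable fun y => b j y * f j y)
    (hfg : ∀ k, f k =ᵐ[volume] g k) : commSum T b f =ᵐ[volume] commSum T b g := by
  have h := fun j => commTerm_congr_ae hm hT hW hf j (hbf j) hfg
  filter_upwards [eventually_countable_forall.2 h] with x hx
  exact Finset.sum_congr rfl fun j _ => hx j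

lemma comm_update_sum_univ {T : (Fin m → Rn n → ℝ) → Rn n → ℝ} (hT : MultilinM T)
    {b : Fin m → Rn n → ℝ} (hb : ∀ j, LocallyIntegrable (b j) volume) (d : Fin m → AtomicData n)
    (s : ∀ k, Finset (Fin (d k).size)) (i : Fin m) (x : Rn n) :
    commSum T b (fun k => (d k).sum (Function.update s i Finset.univ k)) x =
      commSum T b (fun k => (d k).sum (s k)) x +
        commSum T b (fun k => (d k).sum (Function.update s i (Finset.univ \ s i) k)) x := by
  have hupd : ∀ t : Finset (Fin (d i).size), (fun k => (d k).sum (Function.update s i t k)) =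
      Function.update (fun k => (d k).sum (s k)) i ((d i).sum t) := by
    intro t
    ext1 k
    rcases eq_or_ne k i with rfl | h
    · rw [Function.update_self, Function.update_self]
    · rw [Function.update_of_ne h, Function.update_of_ne h]
  have hself : (fun k => (d k).sum (s k)) =
      Function.update (fun k => (d k).sum (s k)) i ((d i).sum (s i)) :=
    (Function.update_eq_self i _).symm
  have huniv : (d i).sum Finset.univ =
      fun y => (d i).sum (s i) y + (d i).sum (Finset.univ \ s i) y := by
    ext y; exact ((d i).sum_add_sum_sdiff (s i) y).symm
  rw [hupd, hupd, huniv]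
  conv_rhs => rw [hself]
  rw [Function.update_idem]
  simp only [commSum]
  rw [← Finset.sum_add_distrib]
  exact Finset.sum_congr rfl fun j _ => commTerm_update_add hT
    (fun k => (d k).integrable_sum (s k)) (fun k => (d k).integrable_mul_sum (s k) (hb j)) i j
    ((d i).integrable_sum _) ((d i).integrable_sum _) ((d i).integrable_mul_sum _ (hb j))
    ((d i).integrable_mul_sum _ (hb j)) x

lemma volume_lt_abs_sum_le {ι : Type*} [Fintype ι] [Nonempty ι] (F : ι → Rn n → ℝ) {t : ℝ} :
    volume {x | t < |∑ j, F j x|} ≤ ∑ j, volume {x | t / Fintype.card ι < |F j x|} := by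
  refine (measure_mono fun x hx => ?_).trans (measure_iUnion_fintype_le _ _)
  by_contra hcon
  simp only [mem_iUnion, mem_ofPred_eq, not_exists, not_lt] at hcon hx
  have h := (Finset.abs_sum_le_sum_abs (fun j => F j x) Finset.univ).trans
    (Finset.sum_le_sum fun j _ => hcon j)
  rw [Finset.sum_const, Finset.card_univ, nsmul_eq_mul, mul_div_cancel₀ _
    (by exact_mod_cast Fintype.card_ne_zero)] at h
  exact absurd hx (not_lt.2 h)

/-- Replacing the good parts by the full atomic sums one entry at a time. -/
lemma volume_lt_abs_comm_piecewise_le {T : (Fin m → Rn n → ℝ) → Rn n → ℝ} (hT : MultilinM T)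
    {b : Fin m → Rn n → ℝ} (hb : ∀ j, LocallyIntegrable (b j) volume) (d : Fin m → AtomicData n)
    (good : ∀ k, Finset (Fin (d k).size)) {t : ℝ} {κ₀ κ : ℝ≥0∞}
    (h₀ : volume {x | t < |commSum T b (fun k => (d k).sum (good k)) x|} ≤ κ₀)
    (h : ∀ (s : ∀ k, Finset (Fin (d k).size)) (i : Fin m), s i = Finset.univ \ good i →
      volume {x | t < |commSum T b (fun k => (d k).sum (s k)) x|} ≤ κ) (S : Finset (Fin m)) :
    volume {x | (S.card + 1) * t < |commSum T b (fun k => (d k).sum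
      (S.piecewise (fun _ => Finset.univ) good k)) x|} ≤ κ₀ + S.card * κ := by
  induction S using Finset.induction_on with
  | empty => simpa using h₀
  | insert i S hi ih =>
    have hgi : S.piecewise (fun _ => Finset.univ) good i = good i :=
      Finset.piecewise_eq_of_notMem _ _ _ hi
    have hadd := comm_update_sum_univ hT hb d (S.piecewise (fun _ => Finset.univ) good) i
    have hpiece := h (Function.update (S.piecewise (fun _ => Finset.univ) good) i
      (Finset.univ \ good i)) i (Function.update_self _ _ _)
    rw [hgi] at hadd
    have hins : (insert i S).piecewise (fun _ => Finset.univ) good =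
        Function.update (S.piecewise (fun _ => Finset.univ) good) i Finset.univ :=
      Finset.piecewise_insert _ _ _ _
    rw [Finset.card_insert_of_notMem hi, hins]
    push_cast
    rw [add_mul, one_mul, add_mul (S.card : ℝ≥0∞), one_mul, ← add_assoc]
    refine le_trans (measure_mono fun x hx => ?_)
      ((measure_union_le _ _).trans (add_le_add ih hpiece))
    by_contra hcon
    simp only [mem_union, mem_ofPred_eq, not_or, not_lt] at hcon hx
    rw [hadd] at hx
    have := abs_add_le (commSum T b (fun k => (d k).sum
      (S.piecewise (fun _ => Finset.univ) good k)) x) (commSum T b (fun k => (d k).sum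
      (Function.update (S.piecewise (fun _ => Finset.univ) good) i (Finset.univ \ good i) k)) x)
    linarith [hcon.1, hcon.2]

/-- The total constant. -/
def totalConst (n m : ℕ) (ω : ℝ → ℝ) (M : Fin m → ℝ) : ℝ≥0∞ :=
  ENNReal.ofReal ((m + 1 : ℝ) ^ ((2 : ℝ) / (m : ℝ)) * (2 ^ (n + 2)) ^ n) +
    m * ∑ j, (m * ENNReal.ofReal (10 ^ n) + commConst n m ω (M j) ((m + 1) * m))

lemma totalConst_ne_top (hm : 1 ≤ m) {ω : ℝ → ℝ} (hω : dyadicDiniSum ω ≠ ⊤) (M : Fin m → ℝ) :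
    totalConst n m ω M ≠ ⊤ := by
  have hm0 : (0 : ℝ) < m := by exact_mod_cast hm
  refine ENNReal.add_ne_top.2 ⟨ENNReal.ofReal_ne_top, ENNReal.mul_ne_top (by simp) ?_⟩
  refine ENNReal.sum_ne_top.2 fun j _ => ENNReal.add_ne_top.2
    ⟨ENNReal.mul_ne_top (by simp) ENNReal.ofReal_ne_top, commConst_ne_top hω _ (by positivity)⟩

lemma volume_lt_abs_comm_le {C₀ C₁ C₂ : ℝ} {ω : ℝ → ℝ} (hC₀ : 0 < C₀) (hC₁ : 0 < C₁)
    (hC₂ : 0 < C₂) (hω0 : ∀ t, 0 < t → 0 ≤ ω t)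
    (hωmono : ∀ s t : ℝ, 0 < s → s ≤ t → ω s ≤ ω t) (hn : 1 ≤ n)
    (hm : 1 ≤ m) {K : Rn n → (Fin m → Rn n) → ℝ} (hK : IsCZKernelM C₀ ω K)
    {T : (Fin m → Rn n → ℝ) → Rn n → ℝ} (hT : MultilinM T) (hrep : KernelRepM K T)
    {b : Fin m → Rn n → ℝ} (hW₁ : WeakTypeTwo (commSum T b) C₁) (hW₂ : WeakTypeOne T C₂)
    (hb : ∀ j, LocallyIntegrable (b j) volume) {M : Fin m → ℝ} (hM : ∀ j, OscBound (b j) (M j))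
    (hM0 : ∀ j, 0 ≤ M j) {α lam : ℝ} (hα : 0 < α) (hlam : 0 < lam) (h₀ : C₀ * α ^ m ≤ lam)
    (h₁ : C₁ * α ^ m ≤ lam) (h₂ : C₂ * α ^ m ≤ lam) (d : Fin m → AtomicData n)
    (good : ∀ k, Finset (Fin (d k).size)) (Ω : Fin m → Set (Rn n))
    (hΩ : ∀ k, volume (Ω k) ≤ ENNReal.ofReal (10 ^ n / α))
    (hgrowth : ∀ k, ∀ x, x ∉ Ω k → ∀ r : ℝ, 0 < r →
      ∫⁻ y in Metric.ball x r, (d k).absSum Finset.univ y ≤ ENNReal.ofReal (α * r ^ n))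
    (hfar : ∀ k, ∀ q, q ∉ good k → ∀ x, x ∉ Ω k →
      2 ^ (n + 1) * (d k).side q ≤ ‖x - (d k).center q‖)
    (hgood : ∀ k x, (d k).absSum (good k) x ≤ ENNReal.ofReal ((2 ^ (n + 2)) ^ n * α)) :
    volume {x | lam < |commSum T b (fun k => (d k).sum Finset.univ) x|} ≤
      totalConst n m ω M / ENNReal.ofReal α := by
  have hm1 : (1 : ℝ) ≤ m := by exact_mod_cast hm
  have hΩU : volume (⋃ k, Ω k) ≤ m * ENNReal.ofReal (10 ^ n) / ENNReal.ofReal α := by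
    refine (measure_iUnion_fintype_le _ _).trans ((Finset.sum_le_sum fun k _ => hΩ k).trans_eq ?_)
    rw [Finset.sum_const, Finset.card_univ, Fintype.card_fin, nsmul_eq_mul,
      ENNReal.ofReal_div_of_pos hα, mul_div_assoc]
  have hbase := hW₁.volume_le hm hC₁ (d := d) (s := good) (Λ := (2 ^ (n + 2)) ^ n)
    (D := m + 1) (by positivity) hα hlam (by positivity) h₁ hgood
  have hpiece : ∀ (s : ∀ k, Finset (Fin (d k).size)) (i : Fin m), s i = Finset.univ \ good i →
      volume {x | lam / (m + 1) < |commSum T b (fun k => (d k).sum (s k)) x|} ≤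
        (∑ j, (m * ENNReal.ofReal (10 ^ n) + commConst n m ω (M j) ((m + 1) * m))) /
          ENNReal.ofReal α := by
    intro s i hsi
    have : Nonempty (Fin m) := ⟨i⟩
    refine (volume_lt_abs_sum_le _).trans ?_
    rw [Fintype.card_fin, div_eq_mul_inv (∑ j, _), Finset.sum_mul]
    refine Finset.sum_le_sum fun j _ => ?_
    rw [div_div, ← div_eq_mul_inv, ENNReal.add_div]
    refine (volume_lt_abs_commTerm_le hC₀ hC₂ hω0 hωmono hn hm hK hT hrep hW₂ d s (i := i)
      (Ω := ⋃ k, Ω k) hα (fun k x hx => hgrowth k x fun h => hx (mem_iUnion.2 ⟨k, h⟩)) ?_ (hb j)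
      (hM j) (hM0 j) hlam (by nlinarith) h₀ h₂ j).trans (add_le_add_left hΩU _)
    intro q hq x hx
    rw [hsi, Finset.mem_sdiff] at hq
    exact hfar i q hq.2 x fun h => hx (mem_iUnion.2 ⟨i, h⟩)
  have hall := volume_lt_abs_comm_piecewise_le hT hb d good hbase hpiece Finset.univ
  rw [Finset.piecewise_univ, Finset.card_univ, Fintype.card_fin,
    mul_div_cancel₀ _ (by positivity)] at hall
  refine hall.trans_eq ?_
  rw [totalConst, ENNReal.add_div, mul_div_assoc]

end Assembly

/-- The commutator in the `j`-th entries
`T_{b⃗}(f⃗) = ∑_j [b_j·T(f⃗) − T(f₁,…,b_j f_j,…,f_m)]` of an `m`-linear Calderón–Zygmund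
operator of `ω` type, with `ω` non-decreasing satisfying the log-Dini(1) condition and
`b_j ∈ BMO`, maps `m`-tuples of finite atomic sums into weak `L^{1/m}`, with constant
`C·(C₀+C₁+C₂)^{1/m}` depending only on `n`, `m`, `ω` and the BMO bounds. -/
theorem stmt2 (n m : ℕ) (hn : 1 ≤ n) (hm : 1 ≤ m) (ω : ℝ → ℝ)
    (hω0 : ∀ t, 0 < t → 0 ≤ ω t)
    (hωmono : ∀ s t : ℝ, 0 < s → s ≤ t → ω s ≤ ω t)
    (hω_logDini : IntegrableOn (fun t => ω t * (1 + Real.log (1 / t)) / t) (Ioo (0:ℝ) 1))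
    (M : Fin m → ℝ) (hM0 : ∀ j, 0 ≤ M j) :
    ∃ C : ℝ, 0 < C ∧
      ∀ (C₀ C₁ C₂ : ℝ) (K : Rn n → (Fin m → Rn n) → ℝ)
        (T : (Fin m → Rn n → ℝ) → Rn n → ℝ) (b : Fin m → Rn n → ℝ),
        0 < C₀ → 0 < C₁ → 0 < C₂ →
        IsCZKernelM C₀ ω K →
        (∀ f : Fin m → Rn n → ℝ, (∀ j, Integrable (f j)) → Measurable (T f)) →
        MultilinM T →
        KernelRepM K T →
        (∀ j, LocallyIntegrable (b j) volume) → (∀ j, OscBound (b j) (M j)) →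
        -- weak `L²×⋯×L² → L^{2/m,∞}` bound for the commutator `T_{b⃗}`
        (∀ f : Fin m → Rn n → ℝ, (∀ j, Measurable (f j)) →
          (∀ j, ∃ A : ℝ, ∀ x, |f j x| ≤ A) → (∀ j, HasCompactSupport (f j)) →
          ∀ lam : ℝ, 0 < lam →
            volume {x | lam <
                |∑ j, (b j x * T f x -
                  T (Function.update f j (fun y => b j y * f j y)) x)|} ≤
              ENNReal.ofReal ((C₁ * (∏ j, l2norm (f j)) / lam) ^ ((2:ℝ)/(m:ℝ)))) →
        -- weak `L¹×⋯×L¹ → L^{1/m,∞}` bound for `T`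
        (∀ f : Fin m → Rn n → ℝ, (∀ j, Integrable (f j)) → ∀ lam : ℝ, 0 < lam →
            volume {x | lam < |T f x|} ≤
              ENNReal.ofReal ((C₂ * (∏ j, l1norm (f j)) / lam) ^ ((1:ℝ)/(m:ℝ)))) →
        ∀ f : Fin m → Rn n → ℝ, (∀ j, FiniteAtomicSum (f j)) →
        ∀ lam : ℝ, 0 < lam →
          volume {x | lam <
              |∑ j, (b j x * T f x -
                T (Function.update f j (fun y => b j y * f j y)) x)|} ≤
            ENNReal.ofReal (C * (C₀ + C₁ + C₂) ^ ((1:ℝ)/(m:ℝ)) * lam ^ (-(1:ℝ)/(m:ℝ))) := by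
  have hD := dyadicDiniSum_ne_top hω0 hωmono hω_logDini
  refine ⟨(totalConst n m ω M).toReal + 1, by positivity, ?_⟩
  intro C₀ C₁ C₂ K T b hC₀ hC₁ hC₂ hK _ hT hrep hb hM hW₁ hW₂ f hf lam hlam
  obtain ⟨α, hαdef⟩ : ∃ α, α = (lam / (C₀ + C₁ + C₂)) ^ ((1 : ℝ) / (m : ℝ)) := ⟨_, rfl⟩
  have hα : 0 < α := by rw [hαdef]; positivity
  have hαm : (C₀ + C₁ + C₂) * α ^ m = lam := by
    rw [hαdef, one_div, Real.rpow_inv_natCast_pow (by positivity) (by omega)]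
    field_simp
  have hpow : 0 < α ^ m := by positivity
  have h₀ : C₀ * α ^ m ≤ lam := by rw [← hαm]; gcongr; linarith
  have h₁ : C₁ * α ^ m ≤ lam := by rw [← hαm]; gcongr; linarith
  have h₂ : C₂ * α ^ m ≤ lam := by rw [← hαm]; gcongr; linarith
  choose N Q a c hQ ha hc hfs using hf
  choose d good Ω hfd hΩ hgrowth hfar hgood using fun k =>
    exists_good_atoms hn (hQ k) (ha k) (hc k) hα
  have hdf : ∀ k, (d k).sum Finset.univ =ᵐ[volume] f k := by
    intro k
    rw [show f k = fun x => ∑ i, c k i * a k i x from funext (hfs k)]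
    exact (hfd k).symm
  have hbound := volume_lt_abs_comm_le hC₀ hC₁ hC₂ hω0 hωmono hn hm hK hT hrep hW₁ hW₂ hb hM hM0
    hα hlam h₀ h₁ h₂ d good Ω hΩ hgrowth hfar hgood
  have hcomm := comm_congr_ae hm hT hW₂ (b := b) (fun k => (d k).integrable_sum _)
    (fun k => (d k).integrable_mul_sum _ (hb k)) hdf
  have hle : volume {x | lam < |commSum T b f x|} ≤
      volume {x | lam < |commSum T b (fun k => (d k).sum Finset.univ) x|} := by
    refine measure_mono_ae ?_
    filter_upwards [hcomm] with x hx hlt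
    change lam < |commSum T b _ x|
    rw [hx]
    exact hlt
  refine (hle.trans hbound).trans ?_
  rw [← ENNReal.ofReal_toReal (totalConst_ne_top hm hD M), ← ENNReal.ofReal_div_of_pos hα]
  refine ENNReal.ofReal_le_ofReal ?_
  have hinv : (C₀ + C₁ + C₂) ^ ((1 : ℝ) / (m : ℝ)) * lam ^ (-(1 : ℝ) / (m : ℝ)) = α⁻¹ := by
    rw [hαdef, Real.div_rpow hlam.le (by positivity), inv_div, neg_div, Real.rpow_neg hlam.le,
      ← div_eq_mul_inv]
  rw [mul_assoc, hinv, div_eq_mul_inv, ENNReal.toReal_ofReal ENNReal.toReal_nonneg]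
  gcongr
  linarith
end
end

section
/- (Christ's selection lemma.) Let n ≥ 1, α > 0, let 𝒬 be a finite collection of dyadic cubes in ℝⁿ, and let (λ_Q)_{Q ∈ 𝒬} be positive real numbers. Then there exists a finite collection 𝒮 of pairwise disjoint dyadic cubes such that: (1) for every S ∈ 𝒮, ∑_{Q ∈ 𝒬, Q ⊆ S} λ_Q ≤ 2ⁿ·α·|S|; (2) ∑_{S ∈ 𝒮} |S| ≤ α⁻¹·∑_{Q ∈ 𝒬} λ_Q; (3) the function ∑_{Q ∈ 𝒬, Q ⊄ S for every S ∈ 𝒮} λ_Q·|Q|⁻¹·χ_Q is bounded almost everywhere by α. -/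
open MeasureTheory Set
open scoped Classical

noncomputable section

/-- The dyadic cube `∏ [2^k mᵢ, 2^k (mᵢ+1))`. -/
def dyadicCube {n : ℕ} (k : ℤ) (m : Fin n → ℤ) : Set (Rn n) :=
  {x : Rn n | ∀ i, (2:ℝ) ^ k * (m i : ℝ) ≤ x i ∧ x i < (2:ℝ) ^ k * ((m i : ℝ) + 1)}

lemma isDyadicCube_iff {n : ℕ} {Q : Set (Rn n)} :
    IsDyadicCube Q ↔ ∃ k m, Q = dyadicCube k m := Iff.rfl

lemma dyadicCube_eq_preimage {n : ℕ} (k : ℤ) (m : Fin n → ℤ) :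
    dyadicCube k m = (MeasurableEquiv.toLp 2 (Fin n → ℝ)).symm ⁻¹'
      (Set.univ.pi fun i => Ico ((2:ℝ) ^ k * (m i : ℝ)) ((2:ℝ) ^ k * ((m i : ℝ) + 1))) := by
  ext x
  simp [dyadicCube]

lemma measurableSet_dyadicCube {n : ℕ} (k : ℤ) (m : Fin n → ℤ) :
    MeasurableSet (dyadicCube k m) := by
  rw [dyadicCube_eq_preimage]
  exact (MeasurableEquiv.measurable _)
    (MeasurableSet.univ_pi fun _ => measurableSet_Ico)

lemma volume_dyadicCube {n : ℕ} (k : ℤ) (m : Fin n → ℤ) :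
    volume (dyadicCube k m) = ENNReal.ofReal (((2:ℝ) ^ k) ^ n) := by
  rw [dyadicCube_eq_preimage,
    (EuclideanSpace.volume_preserving_symm_measurableEquiv_toLp (Fin n)).measure_preimage
      (MeasurableSet.univ_pi fun _ => measurableSet_Ico).nullMeasurableSet,
    Real.volume_pi_Ico]
  have h : ∀ i, (2:ℝ) ^ k * ((m i : ℝ) + 1) - (2:ℝ) ^ k * (m i : ℝ) = 2 ^ k := fun i => by ring
  simp only [h, Finset.prod_const, Finset.card_univ, Fintype.card_fin]
  rw [ENNReal.ofReal_pow (by positivity)]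

lemma toReal_volume_dyadicCube {n : ℕ} (k : ℤ) (m : Fin n → ℤ) :
    (volume (dyadicCube k m)).toReal = ((2:ℝ) ^ k) ^ n := by
  rw [volume_dyadicCube, ENNReal.toReal_ofReal (by positivity)]

lemma eq_floor_of_mem_dyadicCube {n : ℕ} {k : ℤ} {m : Fin n → ℤ} {x : Rn n}
    (hx : x ∈ dyadicCube k m) : m = fun i => ⌊x i / (2:ℝ) ^ k⌋ := by
  funext i
  have h2 : (0:ℝ) < 2 ^ k := by positivity
  obtain ⟨h, h'⟩ := hx i
  symm
  rw [Int.floor_eq_iff, le_div_iff₀ h2, div_lt_iff₀ h2]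
  constructor <;> linarith

lemma dyadicCube_subset_of_le {n : ℕ} {k k' : ℤ} {m m' : Fin n → ℤ} {x : Rn n}
    (hx : x ∈ dyadicCube k m) (hx' : x ∈ dyadicCube k' m') (hk : k ≤ k') :
    dyadicCube k m ⊆ dyadicCube k' m' := by
  obtain ⟨j, rfl⟩ := Int.le.dest hk
  have h2 : (0:ℝ) < 2 ^ k := by positivity
  have hpow : (2:ℝ) ^ (k + (j:ℤ)) = 2 ^ k * 2 ^ j := by
    rw [zpow_add₀ (by norm_num), zpow_natCast]
  intro z hz i
  obtain ⟨a, b⟩ := hx i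
  obtain ⟨a', b'⟩ := hx' i
  obtain ⟨c, d⟩ := hz i
  rw [hpow, mul_assoc] at a' b' ⊢
  rw [mul_assoc]
  have h₁ : (2:ℤ) ^ j * m' i ≤ m i := by
    have : (2:ℝ) ^ j * m' i < m i + 1 := lt_of_mul_lt_mul_left (a'.trans_lt b) h2.le
    exact Int.lt_add_one_iff.mp (by exact_mod_cast this)
  have h₂ : m i + 1 ≤ (2:ℤ) ^ j * (m' i + 1) := by
    have : (m i : ℝ) < (2:ℝ) ^ j * (m' i + 1) := lt_of_mul_lt_mul_left (a.trans_lt b') h2.le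
    exact Int.add_one_le_iff.mpr (by exact_mod_cast this)
  have h₁' : (2:ℝ) ^ j * m' i ≤ m i := by exact_mod_cast h₁
  have h₂' : (m i : ℝ) + 1 ≤ (2:ℝ) ^ j * (m' i + 1) := by exact_mod_cast h₂
  exact ⟨(mul_le_mul_of_nonneg_left h₁' h2.le).trans c,
    d.trans_le (mul_le_mul_of_nonneg_left h₂' h2.le)⟩

namespace IsDyadicCube

variable {n : ℕ} {Q S : Set (Rn n)}

lemma nonempty (hQ : IsDyadicCube Q) : Q.Nonempty := by
  obtain ⟨k, m, rfl⟩ := hQ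
  have h2 : (0:ℝ) < 2 ^ k := by positivity
  refine ⟨WithLp.toLp 2 fun i => (2:ℝ) ^ k * (m i : ℝ), fun i => ⟨le_rfl, ?_⟩⟩
  exact mul_lt_mul_of_pos_left (lt_add_one _) h2

lemma measurableSet (hQ : IsDyadicCube Q) : MeasurableSet Q := by
  obtain ⟨k, m, rfl⟩ := isDyadicCube_iff.mp hQ
  exact measurableSet_dyadicCube k m

lemma volume_ne_top (hQ : IsDyadicCube Q) : volume Q ≠ ⊤ := by
  obtain ⟨k, m, rfl⟩ := isDyadicCube_iff.mp hQ
  simp [volume_dyadicCube]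

lemma toReal_volume_pos (hQ : IsDyadicCube Q) : 0 < (volume Q).toReal := by
  obtain ⟨k, m, rfl⟩ := isDyadicCube_iff.mp hQ
  rw [toReal_volume_dyadicCube]
  positivity

lemma subset_or_subset (hQ : IsDyadicCube Q) (hS : IsDyadicCube S)
    (h : (Q ∩ S).Nonempty) : Q ⊆ S ∨ S ⊆ Q := by
  obtain ⟨x, hxQ, hxS⟩ := h
  obtain ⟨k, m, rfl⟩ := isDyadicCube_iff.mp hQ
  obtain ⟨k', m', rfl⟩ := isDyadicCube_iff.mp hS
  rcases le_total k k' with hk | hk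
  · exact Or.inl (dyadicCube_subset_of_le hxQ hxS hk)
  · exact Or.inr (dyadicCube_subset_of_le hxS hxQ hk)

lemma exists_parent (hS : IsDyadicCube S) :
    ∃ P, IsDyadicCube P ∧ S ⊆ P ∧ (volume P).toReal = 2 ^ n * (volume S).toReal := by
  obtain ⟨x, hx⟩ := hS.nonempty
  obtain ⟨k, m, rfl⟩ := isDyadicCube_iff.mp hS
  have h2 : (0:ℝ) < 2 ^ (k + 1) := by positivity
  refine ⟨dyadicCube (k + 1) fun i => ⌊x i / (2:ℝ) ^ (k + 1)⌋, ⟨_, _, rfl⟩,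
    dyadicCube_subset_of_le hx (fun i => ?_) (by omega), ?_⟩
  · rw [mul_comm, ← le_div_iff₀ h2, mul_comm, ← div_lt_iff₀ h2]
    exact ⟨Int.floor_le _, Int.lt_floor_add_one _⟩
  · rw [toReal_volume_dyadicCube, toReal_volume_dyadicCube, ← mul_pow,
      zpow_add_one₀ (by norm_num), mul_comm]

lemma finite_setOf_superset (hn : 1 ≤ n) (hQ : IsDyadicCube Q) (C : ℝ) :
    {S : Set (Rn n) | IsDyadicCube S ∧ Q ⊆ S ∧ (volume S).toReal ≤ C}.Finite := by
  obtain ⟨x, hx⟩ := hQ.nonempty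
  obtain ⟨k, m, rfl⟩ := isDyadicCube_iff.mp hQ
  obtain ⟨N, hN⟩ := pow_unbounded_of_one_lt C (one_lt_two (α := ℝ))
  refine ((finite_Icc k (N:ℤ)).image
    fun j : ℤ => dyadicCube j fun i => ⌊x i / (2:ℝ) ^ j⌋).subset ?_
  rintro S ⟨hS, hQS, hC⟩
  have hvol := ENNReal.toReal_mono hS.volume_ne_top (measure_mono (μ := volume) hQS)
  obtain ⟨k', m', rfl⟩ := isDyadicCube_iff.mp hS
  rw [toReal_volume_dyadicCube] at hC
  rw [toReal_volume_dyadicCube, toReal_volume_dyadicCube] at hvol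
  refine ⟨k', ⟨?_, ?_⟩, congrArg _ (eq_floor_of_mem_dyadicCube (hQS hx)).symm⟩
  · have := le_of_pow_le_pow_left₀ (by omega) (by positivity) hvol
    exact (zpow_le_zpow_iff_right₀ one_lt_two).mp this
  · by_contra! h
    have h₁ : (2:ℝ) ^ N ≤ 2 ^ k' := by
      rw [← zpow_natCast]
      exact zpow_le_zpow_right₀ one_le_two h.le
    have h₂ : (1:ℝ) ≤ 2 ^ k' := (one_le_pow₀ one_le_two).trans h₁
    have h₃ : (2:ℝ) ^ k' ≤ (2 ^ k') ^ n := le_self_pow₀ h₂ (by omega)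
    linarith

end IsDyadicCube

/-- Pairwise disjoint measurable subsets of `Q` have total volume at most that of `Q`. -/
lemma sum_toReal_volume_le {n : ℕ} {𝒮 : Finset (Set (Rn n))} {Q : Set (Rn n)}
    (hS : ∀ S ∈ 𝒮, MeasurableSet S)
    (hdisj : ∀ S ∈ 𝒮, ∀ S' ∈ 𝒮, S ≠ S' → Disjoint S S')
    (hQ : volume Q ≠ ⊤) (hsub : ∀ S ∈ 𝒮, S ⊆ Q) :
    ∑ S ∈ 𝒮, (volume S).toReal ≤ (volume Q).toReal := by
  rw [← ENNReal.toReal_sum fun S h => ne_top_of_le_ne_top hQ (measure_mono (hsub S h))]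
  refine ENNReal.toReal_mono hQ ?_
  have h := measure_biUnion_finset (μ := volume) (s := 𝒮) (f := id)
    (fun S h S' h' hne => hdisj S h S' h' hne) hS
  simp only [id] at h
  rw [← h]
  exact measure_mono (iUnion₂_subset hsub)

/-- **Christ's selection lemma.** Given a finite collection `𝒬` of dyadic cubes
with positive scalars `λ_Q` and `α > 0`, there is a finite collection `𝒮` of pairwise disjoint
dyadic cubes such that: (1) for each `S ∈ 𝒮`, `∑_{Q ⊆ S} λ_Q ≤ 2ⁿ α |S|`;
(2) `∑_S |S| ≤ α⁻¹ ∑_Q λ_Q`; (3) `∑_{Q ⊄ every S} λ_Q |Q|⁻¹ χ_Q ≤ α` a.e. -/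
theorem stmt5 (n : ℕ) (hn : 1 ≤ n) (α : ℝ) (hα : 0 < α)
    (𝒬 : Finset (Set (Rn n))) (h𝒬 : ∀ Q ∈ 𝒬, IsDyadicCube Q)
    (lamQ : Set (Rn n) → ℝ) (hlam : ∀ Q ∈ 𝒬, 0 < lamQ Q) :
    ∃ 𝒮 : Finset (Set (Rn n)),
      (∀ S ∈ 𝒮, IsDyadicCube S) ∧
      (∀ S ∈ 𝒮, ∀ S' ∈ 𝒮, S ≠ S' → Disjoint S S') ∧
      (∀ S ∈ 𝒮, ∑ Q ∈ 𝒬.filter (fun Q => Q ⊆ S), lamQ Q ≤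
          2 ^ n * α * (volume S).toReal) ∧
      (∑ S ∈ 𝒮, (volume S).toReal ≤ α⁻¹ * ∑ Q ∈ 𝒬, lamQ Q) ∧
      (∀ᵐ x ∂volume,
        ∑ Q ∈ 𝒬.filter (fun Q => ∀ S ∈ 𝒮, ¬ Q ⊆ S),
          lamQ Q * ((volume Q).toReal)⁻¹ * Q.indicator (fun _ => (1:ℝ)) x ≤ α) := by
  set v : Set (Rn n) → ℝ := fun S => (volume S).toReal with hv
  set mass : Set (Rn n) → ℝ := fun S => ∑ Q ∈ 𝒬.filter (fun Q => Q ⊆ S), lamQ Q with hmass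
  have mass_mono : ∀ S P, S ⊆ P → mass S ≤ mass P := fun S P h =>
    Finset.sum_le_sum_of_subset_of_nonneg
      (Finset.monotone_filter_right _ fun Q _ hQ => hQ.trans h)
      fun Q hQ _ => (hlam Q (Finset.mem_filter.mp hQ).1).le
  have hfin : {S | IsDyadicCube S ∧ (∃ Q ∈ 𝒬, Q ⊆ S) ∧ α * v S < mass S}.Finite := by
    refine (𝒬.finite_toSet.biUnion fun Q hQ =>
      (h𝒬 Q hQ).finite_setOf_superset hn (α⁻¹ * ∑ Q ∈ 𝒬, lamQ Q)).subset ?_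
    rintro S ⟨hS, ⟨Q, hQ, hQS⟩, hlt⟩
    refine mem_biUnion hQ ⟨hS, hQS, ?_⟩
    rw [le_inv_mul_iff₀ hα]
    exact hlt.le.trans (Finset.sum_le_sum_of_subset_of_nonneg (Finset.filter_subset _ _)
      fun Q hQ _ => (hlam Q hQ).le)
  -- the heavy cubes, the cubes of `𝒬` lying in none of them, and those where these pile up
  set G := hfin.toFinset with hG
  have mem_G : ∀ S, S ∈ G ↔ IsDyadicCube S ∧ (∃ Q ∈ 𝒬, Q ⊆ S) ∧ α * v S < mass S := fun S =>
    hfin.mem_toFinset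
  set R := 𝒬.filter (fun Q => ∀ S ∈ G, ¬ Q ⊆ S) with hR
  set B := R.filter (fun Q => α < ∑ Q' ∈ R.filter (fun Q' => Q ⊆ Q'), lamQ Q' * (v Q')⁻¹) with hB
  have hR𝒬 : ∀ Q ∈ R, Q ∈ 𝒬 := fun Q hQ => (Finset.mem_filter.mp hQ).1
  have hBR : ∀ Q ∈ B, Q ∈ R := fun Q hQ => (Finset.mem_filter.mp hQ).1
  have hcube : ∀ S ∈ G ∪ B, IsDyadicCube S := by
    intro S hS
    rcases Finset.mem_union.mp hS with h | h
    · exact ((mem_G S).mp h).1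
    · exact h𝒬 S (hR𝒬 S (hBR S h))
  set 𝒮 := (G ∪ B).filter (fun S => Maximal (· ∈ G ∪ B) S) with h𝒮
  have hmax : ∀ S ∈ 𝒮, Maximal (· ∈ G ∪ B) S := fun S hS => (Finset.mem_filter.mp hS).2
  have h𝒮cube : ∀ S ∈ 𝒮, IsDyadicCube S := fun S hS => hcube S (hmax S hS).prop
  have hcover : ∀ S ∈ G ∪ B, ∃ S' ∈ 𝒮, S ⊆ S' := by
    intro S hS
    obtain ⟨S', hle, hS'⟩ := (G ∪ B).exists_le_maximal hS
    exact ⟨S', Finset.mem_filter.mpr ⟨hS'.prop, hS'⟩, hle⟩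
  have heq : ∀ S ∈ 𝒮, ∀ S' ∈ 𝒮, (S ∩ S').Nonempty → S = S' := by
    intro S hS S' hS' hne
    rcases (h𝒮cube S hS).subset_or_subset (h𝒮cube S' hS') hne with h | h
    · exact (hmax S hS).eq_of_le (hmax S' hS').prop h
    · exact ((hmax S' hS').eq_of_le (hmax S hS).prop h).symm
  have hdisj : ∀ S ∈ 𝒮, ∀ S' ∈ 𝒮, S ≠ S' → Disjoint S S' := by
    intro S hS S' hS' hne
    by_contra h
    exact hne (heq S hS S' hS' (not_disjoint_iff_nonempty_inter.mp h))
  refine ⟨𝒮, h𝒮cube, hdisj, ?_, ?_, ?_⟩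
  · intro S hS
    have hvpos := (h𝒮cube S hS).toReal_volume_pos
    change mass S ≤ 2 ^ n * α * v S
    by_cases hSG : S ∈ G
    · obtain ⟨P, hP, hSP, hvP⟩ := (h𝒮cube S hS).exists_parent
      obtain ⟨_, ⟨Q, hQ, hQS⟩, _⟩ := (mem_G S).mp hSG
      have hPG : P ∉ G := by
        intro hPG
        have hEq : S = P := (hmax S hS).eq_of_le (Finset.mem_union_left _ hPG) hSP
        rw [← hEq] at hvP
        have : (2:ℝ) ≤ 2 ^ n := le_self_pow₀ one_le_two (by omega)
        nlinarith
      have hle : mass P ≤ α * v P := by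
        by_contra! h
        exact hPG ((mem_G P).mpr ⟨hP, ⟨Q, hQ, hQS.trans hSP⟩, h⟩)
      calc mass S ≤ mass P := mass_mono S P hSP
        _ ≤ α * v P := hle
        _ = 2 ^ n * α * v S := by simp only [hv, hvP]; ring
    · have hSB : S ∈ B := (Finset.mem_union.mp (hmax S hS).prop).resolve_left hSG
      have hle : mass S ≤ α * v S := by
        by_contra! h
        exact hSG ((mem_G S).mpr ⟨h𝒮cube S hS, ⟨S, hR𝒬 S (hBR S hSB), Subset.rfl⟩, h⟩)
      refine hle.trans (mul_le_mul_of_nonneg_right ?_ hvpos.le)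
      exact le_mul_of_one_le_left hα.le (one_le_pow₀ one_le_two)
  · set c : Set (Rn n) → Set (Rn n) → ℝ := fun S Q =>
      if Q ∈ R then (if S ⊆ Q then v S * (v Q)⁻¹ else 0) else (if Q ⊆ S then 1 else 0) with hc
    have hc0 : ∀ S Q, 0 ≤ c S Q := by
      intro S Q
      simp only [hc, hv]
      split_ifs <;> positivity
    have hcS : ∀ S ∈ 𝒮, α * v S ≤ ∑ Q ∈ 𝒬, lamQ Q * c S Q := by
      intro S hS
      by_cases hSG : S ∈ G
      · refine ((mem_G S).mp hSG).2.2.le.trans ?_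
        simp only [hmass]
        rw [Finset.sum_filter]
        refine Finset.sum_le_sum fun Q hQ => ?_
        split_ifs with hQS
        · have hQR : Q ∉ R := fun h => (Finset.mem_filter.mp h).2 S hSG hQS
          simp [hc, hQR, hQS]
        · exact mul_nonneg (hlam Q hQ).le (hc0 S Q)
      · have hSB : S ∈ B := (Finset.mem_union.mp (hmax S hS).prop).resolve_left hSG
        have hlt := (Finset.mem_filter.mp hSB).2
        have hvpos : 0 < v S := (h𝒮cube S hS).toReal_volume_pos
        calc α * v S
            ≤ (∑ Q ∈ R.filter (fun Q => S ⊆ Q), lamQ Q * (v Q)⁻¹) * v S :=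
              mul_le_mul_of_nonneg_right hlt.le hvpos.le
          _ = ∑ Q ∈ R.filter (fun Q => S ⊆ Q), lamQ Q * c S Q := by
              rw [Finset.sum_mul]
              refine Finset.sum_congr rfl fun Q hQ => ?_
              obtain ⟨hQR, hSQ⟩ := Finset.mem_filter.mp hQ
              simp only [hc, if_pos hQR, if_pos hSQ]
              ring
          _ ≤ ∑ Q ∈ 𝒬, lamQ Q * c S Q :=
              Finset.sum_le_sum_of_subset_of_nonneg
                (fun Q hQ => hR𝒬 Q (Finset.mem_filter.mp hQ).1)
                fun Q hQ _ => mul_nonneg (hlam Q hQ).le (hc0 S Q)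
    have hcQ : ∀ Q ∈ 𝒬, ∑ S ∈ 𝒮, c S Q ≤ 1 := by
      intro Q hQ
      by_cases hQR : Q ∈ R
      · simp only [hc, if_pos hQR]
        rw [← Finset.sum_filter, ← Finset.sum_mul, ← div_eq_mul_inv,
          div_le_one (h𝒬 Q hQ).toReal_volume_pos]
        refine sum_toReal_volume_le (fun S hS => ?_) (fun S hS S' hS' => ?_)
          (h𝒬 Q hQ).volume_ne_top fun S hS => (Finset.mem_filter.mp hS).2
        · exact (h𝒮cube S (Finset.mem_filter.mp hS).1).measurableSet
        · exact hdisj S (Finset.mem_filter.mp hS).1 S' (Finset.mem_filter.mp hS').1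
      · simp only [hc, if_neg hQR]
        rw [Finset.sum_boole]
        have : (𝒮.filter (fun S => Q ⊆ S)).card ≤ 1 := by
          rw [Finset.card_le_one]
          intro S hS S' hS'
          obtain ⟨hS, hQS⟩ := Finset.mem_filter.mp hS
          obtain ⟨hS', hQS'⟩ := Finset.mem_filter.mp hS'
          exact heq S hS S' hS' ((h𝒬 Q hQ).nonempty.mono (subset_inter hQS hQS'))
        exact_mod_cast this
    rw [le_inv_mul_iff₀ hα, Finset.mul_sum]
    calc ∑ S ∈ 𝒮, α * v S
        ≤ ∑ S ∈ 𝒮, ∑ Q ∈ 𝒬, lamQ Q * c S Q := Finset.sum_le_sum hcS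
      _ = ∑ Q ∈ 𝒬, lamQ Q * ∑ S ∈ 𝒮, c S Q := by
          rw [Finset.sum_comm]
          simp only [Finset.mul_sum]
      _ ≤ ∑ Q ∈ 𝒬, lamQ Q :=
          Finset.sum_le_sum fun Q hQ => mul_le_of_le_one_right (hlam Q hQ).le (hcQ Q hQ)
  · refine Filter.Eventually.of_forall fun x => ?_
    set T := (𝒬.filter (fun Q => ∀ S ∈ 𝒮, ¬ Q ⊆ S)).filter (fun Q => x ∈ Q) with hT
    have hsum : ∑ Q ∈ 𝒬.filter (fun Q => ∀ S ∈ 𝒮, ¬ Q ⊆ S),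
        lamQ Q * ((volume Q).toReal)⁻¹ * Q.indicator (fun _ => (1:ℝ)) x
          = ∑ Q ∈ T, lamQ Q * (v Q)⁻¹ := by
      rw [hT, Finset.sum_filter _ (fun Q => lamQ Q * (v Q)⁻¹)]
      refine Finset.sum_congr rfl fun Q _ => ?_
      by_cases h : x ∈ Q <;> simp [h, hv]
    rw [hsum]
    have hTR : ∀ Q ∈ T, Q ∈ R ∧ Q ∉ B ∧ x ∈ Q := by
      intro Q hQ
      obtain ⟨hQ, hxQ⟩ := Finset.mem_filter.mp hQ
      obtain ⟨hQ, hQS⟩ := Finset.mem_filter.mp hQ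
      refine ⟨Finset.mem_filter.mpr ⟨hQ, fun S hS hsub => ?_⟩, fun hQB => ?_, hxQ⟩
      · obtain ⟨S', hS', hSS'⟩ := hcover S (Finset.mem_union_left _ hS)
        exact hQS S' hS' (hsub.trans hSS')
      · obtain ⟨S', hS', hSS'⟩ := hcover Q (Finset.mem_union_right _ hQB)
        exact hQS S' hS' hSS'
    rcases T.eq_empty_or_nonempty with hempty | hne
    · simp [hempty, hα.le]
    · obtain ⟨Q₀, hmin⟩ := T.exists_minimal hne
      obtain ⟨hQ₀R, hQ₀B, hxQ₀⟩ := hTR Q₀ hmin.prop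
      have hle : ∑ Q ∈ R.filter (fun Q => Q₀ ⊆ Q), lamQ Q * (v Q)⁻¹ ≤ α := by
        by_contra! h
        exact hQ₀B (Finset.mem_filter.mpr ⟨hQ₀R, h⟩)
      refine le_trans (Finset.sum_le_sum_of_subset_of_nonneg (fun Q hQ => ?_)
        fun Q hQ _ => ?_) hle
      · obtain ⟨hQR, _, hxQ⟩ := hTR Q hQ
        refine Finset.mem_filter.mpr ⟨hQR, ?_⟩
        rcases (h𝒬 Q₀ (hR𝒬 Q₀ hQ₀R)).subset_or_subset (h𝒬 Q (hR𝒬 Q hQR)) ⟨x, hxQ₀, hxQ⟩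
          with h | h
        · exact h
        · exact hmin.le_of_le hQ h
      · have hQ𝒬 := hR𝒬 Q (Finset.mem_filter.mp hQ).1
        exact mul_nonneg (hlam Q hQ𝒬).le (inv_nonneg.mpr (h𝒬 Q hQ𝒬).toReal_volume_pos.le)
end
end

section
/- For every ε with 0 < ε ≤ 1, the function F(x) = 1/(x·(log₂(1/x))^{1+ε}) on (0, 1/2] fails the L log L integrability condition: ∫₀^{1/2} F(x)·(1 + log⁺F(x)) dx = ∞, where log⁺ t = max(log t, 0). -/
open MeasureTheory Set
open scoped ENNReal

/-- `1 / (x log x)` is not integrable near `0`. -/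
lemma not_integrableOn_inv_mul_log_inv :
    ¬ IntegrableOn (fun x : ℝ => x⁻¹ * (Real.log x)⁻¹) (Ioc 0 (1 / 2)) := by
  have hmem : Ioc (0 : ℝ) (1 / 2) ∈ nhdsWithin 0 (Ioi 0) := Ioc_mem_nhdsGT (by norm_num)
  have hderiv : ∀ x ∈ Ioc (0 : ℝ) (1 / 2),
      HasDerivAt (fun x => Real.log (Real.log x)) (x⁻¹ / Real.log x) x := by
    intro x ⟨h0, h1⟩
    exact (Real.hasDerivAt_log h0.ne').log (Real.log_neg h0 (by linarith)).ne
  refine not_integrableOn_of_tendsto_norm_atTop_of_deriv_isBigO_filter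
    (f := fun x => Real.log (Real.log x)) (l := nhdsWithin 0 (Ioi 0)) hmem ?_ ?_ ?_
  · filter_upwards [hmem] with x hx using (hderiv x hx).differentiableAt
  · refine tendsto_norm_atTop_atTop.comp ?_
    have := Real.tendsto_log_atTop.comp
      (Filter.tendsto_neg_atBot_atTop.comp Real.tendsto_log_nhdsGT_zero)
    simpa [Function.comp_def] using this
  · refine Filter.EventuallyEq.isBigO ?_
    filter_upwards [hmem] with x hx
    rw [(hderiv x hx).deriv, div_eq_mul_inv]

lemma log_eq_neg_logb_two_mul (x : ℝ) :
    Real.log x = -(Real.logb 2 (1 / x) * Real.log 2) := by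
  rw [Real.logb, div_mul_cancel₀ _ (Real.log_pos one_lt_two).ne', one_div, Real.log_inv, neg_neg]

/-- `1 + log⁺ (1 / (x L ^ (1 + ε)))`, where `L = log₂ (1/x)`, dominates a multiple of `L`. -/
lemma logb_div_ten_le {ε x : ℝ} (hε1 : ε ≤ 1) (hx : 0 < x)
    (hL : 1 ≤ Real.logb 2 (1 / x)) :
    Real.logb 2 (1 / x) / 10 ≤
      1 + max (Real.log (1 / (x * Real.logb 2 (1 / x) ^ (1 + ε)))) 0 := by
  have hlx := log_eq_neg_logb_two_mul x
  generalize Real.logb 2 (1 / x) = L at *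
  have hL0 : 0 < L := by linarith
  have hlogF : Real.log (1 / (x * L ^ (1 + ε))) = L * Real.log 2 - (1 + ε) * Real.log L := by
    rw [one_div, Real.log_inv, Real.log_mul hx.ne' (Real.rpow_pos_of_pos hL0 _).ne',
      Real.log_rpow hL0, hlx]
    ring
  have hlogL : Real.log L ≤ L / 8 - 1 + 3 * Real.log 2 := by
    have h := Real.log_le_sub_one_of_pos (show 0 < L / 8 by positivity)
    rw [Real.log_div hL0.ne' (by norm_num), show (8 : ℝ) = 2 ^ 3 by norm_num, Real.log_pow] at h
    norm_num at h ⊢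
    linarith
  have h2 := Real.log_two_gt_d9
  have h3 := Real.log_two_lt_d9
  have hlogL0 := Real.log_nonneg hL
  have hmul : (1 + ε) * Real.log L ≤ 2 * Real.log L := by gcongr; linarith
  have hmul2 : L * 0.69 ≤ L * Real.log 2 := by gcongr; linarith
  rw [hlogF]
  have hm1 := le_max_left (L * Real.log 2 - (1 + ε) * Real.log L) 0
  have hm2 := le_max_right (L * Real.log 2 - (1 + ε) * Real.log L) 0
  linarith

/-- For `0 < ε ≤ 1`, the function `F(x) = 1/(x (log₂(1/x))^{1+ε})` on
`(0, 1/2]` fails the `L log L` condition: `∫₀^{1/2} F(x)(1 + log⁺ F(x)) dx = ∞`. -/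
theorem stmt8 (ε : ℝ) (hε : 0 < ε) (hε1 : ε ≤ 1) :
    ∫⁻ x in Ioc (0:ℝ) (1/2),
      ENNReal.ofReal ((1 / (x * Real.logb 2 (1/x) ^ (1 + ε))) *
        (1 + max (Real.log (1 / (x * Real.logb 2 (1/x) ^ (1 + ε)))) 0)) = ⊤ := by
  have hlog2 := Real.log_pos one_lt_two
  have hmeas : Measurable fun x : ℝ => Real.log 2 / 10 * (x⁻¹ * (Real.log x)⁻¹) := by fun_prop
  have hnot : ¬ IntegrableOn (fun x : ℝ => Real.log 2 / 10 * (x⁻¹ * (Real.log x)⁻¹))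
      (Ioc 0 (1 / 2)) := by
    rw [IntegrableOn, integrable_const_mul_iff (by simp [hlog2.ne'])]
    exact not_integrableOn_inv_mul_log_inv
  have htop : ∫⁻ x in Ioc (0:ℝ) (1/2), ‖Real.log 2 / 10 * (x⁻¹ * (Real.log x)⁻¹)‖ₑ = ⊤ := by
    by_contra h
    exact hnot ⟨hmeas.aestronglyMeasurable, lt_top_iff_ne_top.2 h⟩
  rw [eq_top_iff, ← htop]
  refine setLIntegral_mono' measurableSet_Ioc fun x ⟨h0, h1⟩ => ?_
  have hL : 1 ≤ Real.logb 2 (1 / x) := by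
    rw [Real.le_logb_iff_rpow_le one_lt_two (by positivity), Real.rpow_one,
      le_div_iff₀ h0]
    linarith
  have hlogx := log_eq_neg_logb_two_mul x
  have hbound := logb_div_ten_le hε1 h0 hL
  rw [Real.enorm_eq_ofReal_abs]
  refine ENNReal.ofReal_le_ofReal ?_
  rw [hlogx]
  generalize Real.logb 2 (1 / x) = L at *
  have hL0 : 0 < L := by linarith
  have hpow : L ^ (1 + ε) ≤ L ^ 2 := by
    rw [← Real.rpow_natCast]
    exact Real.rpow_le_rpow_of_exponent_le hL (by push_cast; linarith)
  calc |Real.log 2 / 10 * (x⁻¹ * (-(L * Real.log 2))⁻¹)|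
      = 1 / (x * L ^ 2) * (L / 10) := by
        rw [inv_neg, mul_neg, mul_neg, abs_neg, abs_of_pos (by positivity)]
        field_simp
    _ ≤ _ := by gcongr
end

section
/- Fix ε > 0 and define f : [−1/2, 1/2] ∖ {0} → ℝ by f(x) = 1/(x·(log₂(1/|x|))^{1+ε}). For each integer j ≥ 1 set λ_j = f(2^{−(j+1)})/2^j = 2/(j+1)^{1+ε} and a_j(x) = (f(x)/f(2^{−(j+1)}))·2^j·(χ_{[−2^{−j}, −2^{−(j+1)}]}(x) + χ_{[2^{−(j+1)}, 2^{−j}]}(x)). Then: (i) for almost every x with 0 < |x| ≤ 1/2, f(x) = ∑_{j=1}^∞ λ_j a_j(x); (ii) ∑_{j=1}^∞ λ_j = 2·∑_{j=1}^∞ (j+1)^{−(1+ε)} < ∞; (iii) for every j, a_j vanishes outside [−2^{−j}, 2^{−j}], ∫_ℝ a_j = 0, and ‖a_j‖_{L^∞} ≤ 2^{1+ε}·2^j. -/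
open MeasureTheory Set

noncomputable section

/-- The function of Example 1.1: `f(x) = 1/(x (log₂(1/|x|))^{1+ε})`. -/
def exFun (ε : ℝ) (x : ℝ) : ℝ := 1 / (x * Real.logb 2 (1/|x|) ^ (1 + ε))

/-- The coefficients `λ_j = f(2^{-(j+1)})/2^j`. -/
def exLam (ε : ℝ) (j : ℕ) : ℝ := exFun ε ((2:ℝ) ^ (-(j:ℤ) - 1)) / 2 ^ j

/-- The building blocks
`a_j = (f/f(2^{-(j+1)}))·2^j·(χ_{[-2^{-j},-2^{-(j+1)}]} + χ_{[2^{-(j+1)},2^{-j}]})`. -/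
def exAtom (ε : ℝ) (j : ℕ) (x : ℝ) : ℝ :=
  exFun ε x / exFun ε ((2:ℝ) ^ (-(j:ℤ) - 1)) * 2 ^ j *
    (indicator (Icc (-(2:ℝ) ^ (-(j:ℤ))) (-(2:ℝ) ^ (-(j:ℤ) - 1))) (fun _ => (1:ℝ)) x +
     indicator (Icc ((2:ℝ) ^ (-(j:ℤ) - 1)) ((2:ℝ) ^ (-(j:ℤ)))) (fun _ => (1:ℝ)) x)

lemma logb_two_one_div_zpow (n : ℤ) : Real.logb 2 (1 / (2:ℝ) ^ n) = -n := by
  rw [one_div, ← zpow_neg, ← Real.rpow_intCast,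
    Real.logb_rpow two_pos (by norm_num), Int.cast_neg]

lemma exFun_neg (ε x : ℝ) : exFun ε (-x) = -exFun ε x := by
  simp only [exFun, abs_neg, neg_mul, one_div, inv_neg]

lemma exFun_dyadic (ε : ℝ) (j : ℕ) :
    exFun ε ((2:ℝ) ^ (-(j:ℤ) - 1)) = 2 * 2 ^ j / ((j:ℝ) + 1) ^ (1 + ε) := by
  have h : (2:ℝ) ^ (-(j:ℤ) - 1) = (2 * 2 ^ j)⁻¹ := by
    rw [zpow_sub₀ two_ne_zero, zpow_neg, zpow_natCast, zpow_one, mul_inv, mul_comm, div_eq_inv_mul,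
      mul_comm]
  have h2 : Real.logb 2 (1 / |(2:ℝ) ^ (-(j:ℤ) - 1)|) = (j:ℝ) + 1 := by
    rw [abs_of_pos (by positivity), logb_two_one_div_zpow]
    push_cast
    ring
  rw [exFun, h2, h, one_div, mul_inv, inv_inv, div_eq_mul_inv]

lemma exFun_dyadic_pos (ε : ℝ) (j : ℕ) : 0 < exFun ε ((2:ℝ) ^ (-(j:ℤ) - 1)) := by
  rw [exFun_dyadic]
  positivity

lemma exLam_eq (ε : ℝ) (j : ℕ) : exLam ε j = 2 / ((j:ℝ) + 1) ^ (1 + ε) := by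
  rw [exLam, exFun_dyadic]
  field_simp

lemma exAtom_eq_indicator (ε : ℝ) (j : ℕ) (x : ℝ) :
    exAtom ε j x = indicator {y : ℝ | |y| ∈ Icc ((2:ℝ) ^ (-(j:ℤ) - 1)) ((2:ℝ) ^ (-(j:ℤ)))}
      (fun y => exFun ε y / exFun ε ((2:ℝ) ^ (-(j:ℤ) - 1)) * 2 ^ j) x := by
  have hp : (0:ℝ) < (2:ℝ) ^ (-(j:ℤ) - 1) := by positivity
  simp only [exAtom, indicator, mem_Icc, mem_ofPred_eq]
  generalize exFun ε x / exFun ε ((2:ℝ) ^ (-(j:ℤ) - 1)) * 2 ^ j = c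
  rcases le_total 0 x with hx | hx
  · rw [abs_of_nonneg hx, if_neg (fun h => by linarith [h.2])]
    split_ifs <;> simp
  · rw [abs_of_nonpos hx, if_neg (c := _ ≤ x ∧ x ≤ (2:ℝ) ^ (-(j:ℤ))) (fun h => by linarith [h.1])]
    have : (-(2:ℝ) ^ (-(j:ℤ)) ≤ x ∧ x ≤ -(2:ℝ) ^ (-(j:ℤ) - 1)) ↔
        ((2:ℝ) ^ (-(j:ℤ) - 1) ≤ -x ∧ -x ≤ (2:ℝ) ^ (-(j:ℤ))) :=
      ⟨fun h => ⟨by linarith [h.2], by linarith [h.1]⟩,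
        fun h => ⟨by linarith [h.2], by linarith [h.1]⟩⟩
    simp only [this]
    split_ifs <;> simp

lemma exAtom_of_mem {ε : ℝ} {j : ℕ} {x : ℝ}
    (h : |x| ∈ Icc ((2:ℝ) ^ (-(j:ℤ) - 1)) ((2:ℝ) ^ (-(j:ℤ)))) :
    exAtom ε j x = exFun ε x / exFun ε ((2:ℝ) ^ (-(j:ℤ) - 1)) * 2 ^ j := by
  rw [exAtom_eq_indicator, indicator_of_mem (by exact h)]

lemma exAtom_of_notMem {ε : ℝ} {j : ℕ} {x : ℝ}
    (h : |x| ∉ Icc ((2:ℝ) ^ (-(j:ℤ) - 1)) ((2:ℝ) ^ (-(j:ℤ)))) :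
    exAtom ε j x = 0 := by
  rw [exAtom_eq_indicator, indicator_of_notMem (by exact h)]

lemma exAtom_neg (ε : ℝ) (j : ℕ) (x : ℝ) : exAtom ε j (-x) = -exAtom ε j x := by
  by_cases h : |x| ∈ Icc ((2:ℝ) ^ (-(j:ℤ) - 1)) ((2:ℝ) ^ (-(j:ℤ)))
  · rw [exAtom_of_mem h, exAtom_of_mem (by rwa [abs_neg]), exFun_neg]
    ring
  · rw [exAtom_of_notMem h, exAtom_of_notMem (by rwa [abs_neg]), neg_zero]

lemma integral_exAtom (ε : ℝ) (j : ℕ) : ∫ x : ℝ, exAtom ε j x = 0 := by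
  have h := integral_neg_eq_self (exAtom ε j) volume
  simp only [exAtom_neg, integral_neg] at h
  linarith

lemma abs_exAtom_le {ε : ℝ} (hε : 0 < ε) {j : ℕ} (hj : 1 ≤ j) (x : ℝ) :
    |exAtom ε j x| ≤ 2 ^ (1 + ε) * 2 ^ j := by
  by_cases h : |x| ∈ Icc ((2:ℝ) ^ (-(j:ℤ) - 1)) ((2:ℝ) ^ (-(j:ℤ)))
  swap
  · rw [exAtom_of_notMem h, abs_zero]
    positivity
  have hp : (0:ℝ) < (2:ℝ) ^ (-(j:ℤ) - 1) := by positivity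
  have hx : 0 < |x| := hp.trans_le h.1
  have hj' : (1:ℝ) ≤ j := by exact_mod_cast hj
  have hlog : (j:ℝ) ≤ Real.logb 2 (1 / |x|) := by
    have := Real.logb_le_logb_of_le (b := 2) one_lt_two (by positivity)
      (one_div_le_one_div_of_le hx h.2)
    rw [logb_two_one_div_zpow] at this
    simpa using this
  have hbase : |exFun ε x| ≤ 1 / ((2:ℝ) ^ (-(j:ℤ) - 1) * (j:ℝ) ^ (1 + ε)) := by
    rw [exFun, abs_div, abs_one, abs_mul,
      abs_of_nonneg (a := Real.logb 2 (1 / |x|) ^ (1 + ε)) (Real.rpow_nonneg (by linarith) _)]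
    have := h.1
    gcongr
  have hdy : exFun ε ((2:ℝ) ^ (-(j:ℤ) - 1)) =
      1 / ((2:ℝ) ^ (-(j:ℤ) - 1) * ((j:ℝ) + 1) ^ (1 + ε)) := by
    rw [exFun, abs_of_pos hp, logb_two_one_div_zpow]
    push_cast
    ring_nf
  have hpow : ((j:ℝ) + 1) ^ (1 + ε) ≤ 2 ^ (1 + ε) * (j:ℝ) ^ (1 + ε) := by
    rw [← Real.mul_rpow (by norm_num) (by linarith)]
    gcongr
    linarith
  rw [exAtom_of_mem h, abs_mul, abs_div, abs_of_pos (exFun_dyadic_pos ε j),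
    abs_of_pos (a := (2:ℝ) ^ j) (by positivity)]
  gcongr
  rw [div_le_iff₀ (exFun_dyadic_pos ε j)]
  refine hbase.trans ?_
  rw [hdy, mul_one_div, div_le_div_iff₀ (by positivity) (by positivity)]
  nlinarith [mul_le_mul_of_nonneg_left hpow hp.le]

lemma exLam_mul_exAtom_of_mem {ε : ℝ} {j : ℕ} {x : ℝ}
    (h : |x| ∈ Icc ((2:ℝ) ^ (-(j:ℤ) - 1)) ((2:ℝ) ^ (-(j:ℤ)))) :
    exLam ε j * exAtom ε j x = exFun ε x := by
  rw [exAtom_of_mem h, exLam]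
  have := (exFun_dyadic_pos ε j).ne'
  field_simp

lemma hasSum_exAtom (ε : ℝ) {x : ℝ} (hx : 0 < |x|) (hx2 : |x| ≤ 1/2)
    (hne : ∀ n : ℤ, |x| ≠ (2:ℝ) ^ n) :
    HasSum (fun j : {j : ℕ // 1 ≤ j} => exLam ε j * exAtom ε j x) (exFun ε x) := by
  obtain ⟨n, hn1, hn2⟩ := exists_mem_Ioc_zpow hx (one_lt_two (α := ℝ))
  have hn : n < -1 := by
    rw [← zpow_lt_zpow_iff_right₀ (one_lt_two (α := ℝ))]
    exact hn1.trans_le (by norm_num at hx2 ⊢; exact hx2)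
  obtain ⟨j, rfl⟩ : ∃ j : ℕ, n = -(j:ℤ) - 1 := ⟨(-n - 1).toNat, by omega⟩
  rw [sub_add_cancel] at hn2
  rw [← exLam_mul_exAtom_of_mem ⟨hn1.le, hn2⟩]
  refine hasSum_single (⟨j, by omega⟩ : {j : ℕ // 1 ≤ j}) fun i hi => ?_
  rw [exAtom_of_notMem, mul_zero]
  rintro ⟨h1, h2⟩
  have h3 := (zpow_lt_zpow_iff_right₀ (one_lt_two (α := ℝ))).1
    (h1.trans_lt (lt_of_le_of_ne hn2 (hne _)))
  have h4 := (zpow_lt_zpow_iff_right₀ (one_lt_two (α := ℝ))).1 (hn1.trans_le h2)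
  exact hi (Subtype.ext (by simp only; omega))

lemma ae_abs_ne_two_zpow : ∀ᵐ x : ℝ ∂volume, ∀ n : ℤ, |x| ≠ (2:ℝ) ^ n := by
  refine ae_all_iff.2 fun n => ?_
  filter_upwards [Measure.ae_ne volume ((2:ℝ) ^ n), Measure.ae_ne volume (-(2:ℝ) ^ n)]
    with x h1 h2 h
  rcases eq_or_eq_neg_of_abs_eq h with h | h
  exacts [h1 h, h2 h]

lemma exLam_eq_mul_rpow_neg (ε : ℝ) (j : ℕ) :
    exLam ε j = 2 * ((j:ℝ) + 1) ^ (-(1 + ε)) := by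
  rw [exLam_eq, Real.rpow_neg (by positivity), div_eq_mul_inv]

lemma summable_exLam {ε : ℝ} (hε : 0 < ε) : Summable (exLam ε) := by
  simp only [funext (exLam_eq_mul_rpow_neg ε)]
  have h := (summable_nat_add_iff 1).2 (Real.summable_nat_rpow.2 (by linarith : -(1 + ε) < -1))
  simpa using h.mul_left 2

/-- The atomic decomposition of the paper's Example 1.1:
(i) a.e. on `0 < |x| ≤ 1/2`, `f(x) = ∑_{j≥1} λ_j a_j(x)`;
(ii) `∑_{j≥1} λ_j = 2 ∑_{j≥1} (j+1)^{-(1+ε)} < ∞`;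
(iii) each `a_j` vanishes outside `[-2^{-j}, 2^{-j}]`, has vanishing integral, and
`‖a_j‖_∞ ≤ 2^{1+ε}·2^j`. -/
theorem stmt9 (ε : ℝ) (hε : 0 < ε) :
    (∀ᵐ x : ℝ ∂volume, 0 < |x| → |x| ≤ 1/2 →
      HasSum (fun j : {j : ℕ // 1 ≤ j} => exLam ε j * exAtom ε j x) (exFun ε x)) ∧
    ((∀ j : ℕ, 1 ≤ j → exLam ε j = 2 / ((j:ℝ) + 1) ^ (1 + ε)) ∧
      Summable (fun j : {j : ℕ // 1 ≤ j} => exLam ε j) ∧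
      ∑' j : {j : ℕ // 1 ≤ j}, exLam ε j =
        2 * ∑' j : {j : ℕ // 1 ≤ j}, (((j:ℕ):ℝ) + 1) ^ (-(1 + ε))) ∧
    (∀ j : ℕ, 1 ≤ j →
      (∀ x : ℝ, x ∉ Icc (-(2:ℝ) ^ (-(j:ℤ))) ((2:ℝ) ^ (-(j:ℤ))) → exAtom ε j x = 0) ∧
      (∫ x : ℝ, exAtom ε j x) = 0 ∧
      (∀ x : ℝ, |exAtom ε j x| ≤ 2 ^ (1 + ε) * 2 ^ j)) := by
  refine ⟨?_, ⟨fun j _ => exLam_eq ε j, (summable_exLam hε).subtype _, ?_⟩, fun j hj =>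
    ⟨fun x hx => exAtom_of_notMem fun h => hx (abs_le.1 h.2), integral_exAtom ε j,
      abs_exAtom_le hε hj⟩⟩
  · filter_upwards [ae_abs_ne_two_zpow] with x hne hx hx2
    exact hasSum_exAtom ε hx hx2 hne
  · rw [← tsum_mul_left]
    exact tsum_congr fun j => exLam_eq_mul_rpow_neg ε j
end
end
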